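/- arXiv:2201.13050 — 2 statements merged into one kernel-verified Lean document; each statement's English description precedes it below -/
import Mathlib

section
/- Let d ∈ ℕ, d ≥ 2, let κ ∈ [1/2, 1] and set q := 2(d+1)/(d−3+4κ). Then there exists a constant C > 0 such that for every Schwartz function v : ℝ^d → ℂ one has ‖v‖_q ≤ C · ‖i∂_t v − Δ_x v‖_2^{1−κ} · ‖v‖_2^{κ}, where z = (x,t) ∈ ℝ^{d−1} × ℝ are the space-time coordinates and (i∂_t v − Δ_x v)(z) := i·Dv(z)(e_d) − Σ_{i=1}^{d−1} D²v(z)(e_i, e_i), with Dv(z) and D²v(z) the first and second (Fréchet) derivatives of v at z and e_1,…,e_d the standard basis of ℝ^d. -/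
open MeasureTheory Real SchwartzMap
open scoped FourierTransform ENNReal NNReal

namespace GNS

section Planch
variable {E : Type*} [NormedAddCommGroup E] [InnerProductSpace ℝ E] [FiniteDimensional ℝ E]
  [MeasurableSpace E] [BorelSpace E]

lemma continuous_fourier {f : E → ℂ} (hf : Integrable f) : Continuous (𝓕 f) :=
  VectorFourier.fourierIntegral_continuous Real.continuous_fourierChar
    (by exact continuous_inner) hf

lemma integral_fourier_flip {f g : E → ℂ} (hf : Integrable f) (hg : Integrable g) :
    ∫ x, 𝓕 f x * g x = ∫ x, f x * 𝓕 g x := by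
  simpa using! (VectorFourier.integral_fourierIntegral_smul_eq_flip (L := innerₗ E)
        Real.continuous_fourierChar continuous_inner hf hg)

lemma fourier_toLp_ae {f : E → ℂ} (hf1 : Integrable f) (hf2 : MemLp f 2 volume) :
    ((𝓕 (hf2.toLp f) : Lp ℂ 2 (volume : Measure E)) : E → ℂ) =ᵐ[volume] 𝓕 f := by
  apply ae_eq_of_integral_contDiff_smul_eq
  · exact (Lp.memLp _).locallyIntegrable (by norm_num)
  · exact (continuous_fourier hf1).locallyIntegrable
  intro g hg hgs
  have hg' : ContDiff ℝ ((⊤:ℕ∞):WithTop ℕ∞) (fun x => (g x : ℂ)) := by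
    exact Complex.ofRealCLM.contDiff.comp hg
  have hgs' : HasCompactSupport (fun x => (g x : ℂ)) := hgs.comp_left (g := fun x : ℝ => (x : ℂ)) (by simp)
  let φ : 𝓢(E, ℂ) := hgs'.toSchwartzMap hg'
  have hφ : ∀ x, φ x = (g x : ℂ) := fun x => rfl
  have h1 := congrArg (fun T => T φ) (Lp.fourier_toTemperedDistribution_eq (hf2.toLp f))
  simp only [TemperedDistribution.fourier_apply, Lp.toTemperedDistribution_apply] at h1
  have h2 : ∫ x, (𝓕 φ) x • (hf2.toLp f) x = ∫ x, (𝓕 φ) x * f x := by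
    apply integral_congr_ae
    filter_upwards [hf2.coeFn_toLp] with x hx
    rw [hx]; rfl
  rw [h2] at h1
  simp only [Complex.real_smul]
  calc _ = ∫ x, φ x • (𝓕 (hf2.toLp f) : Lp ℂ 2 (volume : Measure E)) x := rfl
    _ = ∫ x, (𝓕 φ) x * f x := h1.symm
    _ = ∫ x, φ x * 𝓕 f x := by
      rw [SchwartzMap.fourier_coe]
      exact integral_fourier_flip φ.integrable hf1
    _ = _ := rfl

lemma eLpNorm_fourier {f : E → ℂ} (hf1 : Integrable f) (hf2 : MemLp f 2 volume) :
    eLpNorm (𝓕 f) 2 volume = eLpNorm f 2 volume := by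
  rw [← eLpNorm_congr_ae (fourier_toLp_ae hf1 hf2), ← eLpNorm_congr_ae hf2.coeFn_toLp]
  have := Lp.norm_fourier_eq (hf2.toLp f)
  rw [Lp.norm_def, Lp.norm_def] at this
  exact (ENNReal.toReal_eq_toReal_iff' (Lp.eLpNorm_ne_top _) (Lp.eLpNorm_ne_top _)).1 this

lemma memLp_fourier {f : E → ℂ} (hf1 : Integrable f) (hf2 : MemLp f 2 volume) :
    MemLp (𝓕 f) 2 volume :=
  ⟨(continuous_fourier hf1).aestronglyMeasurable, by
    rw [eLpNorm_fourier hf1 hf2]; exact hf2.2⟩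

lemma lintegral_fourier_sq {f : E → ℂ} (hf1 : Integrable f) (hf2 : MemLp f 2 volume) :
    ∫⁻ x, ‖𝓕 f x‖ₑ ^ (2:ℝ) = ∫⁻ x, ‖f x‖ₑ ^ (2:ℝ) := by
  have h := eLpNorm_fourier hf1 hf2
  rw [eLpNorm_eq_lintegral_rpow_enorm_toReal (by norm_num) (by norm_num),
    eLpNorm_eq_lintegral_rpow_enorm_toReal (by norm_num) (by norm_num)] at h
  simp only [ENNReal.toReal_ofNat] at h
  exact ENNReal.rpow_left_injective (x := 1/2) (by norm_num) h

lemma integral_fourier_star {f g : E → ℂ} (hf1 : Integrable f) (hf2 : MemLp f 2 volume)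
    (hg1 : Integrable g) (hg2 : MemLp g 2 volume) :
    ∫ x, 𝓕 f x * starRingEnd ℂ (𝓕 g x) = ∫ x, f x * starRingEnd ℂ (g x) := by
  have h := Lp.inner_fourier_eq (hg2.toLp g) (hf2.toLp f)
  rw [L2.inner_def, L2.inner_def] at h
  have e1 : ∫ x, 𝓕 f x * starRingEnd ℂ (𝓕 g x) = ∫ x, inner ℂ ((𝓕 (hg2.toLp g) : Lp ℂ 2 (volume : Measure E)) x)
      ((𝓕 (hf2.toLp f) : Lp ℂ 2 (volume : Measure E)) x) := by
    apply integral_congr_ae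
    filter_upwards [fourier_toLp_ae hf1 hf2, fourier_toLp_ae hg1 hg2] with x h1 h2
    rw [h1, h2]; rfl
  rw [e1, h]
  apply integral_congr_ae
  filter_upwards [hf2.coeFn_toLp, hg2.coeFn_toLp] with x h1 h2
  rw [h1, h2]; rfl

end Planch
end GNS

namespace GNS

lemma lintegral_Ioc_rpow {R e : ℝ} (hR : 0 ≤ R) (he : -1 < e) :
    ∫⁻ r in Set.Ioc 0 R, ENNReal.ofReal (r ^ e) = ENNReal.ofReal (R ^ (e + 1) / (e + 1)) := by
  rw [← ofReal_integral_eq_lintegral_ofReal]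
  · rw [← intervalIntegral.integral_of_le hR, integral_rpow (Or.inl he),
      Real.zero_rpow (by linarith), sub_zero]
  · exact (intervalIntegrable_iff_integrableOn_Ioc_of_le hR).1
      (intervalIntegral.intervalIntegrable_rpow' he)
  · filter_upwards [ae_restrict_mem measurableSet_Ioc] with r hr
    exact Real.rpow_nonneg hr.1.le _

lemma lintegral_Ioi_rpow_neg_two {R : ℝ} (hR : 0 < R) :
    ∫⁻ r in Set.Ioi R, ENNReal.ofReal (r ^ (-2:ℝ)) = ENNReal.ofReal (R⁻¹) := by
  rw [← ofReal_integral_eq_lintegral_ofReal]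
  · rw [integral_Ioi_rpow_of_lt (by norm_num) hR]
    congr 1
    norm_num
    rw [Real.rpow_neg_one]
  · exact integrableOn_Ioi_rpow_of_lt (by norm_num) hR
  · filter_upwards [ae_restrict_mem measurableSet_Ioi] with r hr
    exact Real.rpow_nonneg (hR.le.trans (le_of_lt hr)) _

lemma lintegral_even (g : ℝ → ℝ≥0∞) :
    ∫⁻ r, g |r| = 2 * ∫⁻ r in Set.Ioi 0, g r := by
  have h0 : ∫⁻ r, g |r| = (∫⁻ r in Set.Ioi 0, g |r|) + ∫⁻ r in (Set.Ioi (0:ℝ))ᶜ, g |r| :=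
    (lintegral_add_compl _ measurableSet_Ioi).symm
  have h1 : ∫⁻ r in Set.Ioi (0:ℝ), g |r| = ∫⁻ r in Set.Ioi 0, g r :=
    setLIntegral_congr_fun measurableSet_Ioi (fun r hr => by
      rw [abs_of_pos hr])
  have h2 : ∫⁻ r in (Set.Ioi (0:ℝ))ᶜ, g |r| = ∫⁻ r in Set.Ioi 0, g r := by
    rw [Set.compl_Ioi, setLIntegral_congr (Iio_ae_eq_Iic (a := (0:ℝ)) (μ := volume)).symm]
    have := (Measure.measurePreserving_neg (volume : Measure ℝ)).setLIntegral_comp_preimage_emb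
      (MeasurableEquiv.neg ℝ).measurableEmbedding (fun r => g |r|) (Set.Iio 0)
    rw [← this, ← h1]
    simp
  rw [h0, h1, h2, two_mul]

/-- one-dimensional symmetric Hardy-Littlewood-Sobolev inequality -/
lemma hls (p : ℝ) (hp1 : 1 < p) (hp2 : p < 2) :
    ∃ C : ℝ, 0 < C ∧ ∀ a : ℝ → ℝ≥0∞, Measurable a → (∀ t, a t ≠ ∞) → (∫⁻ t, a t ^ p) ≠ ∞ →
      ∫⁻ t, ∫⁻ s, a s * a t * ENNReal.ofReal (|t - s| ^ (-(2 - 2 / p))) ≤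
        ENNReal.ofReal C * (∫⁻ t, a t ^ p) ^ (2 / p) := by
  have hp0 : 0 < p := by linarith
  set γ : ℝ := 2 - 2 / p with hγ
  have hγ1 : γ < 1 := by
    rw [hγ]; have : 1 < 2 / p := by rw [lt_div_iff₀ hp0]; linarith
    linarith
  set q : ℝ := p / (p - 1) with hq
  have hpq : p.HolderConjugate q := Real.HolderConjugate.conjExponent hp1
  have hq0 : 0 < q := hpq.symm.pos
  have hγq : γ * q = 2 := by
    rw [hγ, hq]; have : p - 1 ≠ 0 := by linarith
    field_simp
  set C0 : ℝ := 2 / (1 - γ) + 2 ^ (1 / q) with hC0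
  have hC0p : 0 < C0 := by
    have : 0 < 1 - γ := by linarith
    positivity
  refine ⟨2 * C0, by positivity, ?_⟩
  intro a ha hafin hA
  set A := ∫⁻ t, a t ^ p with hAdef
  set k : ℝ → ℝ≥0∞ := fun r => ENNReal.ofReal (|r| ^ (-γ)) with hk
  have hkm : Measurable k := by fun_prop
  by_cases hA0 : A = 0
  · have h0 : a =ᵐ[volume] 0 := by
      have := (lintegral_eq_zero_iff (by fun_prop)).1 hA0
      filter_upwards [this] with t ht
      simpa [hp0, hp0.le, not_lt.2 hp0.le] using ht
    have : ∫⁻ t, ∫⁻ s, a s * a t * ENNReal.ofReal (|t - s| ^ (-γ)) = 0 := by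
      rw [lintegral_eq_zero_iff (by fun_prop)]
      filter_upwards [h0] with t ht
      simp [ht]
    rw [this]; exact zero_le
  -- inner estimate
  have inner : ∀ t, ∫⁻ s, min (a s) (a t) * k (t - s) ≤
      ENNReal.ofReal C0 * A ^ (2 / p - 1) * a t ^ (p - 1) := by
    intro t
    by_cases hat : a t = 0
    · simp [hat]
    obtain ⟨α, hα⟩ : ∃ α : ℝ, α = (a t).toReal := ⟨_, rfl⟩
    have hαp : 0 < α := by rw [hα]; exact ENNReal.toReal_pos hat (hafin t)
    have hαe : a t = ENNReal.ofReal α := by rw [hα, ENNReal.ofReal_toReal (hafin t)]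
    obtain ⟨B, hB⟩ : ∃ B : ℝ, B = A.toReal := ⟨_, rfl⟩
    have hBp : 0 < B := by rw [hB]; exact ENNReal.toReal_pos hA0 hA
    have hBe : A = ENNReal.ofReal B := by rw [hB, ENNReal.ofReal_toReal hA]
    set R : ℝ := B * α ^ (-p) with hR
    have hRp : 0 < R := by positivity
    set S : Set ℝ := {s | |t - s| ≤ R} with hS
    have hSm : MeasurableSet S := measurableSet_le (by fun_prop) (by fun_prop)
    have near : ∫⁻ s in S, min (a s) (a t) * k (t - s) ≤
        ENNReal.ofReal (α * (2 * (R ^ (1 - γ) / (1 - γ)))) := by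
      calc ∫⁻ s in S, min (a s) (a t) * k (t - s)
          ≤ ∫⁻ s in S, a t * k (t - s) := by
            gcongr; exact min_le_right _ _
        _ = ∫⁻ s, (fun r => a t * (Set.indicator (Set.Iic R) (fun r => ENNReal.ofReal (r ^ (-γ))) |r|)) (t - s) := by
            rw [← lintegral_indicator hSm]
            congr 1; ext s
            simp only [Set.indicator, hS, Set.mem_ofPred_eq, Set.mem_Iic, hk]
            split_ifs <;> simp
        _ = ∫⁻ r, a t * (Set.indicator (Set.Iic R) (fun r => ENNReal.ofReal (r ^ (-γ))) |r|) :=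
            lintegral_sub_left_eq_self (fun r => a t * (Set.indicator (Set.Iic R) (fun r => ENNReal.ofReal (r ^ (-γ))) |r|)) t
        _ = a t * (2 * ∫⁻ r in Set.Ioc 0 R, ENNReal.ofReal (r ^ (-γ))) := by
            rw [lintegral_const_mul' _ _ (hafin t), lintegral_even,
              setLIntegral_indicator measurableSet_Iic]
            congr 3
            rw [Set.inter_comm, Set.Ioi_inter_Iic]
        _ = _ := by
            rw [lintegral_Ioc_rpow hRp.le (by linarith), hαe, ENNReal.ofReal_mul hαp.le,
              ENNReal.ofReal_mul (by norm_num)]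
            rw [show -γ + 1 = 1 - γ by ring]
            norm_num
    have far : ∫⁻ s in Sᶜ, min (a s) (a t) * k (t - s) ≤
        ENNReal.ofReal (B ^ (1 / p) * (2 * R⁻¹) ^ (1 / q)) := by
      calc ∫⁻ s in Sᶜ, min (a s) (a t) * k (t - s)
          ≤ ∫⁻ s in Sᶜ, a s * k (t - s) := by
            gcongr; exact min_le_left _ _
        _ ≤ (∫⁻ s in Sᶜ, a s ^ p) ^ (1 / p) * (∫⁻ s in Sᶜ, k (t - s) ^ q) ^ (1 / q) :=
            ENNReal.lintegral_mul_le_Lp_mul_Lq _ hpq (by fun_prop) (by fun_prop)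
        _ ≤ A ^ (1 / p) * (∫⁻ s in Sᶜ, k (t - s) ^ q) ^ (1 / q) := by
            gcongr
            exact setLIntegral_le_lintegral _ _
        _ = A ^ (1 / p) * (ENNReal.ofReal (2 * R⁻¹)) ^ (1 / q) := by
            congr 2
            calc ∫⁻ s in Sᶜ, k (t - s) ^ q
                = ∫⁻ s, (fun r => (Set.indicator (Set.Ioi R) (fun r => ENNReal.ofReal (r ^ (-2:ℝ))) |r|)) (t - s) := by
                  rw [← lintegral_indicator hSm.compl]
                  congr 1; ext s
                  simp only [Set.indicator, hS, Set.mem_compl_iff, Set.mem_ofPred_eq, Set.mem_Ioi, hk, not_le]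
                  split_ifs with h
                  · rw [ENNReal.ofReal_rpow_of_nonneg (by positivity) hq0.le,
                      ← Real.rpow_mul (abs_nonneg _), neg_mul, hγq]
                  · rfl
              _ = ∫⁻ r, (Set.indicator (Set.Ioi R) (fun r => ENNReal.ofReal (r ^ (-2:ℝ))) |r|) :=
                  lintegral_sub_left_eq_self (fun r => (Set.indicator (Set.Ioi R) (fun r => ENNReal.ofReal (r ^ (-2:ℝ))) |r|)) t
              _ = 2 * ∫⁻ r in Set.Ioi R, ENNReal.ofReal (r ^ (-2:ℝ)) := by
                  rw [lintegral_even, setLIntegral_indicator measurableSet_Ioi]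
                  congr 3
                  rw [Set.Ioi_inter_Ioi]; simp [hRp.le]
              _ = _ := by
                  rw [lintegral_Ioi_rpow_neg_two hRp, ENNReal.ofReal_mul (by norm_num)]
                  norm_num
        _ = _ := by
            rw [hBe, ENNReal.ofReal_rpow_of_nonneg hBp.le (by positivity),
              ENNReal.ofReal_rpow_of_nonneg (by positivity) (by positivity),
              ENNReal.ofReal_mul (by positivity)]
    have e1 : α * R ^ (1 - γ) = B ^ (2 / p - 1) * α ^ (p - 1) := by
      rw [hR, Real.mul_rpow hBp.le (by positivity), ← Real.rpow_mul hαp.le]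
      have : α * (B ^ (1 - γ) * α ^ (-p * (1 - γ))) = B ^ (1 - γ) * α ^ (1 + -p * (1 - γ)) := by
        rw [Real.rpow_add hαp, Real.rpow_one]; ring
      rw [this]
      congr 2
      · rw [hγ]; ring
      · rw [hγ]; field_simp; ring
    have e2 : B ^ (1 / p) * (R⁻¹) ^ (1 / q) = B ^ (2 / p - 1) * α ^ (p - 1) := by
      have hp10 : p - 1 ≠ 0 := by linarith
      rw [hR, ← Real.rpow_neg_one, ← Real.rpow_mul (by positivity), Real.mul_rpow hBp.le (by positivity), ← Real.rpow_mul hαp.le,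
        ← mul_assoc, ← Real.rpow_add hBp]
      congr 2
      · rw [hq]; field_simp; ring
      · rw [hq]; field_simp
    rw [← lintegral_add_compl _ hSm]
    calc _ ≤ _ := add_le_add near far
      _ = ENNReal.ofReal (C0 * (B ^ (2 / p - 1) * α ^ (p - 1))) := by
        have : 0 < 1 - γ := by linarith
        rw [← ENNReal.ofReal_add (by positivity) (by positivity)]
        congr 1
        rw [Real.mul_rpow (x := 2) (y := R⁻¹) (by norm_num) (by positivity), hC0, add_mul]
        congr 1
        · rw [← e1]; ring
        · rw [← e2]; ring
      _ = _ := by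
        rw [hBe, hαe, ENNReal.ofReal_rpow_of_pos hBp, ENNReal.ofReal_rpow_of_pos hαp, mul_assoc,
          ← ENNReal.ofReal_mul (by positivity), ← ENNReal.ofReal_mul (by positivity)]
  have half : ∫⁻ t, ∫⁻ s, min (a s) (a t) * a t * k (t - s) ≤
      ENNReal.ofReal C0 * A ^ (2 / p) := by
    calc ∫⁻ t, ∫⁻ s, min (a s) (a t) * a t * k (t - s)
        = ∫⁻ t, a t * ∫⁻ s, min (a s) (a t) * k (t - s) := by
          congr 1; ext t
          rw [← lintegral_const_mul' _ _ (hafin t)]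
          congr 1; ext s; ring
      _ ≤ ∫⁻ t, a t * (ENNReal.ofReal C0 * A ^ (2 / p - 1) * a t ^ (p - 1)) := by
          gcongr with t; exact inner t
      _ = ∫⁻ t, (ENNReal.ofReal C0 * A ^ (2 / p - 1)) * a t ^ p := by
          congr 1; ext t
          have : a t ^ p = a t * a t ^ (p - 1) := by
            conv_rhs => rw [← ENNReal.rpow_one (a t), ← ENNReal.rpow_mul, one_mul]
            rw [← ENNReal.rpow_add_of_nonneg _ _ (by norm_num) (by linarith)]; congr 1; ring
          rw [this]; ring
      _ = ENNReal.ofReal C0 * A ^ (2 / p - 1) * A := by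
          rw [lintegral_const_mul _ (by fun_prop)]
      _ = _ := by
          rw [mul_assoc]; congr 1
          conv_lhs => rw [← ENNReal.rpow_one A, ← ENNReal.rpow_mul, one_mul]
          rw [← ENNReal.rpow_add _ _ hA0 hA]; congr 1; ring
  have swap : ∫⁻ t, ∫⁻ s, min (a s) (a t) * a s * k (t - s) =
      ∫⁻ t, ∫⁻ s, min (a s) (a t) * a t * k (t - s) := by
    rw [lintegral_lintegral_swap (by fun_prop)]
    congr 1; ext t; congr 1; ext s
    rw [min_comm]; congr 1
    simp only [hk]; rw [abs_sub_comm]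
  calc ∫⁻ t, ∫⁻ s, a s * a t * ENNReal.ofReal (|t - s| ^ (-γ))
      ≤ ∫⁻ t, ∫⁻ s, (min (a s) (a t) * a s * k (t - s) + min (a s) (a t) * a t * k (t - s)) := by
        gcongr with t s
        rw [← add_mul, ← mul_add]
        refine mul_le_mul_left ?_ _
        rw [← min_mul_max]
        gcongr
        exact max_le (le_add_of_nonneg_right (zero_le)) (le_add_of_nonneg_left (zero_le))
    _ = (∫⁻ t, ∫⁻ s, min (a s) (a t) * a s * k (t - s)) + ∫⁻ t, ∫⁻ s, min (a s) (a t) * a t * k (t - s) := by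
        rw [← lintegral_add_left (by fun_prop)]
        congr 1; ext t
        rw [← lintegral_add_left (by fun_prop)]
    _ ≤ ENNReal.ofReal C0 * A ^ (2 / p) + ENNReal.ofReal C0 * A ^ (2 / p) := by
        rw [swap]; gcongr
    _ = _ := by
        rw [ENNReal.ofReal_mul (by norm_num), ← two_mul, mul_assoc]; norm_num

end GNS

namespace GNS

/-- real interpolation between `L¹ → L^∞` and `L² → L²` -/
lemma marcinkiewicz {α : Type*} [MeasurableSpace α] {μ : Measure α} [SFinite μ]
    {p q : ℝ} (hpq : p.HolderConjugate q) (hp2 : p < 2)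
    {N : ℝ} (hN : 0 < N) (T : (α → ℂ) → (α → ℂ))
    (hTm : ∀ f, Integrable f μ → MemLp f 2 μ → Measurable (T f))
    (hTadd : ∀ f g, Integrable f μ → MemLp f 2 μ → Integrable g μ → MemLp g 2 μ →
      ∀ y, T (f + g) y = T f y + T g y)
    (hT1 : ∀ f, Integrable f μ → MemLp f 2 μ → ∀ y, ‖T f y‖ ≤ N * ∫ x, ‖f x‖ ∂μ)
    (hT2 : ∀ f, Integrable f μ → MemLp f 2 μ →
      ∫⁻ x, ‖T f x‖ₑ ^ (2:ℝ) ∂μ ≤ ∫⁻ x, ‖f x‖ₑ ^ (2:ℝ) ∂μ)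
    {f : α → ℂ} (hfm : Measurable f) (hf1 : Integrable f μ) (hf2 : MemLp f 2 μ) :
    ∫⁻ x, ‖T f x‖ₑ ^ q ∂μ ≤
      ENNReal.ofReal (q * (4 / (q - 2)) * (2 * N) ^ (q - 2)) * (∫⁻ x, ‖f x‖ₑ ^ p ∂μ) ^ (q - 1) := by
  have hp1 : 1 < p := hpq.lt
  have hp0 : 0 < p := hpq.pos
  have hq0 : 0 < q := hpq.symm.pos
  have hpqm : (p - 1) * (q - 1) = 1 := hpq.sub_one_mul_conj ▸ by
    have := hpq.mul_eq_add; nlinarith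
  have hq2 : 2 < q := by
    by_contra h
    push Not at h
    have : 1 < q := hpq.symm.lt
    nlinarith
  have hfp : Integrable (fun x => ‖f x‖ ^ p) μ := by
    have h2 : Integrable (fun x => ‖f x‖ ^ 2) μ := hf2.integrable_norm_pow (by norm_num)
    refine (hf1.norm.add h2).mono' (hfm.norm.pow_const p).aestronglyMeasurable ?_
    filter_upwards with x
    rw [Real.norm_of_nonneg (by positivity)]
    simp only [Pi.add_apply]
    rcases le_total (‖f x‖) 1 with h | h
    · have : ‖f x‖ ^ p ≤ ‖f x‖ := by
        rcases (norm_nonneg (f x)).eq_or_lt with h0 | h0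
        · rw [← h0, Real.zero_rpow hp0.ne']
        · calc _ ≤ ‖f x‖ ^ (1:ℝ) := Real.rpow_le_rpow_of_exponent_ge h0 h hp1.le
            _ = _ := Real.rpow_one _
      nlinarith [sq_nonneg ‖f x‖]
    · have : ‖f x‖ ^ p ≤ ‖f x‖ ^ (2:ℝ) := Real.rpow_le_rpow_of_exponent_le h hp2.le
      rw [Real.rpow_two] at this
      nlinarith [norm_nonneg (f x)]
  set a : ℝ := ∫ x, ‖f x‖ ^ p ∂μ with ha
  have hae : ∫⁻ x, ‖f x‖ₑ ^ p ∂μ = ENNReal.ofReal a := by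
    rw [ha, ofReal_integral_eq_lintegral_ofReal hfp (by filter_upwards with x; positivity)]
    congr 1; ext x
    rw [← ofReal_norm, ENNReal.ofReal_rpow_of_nonneg (norm_nonneg _) hp0.le]
  have ha0 : 0 ≤ a := integral_nonneg fun x => by positivity
  rcases ha0.eq_or_lt with ha00 | hapos
  · have h0 : f =ᵐ[μ] 0 := by
      have := (integral_eq_zero_iff_of_nonneg (fun x => by positivity) hfp).1 ha00.symm
      filter_upwards [this] with x hx
      simp only [Pi.zero_apply] at hx ⊢
      rw [Real.rpow_eq_zero (norm_nonneg _) hp0.ne'] at hx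
      exact norm_eq_zero.1 hx
    have h1 : ∫ x, ‖f x‖ ∂μ = 0 := by
      rw [integral_eq_zero_of_ae]
      filter_upwards [h0] with x hx
      simp [hx]
    have : ∀ x, T f x = 0 := fun x => by
      have := hT1 f hf1 hf2 x
      rw [h1, mul_zero] at this
      exact norm_le_zero_iff.1 this
    simp [this, hq0]
  -- main case
  have key : ∀ l : ℝ, 0 < l → μ {x | l < ‖T f x‖} ≤
      ENNReal.ofReal (4 * l ^ (-2:ℝ)) *
        ∫⁻ x, Set.indicator {x | l * ‖f x‖ ^ (p - 1) ≤ 2 * N * a} (fun x => ‖f x‖ₑ ^ (2:ℝ)) x ∂μ := by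
    intro l hl
    set S : Set α := {x | l * ‖f x‖ ^ (p - 1) ≤ 2 * N * a} with hS
    have hSm : MeasurableSet S := measurableSet_le (by fun_prop) (by fun_prop)
    have hlo1 : Integrable (S.indicator f) μ := hf1.indicator hSm
    have hlo2 : MemLp (S.indicator f) 2 μ := hf2.indicator hSm
    have hhi1 : Integrable (Sᶜ.indicator f) μ := hf1.indicator hSm.compl
    have hhi2 : MemLp (Sᶜ.indicator f) 2 μ := hf2.indicator hSm.compl
    have hsum : S.indicator f + Sᶜ.indicator f = f := Set.indicator_self_add_compl S f
    have hhi : ∀ y, ‖T (Sᶜ.indicator f) y‖ ≤ l / 2 := by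
      intro y
      refine (hT1 _ hhi1 hhi2 y).trans ?_
      have : ∫ x, ‖Sᶜ.indicator f x‖ ∂μ ≤ ∫ x, l / (2 * N * a) * ‖f x‖ ^ p ∂μ := by
        apply integral_mono hhi1.norm (hfp.const_mul _)
        intro x
        by_cases hx : x ∈ S
        · simp only [Set.indicator, Set.mem_compl_iff, hx, not_true_eq_false, if_false, norm_zero]
          positivity
        · simp only [Set.indicator, Set.mem_compl_iff, hx, not_false_eq_true, if_true]
          have hx' : 2 * N * a < l * ‖f x‖ ^ (p - 1) := by
            simpa [hS] using hx
          have hfx : 0 < ‖f x‖ := by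
            by_contra h
            have h0 : ‖f x‖ = 0 := le_antisymm (not_lt.1 h) (norm_nonneg _)
            rw [h0, Real.zero_rpow (by linarith), mul_zero] at hx'
            have : 0 < 2 * N * a := by positivity
            linarith
          have e : ‖f x‖ ^ p = ‖f x‖ ^ (p - 1) * ‖f x‖ := by
            conv_rhs => rw [← Real.rpow_add_one hfx.ne']
            congr 1; ring
          rw [e, div_mul_eq_mul_div, le_div_iff₀ (by positivity)]
          nlinarith
      rw [integral_const_mul] at this
      calc N * ∫ x, ‖Sᶜ.indicator f x‖ ∂μ ≤ N * (l / (2 * N * a) * a) := by gcongr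
        _ = l / 2 := by field_simp
    have hsub : {x | l < ‖T f x‖} ⊆ {x | ENNReal.ofReal ((l/2)^2) ≤ ‖T (S.indicator f) x‖ₑ ^ (2:ℝ)} := by
      intro x hx
      have hx' : l < ‖T f x‖ := hx
      rw [← hsum, hTadd _ _ hlo1 hlo2 hhi1 hhi2] at hx'
      have h1 := norm_add_le (T (S.indicator f) x) (T (Sᶜ.indicator f) x)
      have h2 := hhi x
      show ENNReal.ofReal ((l/2)^2) ≤ ‖T (S.indicator f) x‖ₑ ^ (2:ℝ)
      rw [← ofReal_norm, ENNReal.ofReal_rpow_of_nonneg (norm_nonneg _) (by norm_num), Real.rpow_two]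
      apply ENNReal.ofReal_le_ofReal
      gcongr
      linarith
    have hpos : ENNReal.ofReal ((l/2)^2) ≠ 0 := by
      simp; positivity
    calc μ {x | l < ‖T f x‖} ≤ _ := measure_mono hsub
      _ ≤ (∫⁻ x, ‖T (S.indicator f) x‖ₑ ^ (2:ℝ) ∂μ) / ENNReal.ofReal ((l/2)^2) :=
        meas_ge_le_lintegral_div (((hTm _ hlo1 hlo2).enorm.pow_const _).aemeasurable) hpos ENNReal.ofReal_ne_top
      _ ≤ (∫⁻ x, ‖S.indicator f x‖ₑ ^ (2:ℝ) ∂μ) / ENNReal.ofReal ((l/2)^2) := by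
        exact ENNReal.div_le_div_right (hT2 _ hlo1 hlo2) _
      _ = _ := by
        rw [ENNReal.div_eq_inv_mul, ← ENNReal.ofReal_inv_of_pos (by positivity)]
        congr 2
        · rw [Real.rpow_neg hl.le, Real.rpow_two]; field_simp; norm_num
        · ext x
          by_cases hx : x ∈ S <;> simp [hx]
  have lc := lintegral_rpow_eq_lintegral_meas_lt_mul μ (f := fun x => ‖T f x‖)
    (by filter_upwards with x; simp) (hTm f hf1 hf2).norm.aemeasurable hq0
  have lhs : ∫⁻ x, ‖T f x‖ₑ ^ q ∂μ = ∫⁻ x, ENNReal.ofReal (‖T f x‖ ^ q) ∂μ := by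
    congr 1; ext x
    rw [← ofReal_norm, ENNReal.ofReal_rpow_of_nonneg (norm_nonneg _) hq0.le]
  have hl4 : ∀ x, ∫⁻ l in Set.Ioi (0:ℝ), ENNReal.ofReal (4 * l ^ (-2:ℝ)) * ENNReal.ofReal (l ^ (q - 1)) *
        Set.indicator {x | l * ‖f x‖ ^ (p - 1) ≤ 2 * N * a} (fun x => ‖f x‖ₑ ^ (2:ℝ)) x ≤
      ENNReal.ofReal ((4 / (q - 2)) * (2 * N) ^ (q - 2) * a ^ (q - 2)) * ‖f x‖ₑ ^ p := by
    intro x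
    by_cases hx : f x = 0
    · have h0 : ∀ l : ℝ, Set.indicator {x | l * ‖f x‖ ^ (p - 1) ≤ 2 * N * a}
          (fun x => ‖f x‖ₑ ^ (2:ℝ)) x = 0 := fun l => by
        simp only [Set.indicator]; split_ifs <;> simp [hx]
      simp only [h0, mul_zero, lintegral_zero, zero_le]
    have hfx : 0 < ‖f x‖ := norm_pos_iff.2 hx
    set L : ℝ := 2 * N * a * ‖f x‖ ^ (-(p - 1)) with hL
    have hLp : 0 < L := by positivity
    have hiff : ∀ l : ℝ, l * ‖f x‖ ^ (p - 1) ≤ 2 * N * a ↔ l ≤ L := by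
      intro l
      rw [hL, Real.rpow_neg hfx.le, ← div_eq_mul_inv, le_div_iff₀ (by positivity)]
    calc _ = ∫⁻ l in Set.Ioi (0:ℝ), Set.indicator (Set.Iic L) (fun l => ENNReal.ofReal (4 * ‖f x‖ ^ 2) * ENNReal.ofReal (l ^ (q - 3))) l := by
          apply setLIntegral_congr_fun measurableSet_Ioi
          intro l hl
          have hl' : 0 < l := hl
          simp only [Set.indicator, Set.mem_ofPred_eq, Set.mem_Iic, hiff]
          split_ifs
          · rw [← ofReal_norm, ENNReal.ofReal_rpow_of_nonneg (norm_nonneg _) (by norm_num), Real.rpow_two,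
              ← ENNReal.ofReal_mul (by positivity), ← ENNReal.ofReal_mul (by positivity), ← ENNReal.ofReal_mul (by positivity)]
            congr 1
            rw [show q - 3 = -2 + (q - 1) by ring, Real.rpow_add hl']
            ring
          · simp
      _ = ENNReal.ofReal (4 * ‖f x‖ ^ 2) * ∫⁻ l in Set.Ioc 0 L, ENNReal.ofReal (l ^ (q - 3)) := by
          rw [setLIntegral_indicator measurableSet_Iic, Set.inter_comm, Set.Ioi_inter_Iic,
            lintegral_const_mul' _ _ ENNReal.ofReal_ne_top]
      _ = _ := by
          rw [lintegral_Ioc_rpow hLp.le (by linarith), ← ofReal_norm,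
            ENNReal.ofReal_rpow_of_nonneg (norm_nonneg _) hp0.le,
            ← ENNReal.ofReal_mul (by positivity), ← ENNReal.ofReal_mul]
          swap
          · have : 0 < q - 2 := by linarith
            positivity
          congr 1
          rw [hL, Real.mul_rpow (by positivity) (by positivity), Real.mul_rpow (by positivity) hapos.le,
            ← Real.rpow_mul hfx.le, show q - 3 + 1 = q - 2 by ring]
          have : ‖f x‖ ^ p = ‖f x‖ ^ 2 * ‖f x‖ ^ (-(p - 1) * (q - 2)) := by
            rw [← Real.rpow_two, ← Real.rpow_add hfx]
            congr 1
            linear_combination hpqm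
          rw [this]; ring
      _ ≤ _ := le_rfl
  rw [lhs, lc, hae]
  calc ENNReal.ofReal q * ∫⁻ l in Set.Ioi (0:ℝ), μ {x | l < ‖T f x‖} * ENNReal.ofReal (l ^ (q - 1))
      ≤ ENNReal.ofReal q * ∫⁻ l in Set.Ioi (0:ℝ), ∫⁻ x, ENNReal.ofReal (4 * l ^ (-2:ℝ)) * ENNReal.ofReal (l ^ (q - 1)) *
        Set.indicator {x | l * ‖f x‖ ^ (p - 1) ≤ 2 * N * a} (fun x => ‖f x‖ₑ ^ (2:ℝ)) x ∂μ := by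
        gcongr ENNReal.ofReal q * ?_
        apply setLIntegral_mono' measurableSet_Ioi
        intro l hl
        rw [lintegral_const_mul' _ _ (ENNReal.mul_ne_top ENNReal.ofReal_ne_top ENNReal.ofReal_ne_top)]
        calc _ ≤ _ := mul_le_mul_left (key l hl) _
          _ = _ := by ring
    _ = ENNReal.ofReal q * ∫⁻ x, (∫⁻ l in Set.Ioi (0:ℝ), ENNReal.ofReal (4 * l ^ (-2:ℝ)) * ENNReal.ofReal (l ^ (q - 1)) *
        Set.indicator {x | l * ‖f x‖ ^ (p - 1) ≤ 2 * N * a} (fun x => ‖f x‖ₑ ^ (2:ℝ)) x) ∂μ := by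
        congr 1
        apply lintegral_lintegral_swap
        apply Measurable.aemeasurable
        apply Measurable.mul (by fun_prop)
        have hm : MeasurableSet {z : ℝ × α | z.1 * ‖f z.2‖ ^ (p - 1) ≤ 2 * N * a} :=
          measurableSet_le (by fun_prop) (by fun_prop)
        have hh : Measurable (fun z : ℝ × α => ‖f z.2‖ₑ ^ (2:ℝ)) := by fun_prop
        exact hh.indicator hm
    _ ≤ ENNReal.ofReal q * ∫⁻ x, ENNReal.ofReal ((4 / (q - 2)) * (2 * N) ^ (q - 2) * a ^ (q - 2)) * ‖f x‖ₑ ^ p ∂μ := by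
        gcongr with x; exact hl4 x
    _ = _ := by
        have : 0 < q - 2 := by linarith
        rw [lintegral_const_mul' _ _ ENNReal.ofReal_ne_top, hae, ENNReal.ofReal_rpow_of_pos hapos,
          ← ENNReal.ofReal_mul (by positivity), ← ENNReal.ofReal_mul (by positivity), ← ENNReal.ofReal_mul (by positivity)]
        congr 1
        rw [show q - 1 = (q - 2) + 1 by ring, Real.rpow_add_one hapos.ne']
        ring

end GNS

namespace GNS

section Disp
variable {E : Type*} [NormedAddCommGroup E] [InnerProductSpace ℝ E] [FiniteDimensional ℝ E]
  [MeasurableSpace E] [BorelSpace E]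

lemma fourier_neg_arg (h : E → ℂ) (y : E) : 𝓕 (fun ξ => h (-ξ)) y = 𝓕 h (-y) := by
  rw [Real.fourier_eq', Real.fourier_eq', ← integral_neg_eq_self]
  simp

lemma star_fourier (g : E → ℂ) (ξ : E) :
    starRingEnd ℂ (𝓕 g ξ) = 𝓕 (fun x => starRingEnd ℂ (g x)) (-ξ) := by
  rw [Real.fourier_eq', Real.fourier_eq', ← integral_conj]
  congr 1; ext x
  simp only [smul_eq_mul, map_mul, ← Complex.exp_conj]
  congr 2
  simp only [map_mul, Complex.conj_ofReal, Complex.conj_I, inner_neg_right]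
  push_cast; ring

lemma fourier_add_fun {f g : E → ℂ} (hf : Integrable f) (hg : Integrable g) (y : E) :
    𝓕 (f + g) y = 𝓕 f y + 𝓕 g y := by
  have := VectorFourier.fourierIntegral_add (L := innerₗ E) Real.continuous_fourierChar
    (by exact continuous_inner) hf hg
  exact congrFun this y

/-- The regularised Schrödinger multiplier -/
noncomputable def mult (b : ℂ) (ξ : E) : ℂ := Complex.exp (-b * (‖ξ‖:ℂ) ^ 2)

lemma continuous_mult (b : ℂ) : Continuous (mult b : E → ℂ) := by
  unfold mult; fun_prop

lemma norm_mult_le {b : ℂ} (hb : 0 ≤ b.re) (ξ : E) : ‖mult b ξ‖ ≤ 1 := by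
  unfold mult
  rw [Complex.norm_exp, Real.exp_le_one_iff, ← Complex.ofReal_pow, Complex.re_mul_ofReal]
  have : 0 ≤ ‖ξ‖ ^ 2 := by positivity
  simp only [Complex.neg_re]
  nlinarith

lemma integrable_mult {b : ℂ} (hb : 0 < b.re) : Integrable (mult b : E → ℂ) := by
  have := GaussianFourier.integrable_cexp_neg_mul_sq_norm_add (V := E) hb 0 0
  have h2 : (mult b : E → ℂ) = fun v => Complex.exp (-b * (‖v‖:ℂ) ^ 2) := rfl
  rw [h2]
  simpa using this

lemma norm_fourier_le {f : E → ℂ} (ξ : E) : ‖𝓕 f ξ‖ ≤ ∫ x, ‖f x‖ :=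
  VectorFourier.norm_fourierIntegral_le_integral_norm _ _ _ f ξ

lemma integrable_mult_fourier {b : ℂ} (hb : 0 < b.re) {f : E → ℂ} (hf : Integrable f) :
    Integrable (fun ξ => mult b ξ * 𝓕 f ξ) :=
  (integrable_mult hb).mul_bdd (c := ∫ x, ‖f x‖) (continuous_fourier hf).aestronglyMeasurable
    (by filter_upwards with ξ; exact norm_fourier_le ξ)

lemma memLp_mult_fourier {b : ℂ} (hb : 0 < b.re) {f : E → ℂ} (hf : Integrable f)
    (hf2 : MemLp f 2 volume) : MemLp (fun ξ => mult b ξ * 𝓕 f ξ) 2 volume := by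
  refine (memLp_fourier hf hf2).mono
    ((continuous_mult b).mul (continuous_fourier hf)).aestronglyMeasurable ?_
  filter_upwards with ξ
  rw [norm_mul]
  exact mul_le_of_le_one_left (norm_nonneg _) (norm_mult_le hb.le ξ)

lemma norm_kernel_le {b : ℂ} (hb : 0 < b.re) {θ : ℝ} (hθ : θ ≠ 0) (him : |b.im| = |θ|) (x w : E) :
    ‖((π:ℂ) / b) ^ (Module.finrank ℝ E / 2 : ℂ) * Complex.exp (-(π:ℂ) ^ 2 * (‖x - w‖:ℂ) ^ 2 / b)‖
      ≤ (π / |θ|) ^ ((Module.finrank ℝ E : ℝ) / 2) := by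
  have hθ' : 0 < |θ| := abs_pos.2 hθ
  have hbn : |θ| ≤ ‖b‖ := him ▸ Complex.abs_im_le_norm b
  have e1 : ‖((π:ℂ) / b) ^ (Module.finrank ℝ E / 2 : ℂ)‖ ≤ (π / |θ|) ^ ((Module.finrank ℝ E : ℝ) / 2) := by
    have : (Module.finrank ℝ E / 2 : ℂ) = (((Module.finrank ℝ E : ℝ) / 2 : ℝ) : ℂ) := by push_cast; rfl
    rw [this, Complex.norm_cpow_real]
    apply Real.rpow_le_rpow (norm_nonneg _) _ (by positivity)
    rw [norm_div, Complex.norm_real, Real.norm_of_nonneg Real.pi_pos.le]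
    gcongr
  have e2 : ‖Complex.exp (-(π:ℂ) ^ 2 * (‖x - w‖:ℂ) ^ 2 / b)‖ ≤ 1 := by
    rw [Complex.norm_exp, Real.exp_le_one_iff]
    have : (-(π:ℂ) ^ 2 * (‖x - w‖:ℂ) ^ 2 / b) = ((-(π ^ 2 * ‖x - w‖ ^ 2) : ℝ) : ℂ) * b⁻¹ := by
      push_cast; rw [div_eq_mul_inv]; ring
    rw [this, Complex.re_ofReal_mul, Complex.inv_re]
    have : 0 ≤ b.re / Complex.normSq b := div_nonneg hb.le (Complex.normSq_nonneg _)
    have : 0 ≤ (π ^ 2 * ‖x - w‖ ^ 2) := by positivity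
    nlinarith
  rw [norm_mul]
  calc _ ≤ _ := mul_le_mul e1 e2 (norm_nonneg _) (by positivity)
    _ = _ := mul_one _

/-- regularised propagator -/
noncomputable def prop (b : ℂ) (f : E → ℂ) (y : E) : ℂ := 𝓕 (fun ξ => mult b ξ * 𝓕 f ξ) (-y)

lemma prop_eq {b : ℂ} (hb : 0 < b.re) {f : E → ℂ} (hf : Integrable f) (y : E) :
    prop b f y = ∫ x, f x * (((π:ℂ) / b) ^ (Module.finrank ℝ E / 2 : ℂ) *
      Complex.exp (-(π:ℂ) ^ 2 * (‖y - x‖:ℂ) ^ 2 / b)) := by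
  have hintg : Integrable (fun v : E ↦ Complex.exp (-b * (‖v‖:ℂ) ^ 2 + 2 * π * Complex.I * (inner ℝ y v : ℝ))) :=
    GaussianFourier.integrable_cexp_neg_mul_sq_norm_add hb _ _
  have h := integral_fourier_flip hf hintg
  simp_rw [fourier_gaussian_innerProductSpace' hb] at h
  rw [← h, prop, Real.fourier_eq']
  congr 1; ext ξ
  rw [Complex.exp_add, mult, smul_eq_mul]
  simp only [inner_neg_right]
  rw [real_inner_comm]
  have : (((-2 * π * -(inner ℝ y ξ : ℝ) : ℝ) : ℂ) * Complex.I) = 2 * π * Complex.I * (inner ℝ y ξ : ℝ) := by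
    push_cast; ring
  rw [this]; ring

lemma prop_pair {b : ℂ} (hb : 0 < b.re) {f g : E → ℂ} (hf : Integrable f) (hg : Integrable g) :
    ∫ ξ, mult b ξ * 𝓕 f ξ * starRingEnd ℂ (𝓕 g ξ) = ∫ y, prop b f y * starRingEnd ℂ (g y) := by
  simp_rw [star_fourier g]
  rw [← integral_neg_eq_self]
  simp only [neg_neg]
  have hg' : Integrable (fun x => starRingEnd ℂ (g x)) := by
    exact Complex.conjLIE.toContinuousLinearEquiv.toContinuousLinearMap.integrable_comp hg
  have h := integral_fourier_flip (integrable_mult_fourier hb hf).comp_neg hg'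
  rw [← h]
  congr 1; ext y
  rw [fourier_neg_arg (fun ξ => mult b ξ * 𝓕 f ξ)]; rfl

lemma prop_Lq {p q : ℝ} (hpq : p.HolderConjugate q) (hp2 : p < 2) {b : ℂ} (hb : 0 < b.re)
    {θ : ℝ} (hθ : θ ≠ 0) (him : |b.im| = |θ|)
    {f : E → ℂ} (hfm : Measurable f) (hf1 : Integrable f) (hf2 : MemLp f 2 volume) :
    ∫⁻ x, ‖prop b f x‖ₑ ^ q ≤
      ENNReal.ofReal (q * (4 / (q - 2)) * (2 * (π / |θ|) ^ ((Module.finrank ℝ E : ℝ) / 2)) ^ (q - 2))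
        * (∫⁻ x, ‖f x‖ₑ ^ p) ^ (q - 1) := by
  have hθ' : 0 < |θ| := abs_pos.2 hθ
  apply marcinkiewicz hpq hp2 (by positivity) (prop b) _ _ _ _ hfm hf1 hf2
  · intro f hf _
    exact ((continuous_fourier (integrable_mult_fourier hb hf)).comp continuous_neg).measurable
  · intro f g hf _ hg _ y
    unfold prop
    rw [← fourier_add_fun (integrable_mult_fourier hb hf) (integrable_mult_fourier hb hg)]
    have : (fun ξ => mult b ξ * 𝓕 (f + g) ξ) =
        (fun ξ => mult b ξ * 𝓕 f ξ) + (fun ξ => mult b ξ * 𝓕 g ξ) := by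
      ext ξ
      rw [fourier_add_fun hf hg]; simp [mul_add]
    rw [this]
  · intro f hf _ y
    rw [prop_eq hb hf, ← integral_const_mul]
    apply norm_integral_le_of_norm_le (hf.norm.const_mul _)
    filter_upwards with x
    rw [norm_mul, mul_comm]
    gcongr
    exact norm_kernel_le hb hθ him y x
  · intro f hf hf2
    have h1 := lintegral_fourier_sq (integrable_mult_fourier hb hf) (memLp_mult_fourier hb hf hf2)
    calc ∫⁻ x, ‖prop b f x‖ₑ ^ (2:ℝ) = ∫⁻ x, ‖𝓕 (fun ξ => mult b ξ * 𝓕 f ξ) x‖ₑ ^ (2:ℝ) :=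
          lintegral_neg_eq_self (fun x => ‖𝓕 (fun ξ => mult b ξ * 𝓕 f ξ) x‖ₑ ^ (2:ℝ))
      _ = ∫⁻ ξ, ‖mult b ξ * 𝓕 f ξ‖ₑ ^ (2:ℝ) := h1
      _ ≤ ∫⁻ ξ, ‖𝓕 f ξ‖ₑ ^ (2:ℝ) := by
          gcongr with ξ
          rw [enorm_le_iff_norm_le, norm_mul]
          exact mul_le_of_le_one_left (norm_nonneg _) (norm_mult_le hb.le ξ)
      _ = _ := lintegral_fourier_sq hf hf2

lemma integrable_fourier_pair {f g : E → ℂ} (hf1 : Integrable f) (hf2 : MemLp f 2 volume)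
    (hg1 : Integrable g) (hg2 : MemLp g 2 volume) :
    Integrable (fun ξ => ‖𝓕 f ξ‖ * ‖𝓕 g ξ‖) :=
  (memLp_fourier hf1 hf2).norm.integrable_mul (memLp_fourier hg1 hg2).norm

/-- dispersive bound in bilinear form -/
lemma dispersive {p q : ℝ} (hpq : p.HolderConjugate q) (hp2 : p < 2) :
    ∃ C : ℝ, 0 < C ∧ ∀ θ : ℝ, θ ≠ 0 → ∀ f g : E → ℂ, Measurable f → Integrable f →
      MemLp f 2 volume → Measurable g → Integrable g → MemLp g 2 volume →
      ‖∫ ξ, Complex.exp (Complex.I * θ * (‖ξ‖:ℂ)^2) * 𝓕 f ξ * starRingEnd ℂ (𝓕 g ξ)‖ₑ ≤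
        ENNReal.ofReal (C * |θ| ^ (-((Module.finrank ℝ E : ℝ) / 2 * (2 / p - 1)))) *
          (∫⁻ x, ‖f x‖ₑ ^ p) ^ (1 / p) * (∫⁻ x, ‖g x‖ₑ ^ p) ^ (1 / p) := by
  have hq0 : 0 < q := hpq.symm.pos
  have hp0 : 0 < p := hpq.pos
  have hq2 : 2 < q := by
    have := hpq.mul_eq_add; have := hpq.lt
    by_contra h
    push Not at h
    have : 1 < q := hpq.symm.lt
    nlinarith
  have hq2' : 0 < q - 2 := by linarith
  set n : ℝ := (Module.finrank ℝ E : ℝ) with hn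
  refine ⟨(q * (4 / (q - 2))) ^ (1 / q) * (2 * π ^ (n / 2)) ^ ((q - 2) / q), by positivity, ?_⟩
  intro θ hθ f g hfm hf1 hf2 hgm hg1 hg2
  have hθ' : 0 < |θ| := abs_pos.2 hθ
  set RHS := ENNReal.ofReal ((q * (4 / (q - 2))) ^ (1 / q) * (2 * π ^ (n / 2)) ^ ((q - 2) / q) * |θ| ^ (-(n / 2 * (2 / p - 1)))) *
          (∫⁻ x, ‖f x‖ₑ ^ p) ^ (1 / p) * (∫⁻ x, ‖g x‖ₑ ^ p) ^ (1 / p) with hRHS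
  have bound : ∀ ε : ℝ, 0 < ε →
      ‖∫ ξ, mult (ε - Complex.I * θ) ξ * 𝓕 f ξ * starRingEnd ℂ (𝓕 g ξ)‖ₑ ≤ RHS := by
    intro ε hε
    set b : ℂ := ε - Complex.I * θ with hb
    have hbre : 0 < b.re := by simp [hb, hε]
    have him : |b.im| = |θ| := by simp [hb]
    rw [prop_pair hbre hf1 hg1]
    have hpm : Measurable (prop b f) :=
      ((continuous_fourier (integrable_mult_fourier hbre hf1)).comp continuous_neg).measurable
    calc _ ≤ ∫⁻ y, ‖prop b f y * starRingEnd ℂ (g y)‖ₑ := enorm_integral_le_lintegral_enorm _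
      _ = ∫⁻ y, ‖g y‖ₑ * ‖prop b f y‖ₑ := by
          congr 1; ext y
          rw [enorm_mul, mul_comm]
          congr 1
          simp [← ofReal_norm]
      _ ≤ (∫⁻ y, ‖g y‖ₑ ^ p) ^ (1 / p) * (∫⁻ y, ‖prop b f y‖ₑ ^ q) ^ (1 / q) :=
          ENNReal.lintegral_mul_le_Lp_mul_Lq _ hpq hgm.enorm.aemeasurable hpm.enorm.aemeasurable
      _ ≤ (∫⁻ y, ‖g y‖ₑ ^ p) ^ (1 / p) * (ENNReal.ofReal (q * (4 / (q - 2)) * (2 * (π / |θ|) ^ (n / 2)) ^ (q - 2))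
        * (∫⁻ x, ‖f x‖ₑ ^ p) ^ (q - 1)) ^ (1 / q) := by
          gcongr
          exact prop_Lq hpq hp2 hbre hθ him hfm hf1 hf2
      _ = _ := by
          rw [ENNReal.mul_rpow_of_nonneg _ _ (by positivity), ← ENNReal.rpow_mul,
            ENNReal.ofReal_rpow_of_nonneg (by positivity) (by positivity), hRHS, mul_comm]
          congr 2
          · congr 1
            rw [Real.mul_rpow (by positivity) (by positivity), ← Real.rpow_mul (by positivity), mul_assoc]
            congr 1
            rw [Real.div_rpow Real.pi_pos.le hθ'.le, ← mul_div_assoc, mul_one_div,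
              Real.div_rpow (by positivity) (by positivity), div_eq_mul_inv]
            congr 1
            rw [← Real.rpow_mul hθ'.le, ← Real.rpow_neg hθ'.le]
            congr 1
            have : 1 / p = 1 - 1 / q := by
              have := hpq.inv_add_inv_eq_one; simp only [one_div]; linarith
            rw [show 2 / p = 2 * (1 / p) by ring, this]
            field_simp; ring
          · congr 1
            have : 1 / p = 1 - 1 / q := by
              have := hpq.inv_add_inv_eq_one; simp only [one_div]; linarith
            rw [this]; field_simp
  have lim : Filter.Tendsto (fun ε : ℝ => ∫ ξ, mult (ε - Complex.I * θ) ξ * 𝓕 f ξ * starRingEnd ℂ (𝓕 g ξ))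
      (nhdsWithin 0 (Set.Ioi 0))
      (nhds (∫ ξ, Complex.exp (Complex.I * θ * (‖ξ‖:ℂ)^2) * 𝓕 f ξ * starRingEnd ℂ (𝓕 g ξ))) := by
    apply tendsto_integral_filter_of_dominated_convergence (fun ξ => ‖𝓕 f ξ‖ * ‖𝓕 g ξ‖)
    · filter_upwards with ε
      exact (((continuous_mult _).mul (continuous_fourier hf1)).mul
        (Complex.continuous_conj.comp (continuous_fourier hg1))).aestronglyMeasurable
    · filter_upwards [self_mem_nhdsWithin] with ε hε
      filter_upwards with ξ
      rw [norm_mul, norm_mul, RCLike.norm_conj]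
      gcongr
      apply mul_le_of_le_one_left (norm_nonneg _) (norm_mult_le _ ξ)
      simpa using (le_of_lt hε)
    · exact integrable_fourier_pair hf1 hf2 hg1 hg2
    · filter_upwards with ξ
      apply Filter.Tendsto.mul_const
      apply Filter.Tendsto.mul_const
      have : Continuous (fun ε : ℝ => mult ((ε:ℂ) - Complex.I * θ) ξ) := by
        unfold mult; fun_prop
      have := (this.tendsto 0).mono_left (nhdsWithin_le_nhds (s := Set.Ioi 0))
      convert this using 2
      simp [mult]
  refine le_of_tendsto lim.enorm ?_
  filter_upwards [self_mem_nhdsWithin] with ε hε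
  exact bound ε hε

end Disp
end GNS

namespace GNS

section Nice
variable {E : Type*} [NormedAddCommGroup E] [InnerProductSpace ℝ E] [FiniteDimensional ℝ E]
  [MeasurableSpace E] [BorelSpace E]

/-- Spatial weight. -/
noncomputable def wt (x : E) : ℝ := (1 + ‖x‖) ^ (-((Module.finrank ℝ E : ℝ) + 1))

lemma wt_pos (x : E) : 0 < wt x := by unfold wt; positivity

lemma wt_le_one (x : E) : wt x ≤ 1 := by
  unfold wt
  apply Real.rpow_le_one_of_one_le_of_nonpos
  · linarith [norm_nonneg x]
  · have : (0:ℝ) ≤ Module.finrank ℝ E := by positivity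
    linarith

lemma integrable_wt : Integrable (wt : E → ℝ) := by
  exact integrable_one_add_norm (by linarith)

/-- Time weight. -/
noncomputable def tw (t : ℝ) : ℝ := (1 + t ^ 2)⁻¹

lemma tw_pos (t : ℝ) : 0 < tw t := by unfold tw; positivity

lemma tw_le_one (t : ℝ) : tw t ≤ 1 := by
  unfold tw
  apply inv_le_one_of_one_le₀
  nlinarith

lemma integrable_tw : Integrable tw := integrable_inv_one_add_sq

/-- Continuous space-time functions with integrable decay. -/
structure Nice (F : ℝ → E → ℂ) : Prop where
  cont : Continuous (Function.uncurry F)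
  bd : ∃ C : ℝ, 0 ≤ C ∧ ∀ t x, ‖F t x‖ ≤ C * (tw t * wt x)

variable {F : ℝ → E → ℂ}

lemma Nice.slice_cont (h : Nice F) (t : ℝ) : Continuous (F t) :=
  h.cont.comp (by fun_prop : Continuous fun x : E => (t, x))

lemma Nice.slice_int (h : Nice F) (t : ℝ) : Integrable (F t) := by
  obtain ⟨C, hC, hb⟩ := h.bd
  refine (integrable_wt.const_mul (C * tw t)).mono' (h.slice_cont t).aestronglyMeasurable ?_
  filter_upwards with x
  calc _ ≤ _ := hb t x
    _ = _ := by ring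

lemma Nice.pow_le (h : Nice F) {r : ℝ} (hr : 1 ≤ r) : ∃ K : ℝ, 0 ≤ K ∧ ∀ t x, ‖F t x‖ ^ r ≤ K * (tw t ^ r * wt x) := by
  obtain ⟨C, hC, hb⟩ := h.bd
  refine ⟨C ^ r, by positivity, fun t x => ?_⟩
  have h1 := (tw_pos t).le
  have h2 := (wt_pos x).le
  calc ‖F t x‖ ^ r ≤ (C * (tw t * wt x)) ^ r := Real.rpow_le_rpow (norm_nonneg _) (hb t x) (by linarith)
    _ = C ^ r * (tw t ^ r * wt x ^ r) := by
      rw [Real.mul_rpow hC (by positivity), Real.mul_rpow h1 h2]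
    _ ≤ _ := by
      gcongr
      exact Real.rpow_le_self_of_le_one h2 (wt_le_one x) hr

/-- r-th power slice integrals -/
lemma Nice.lint_le (h : Nice F) {r : ℝ} (hr : 1 ≤ r) :
    ∃ K : ℝ, 0 ≤ K ∧ ∀ t, ∫⁻ x, ‖F t x‖ₑ ^ r ≤ ENNReal.ofReal (K * tw t ^ r) := by
  obtain ⟨K, hK, hb⟩ := h.pow_le hr
  refine ⟨K * ∫ x : E, wt x, mul_nonneg hK (integral_nonneg fun x => (wt_pos x).le), fun t => ?_⟩
  have e : K * (∫ x : E, wt x) * tw t ^ r = ∫ x : E, K * (tw t ^ r) * wt x := by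
    rw [integral_const_mul]; ring
  rw [e, ofReal_integral_eq_lintegral_ofReal (integrable_wt.const_mul _)
    (by filter_upwards with x; have := (wt_pos x).le; have := (tw_pos t).le; positivity)]
  gcongr with x
  rw [← ofReal_norm, ENNReal.ofReal_rpow_of_nonneg (norm_nonneg _) (by linarith)]
  apply ENNReal.ofReal_le_ofReal
  rw [mul_assoc]; exact hb t x

lemma Nice.lint_ne_top (h : Nice F) {r : ℝ} (hr : 1 ≤ r) (t : ℝ) : ∫⁻ x, ‖F t x‖ₑ ^ r ≠ ∞ := by
  obtain ⟨K, hK, hb⟩ := h.lint_le hr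
  exact ne_top_of_le_ne_top ENNReal.ofReal_ne_top (hb t)

lemma Nice.slice_memLp (h : Nice F) (t : ℝ) : MemLp (F t) 2 volume := by
  refine ⟨(h.slice_cont t).aestronglyMeasurable, ?_⟩
  rw [eLpNorm_lt_top_iff_lintegral_rpow_enorm_lt_top (by norm_num) (by norm_num)]
  have := h.lint_ne_top (r := 2) (by norm_num) t
  simpa using this.lt_top

lemma Nice.lint2_ne_top (h : Nice F) {r : ℝ} (hr : 1 ≤ r) : ∫⁻ t, ∫⁻ x, ‖F t x‖ₑ ^ r ≠ ∞ := by
  obtain ⟨K, hK, hb⟩ := h.lint_le hr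
  refine ne_top_of_le_ne_top ?_ (lintegral_mono fun t => (hb t).trans
    (ENNReal.ofReal_le_ofReal (mul_le_mul_of_nonneg_left
      (Real.rpow_le_self_of_le_one (tw_pos t).le (tw_le_one t) hr) hK)))
  rw [← ofReal_integral_eq_lintegral_ofReal (integrable_tw.const_mul _)
    (by filter_upwards with t; have := (tw_pos t).le; positivity)]
  exact ENNReal.ofReal_ne_top

lemma Nice.meas_lint (h : Nice F) (r : ℝ) : Measurable fun t => ∫⁻ x, ‖F t x‖ₑ ^ r := by
  apply Measurable.lintegral_prod_right' (f := fun z : ℝ × E => ‖F z.1 z.2‖ₑ ^ r)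
  exact h.cont.measurable.enorm.pow_const r

lemma Nice.fourier_bd (h : Nice F) : ∃ K : ℝ, 0 ≤ K ∧ ∀ t ξ, ‖𝓕 (F t) ξ‖ ≤ K * tw t := by
  obtain ⟨C, hC, hb⟩ := h.bd
  refine ⟨C * ∫ x : E, wt x, mul_nonneg hC (integral_nonneg fun x => (wt_pos x).le), fun t ξ => ?_⟩
  calc _ ≤ ∫ x, ‖F t x‖ := norm_fourier_le ξ
    _ ≤ ∫ x : E, C * tw t * wt x := by
      apply integral_mono (h.slice_int t).norm (integrable_wt.const_mul _)
      intro x; simp only; rw [mul_assoc]; exact hb t x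
    _ = _ := by rw [integral_const_mul]; ring

lemma Nice.fourier_cont (h : Nice F) : Continuous fun z : ℝ × E => 𝓕 (F z.1) z.2 := by
  obtain ⟨C, hC, hb⟩ := h.bd
  simp only [Real.fourier_eq']
  apply continuous_of_dominated (bound := fun x => C * wt x)
  · intro z
    exact ((by fun_prop : Continuous fun x : E => Complex.exp (((-2 * π * inner ℝ x z.2 : ℝ):ℂ) * Complex.I)).smul
      (h.slice_cont z.1)).aestronglyMeasurable
  · intro z
    filter_upwards with x
    rw [norm_smul, Complex.norm_exp_ofReal_mul_I, one_mul]
    refine (hb _ _).trans ?_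
    have := tw_le_one z.1
    have := (wt_pos x).le
    gcongr
    exact mul_le_of_le_one_left this (tw_le_one z.1)
  · exact integrable_wt.const_mul _
  · filter_upwards with x
    have : Continuous fun z : ℝ × E => F z.1 x := h.cont.comp (by fun_prop : Continuous fun z : ℝ × E => (z.1, x))
    exact (by fun_prop : Continuous fun z : ℝ × E =>
      Complex.exp (((-2 * π * inner ℝ x z.2 : ℝ):ℂ) * Complex.I)).smul this

lemma Nice.fourier_sq (h : Nice F) (t : ℝ) : ∫⁻ ξ, ‖𝓕 (F t) ξ‖ₑ ^ (2:ℝ) = ∫⁻ x, ‖F t x‖ₑ ^ (2:ℝ) :=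
  lintegral_fourier_sq (h.slice_int t) (h.slice_memLp t)

lemma Nice.fourier_pair_le (h : Nice F) : ∃ K : ℝ, 0 ≤ K ∧ ∀ t t', ∫⁻ ξ, ‖𝓕 (F t) ξ‖ₑ * ‖𝓕 (F t') ξ‖ₑ ≤
    ENNReal.ofReal (K * (tw t * tw t')) := by
  obtain ⟨K, hK, hb⟩ := h.lint_le (r := 2) (by norm_num)
  refine ⟨K, hK, fun t t' => ?_⟩
  have hm : ∀ t, AEMeasurable (fun ξ => ‖𝓕 (F t) ξ‖ₑ) (volume : Measure E) := fun t =>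
    (continuous_fourier (h.slice_int t)).measurable.enorm.aemeasurable
  have hh := fun t => (h.fourier_sq t).trans_le (hb t)
  calc _ ≤ (∫⁻ ξ, ‖𝓕 (F t) ξ‖ₑ ^ (2:ℝ)) ^ (1/(2:ℝ)) * (∫⁻ ξ, ‖𝓕 (F t') ξ‖ₑ ^ (2:ℝ)) ^ (1/(2:ℝ)) :=
        ENNReal.lintegral_mul_le_Lp_mul_Lq _ Real.HolderConjugate.two_two (hm t) (hm t')
    _ ≤ ENNReal.ofReal (K * tw t ^ (2:ℝ)) ^ (1/(2:ℝ)) * ENNReal.ofReal (K * tw t' ^ (2:ℝ)) ^ (1/(2:ℝ)) := by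
        gcongr
        exacts [hh t, hh t']
    _ = _ := by
        have h1 := (tw_pos t).le
        have h2 := (tw_pos t').le
        rw [ENNReal.ofReal_rpow_of_nonneg (by positivity) (by norm_num),
          ENNReal.ofReal_rpow_of_nonneg (by positivity) (by norm_num), ← ENNReal.ofReal_mul (by positivity),
          ← Real.mul_rpow (by positivity) (by positivity)]
        congr 1
        rw [← Real.sqrt_eq_rpow]
        rw [show K * tw t ^ (2:ℝ) * (K * tw t' ^ (2:ℝ)) = (K * (tw t * tw t')) ^ 2 by
          rw [Real.rpow_two, Real.rpow_two]; ring]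
        exact Real.sqrt_sq (by positivity)

end Nice

section TT
variable {E : Type*} [MeasurableSpace E] {ν : Measure E} [SigmaFinite ν]

lemma tt_star (h : ℝ → E → ℂ)
    (hi : Integrable (fun z : E × (ℝ × ℝ) => h z.2.1 z.1 * starRingEnd ℂ (h z.2.2 z.1)) (ν.prod volume)) :
    ∫⁻ ξ, ‖∫ t, h t ξ‖ₑ ^ (2:ℝ) ∂ν ≤ ∫⁻ t, ∫⁻ t', ‖∫ ξ, h t ξ * starRingEnd ℂ (h t' ξ) ∂ν‖ₑ := by
  have e1 : ∀ ξ, ∫ z : ℝ × ℝ, h z.1 ξ * starRingEnd ℂ (h z.2 ξ) = ((‖∫ t, h t ξ‖ ^ 2 : ℝ) : ℂ) := by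
    intro ξ
    rw [Measure.volume_eq_prod, integral_prod_mul (fun t => h t ξ) (fun t => starRingEnd ℂ (h t ξ)), integral_conj,
      Complex.mul_conj, Complex.normSq_eq_norm_sq]
  have h1 := hi.integral_prod_left
  simp only [e1] at h1
  have h2 : Integrable (fun ξ => ‖∫ t, h t ξ‖ ^ 2) ν := by
    have := h1.re
    simpa [← Complex.ofReal_pow] using this
  have h3 : ∫⁻ ξ, ‖∫ t, h t ξ‖ₑ ^ (2:ℝ) ∂ν = ‖∫ ξ, (∫ z : ℝ × ℝ, h z.1 ξ * starRingEnd ℂ (h z.2 ξ)) ∂ν‖ₑ := by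
    simp only [e1]
    rw [integral_complex_ofReal, ← ofReal_norm, Complex.norm_real, Real.norm_of_nonneg
      (integral_nonneg fun _ => by positivity),
      ofReal_integral_eq_lintegral_ofReal h2 (by filter_upwards with ξ; positivity)]
    congr 1; ext ξ
    rw [← ofReal_norm, ENNReal.ofReal_rpow_of_nonneg (norm_nonneg _) (by norm_num), Real.rpow_two]
  rw [h3, integral_integral_swap (f := fun ξ (z : ℝ × ℝ) => h z.1 ξ * starRingEnd ℂ (h z.2 ξ)) hi]
  refine (enorm_integral_le_lintegral_enorm _).trans ?_
  have h4 := hi.integral_prod_right.aestronglyMeasurable.enorm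
  rw [Measure.volume_eq_prod, lintegral_prod _ h4]

end TT

section Str
variable {E : Type*} [NormedAddCommGroup E] [InnerProductSpace ℝ E] [FiniteDimensional ℝ E]
  [MeasurableSpace E] [BorelSpace E]

/-- one-sided damping factor -/
noncomputable def kd (μ : ℝ) (r : ℝ) : ℝ := Set.indicator (Set.Ioi 0) (fun r => Real.exp (-μ * r)) r

lemma kd_nonneg (μ r : ℝ) : 0 ≤ kd μ r := by
  unfold kd
  exact Set.indicator_nonneg (fun r _ => (Real.exp_pos _).le) r

lemma kd_le_one {μ : ℝ} (hμ : 0 < μ) (r : ℝ) : kd μ r ≤ 1 := by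
  unfold kd
  apply Set.indicator_le' (s := Set.Ioi (0:ℝ)) (f := fun r => Real.exp (-μ * r)) (g := fun _ => 1)
  · intro r hr
    rw [Real.exp_le_one_iff]
    have := mul_pos hμ hr
    linarith
  · intro r _; norm_num

lemma measurable_kd (μ : ℝ) : Measurable (kd μ) := by
  unfold kd
  exact Measurable.indicator (by fun_prop) measurableSet_Ioi

lemma lintegral_kd {μ : ℝ} (hμ : 0 < μ) (t : ℝ) :
    ∫⁻ s, ENNReal.ofReal (kd μ (t - s)) = ENNReal.ofReal (1 / μ) := by
  rw [lintegral_sub_left_eq_self (fun s => ENNReal.ofReal (kd μ s)) t]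
  have h1 : IntegrableOn (fun r => Real.exp (-μ * r)) (Set.Ioi 0) := exp_neg_integrableOn_Ioi 0 hμ
  rw [← ofReal_integral_eq_lintegral_ofReal]
  · unfold kd
    rw [integral_indicator measurableSet_Ioi, integral_exp_mul_Ioi (by linarith)]
    congr 1
    simp [neg_div]
  · exact (integrable_indicator_iff measurableSet_Ioi).2 h1
  · filter_upwards with r using kd_nonneg μ r

/-- symbol frequency -/
noncomputable def om (ξ : E) : ℝ := 4 * π ^ 2 * ‖ξ‖ ^ 2

/-- integrand of dual solution -/
noncomputable def hker (μ : ℝ) (F : ℝ → E → ℂ) (s t : ℝ) (ξ : E) : ℂ :=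
  kd μ (t - s) * Complex.exp (Complex.I * om ξ * (t - s)) * starRingEnd ℂ (𝓕 (F t) ξ)

lemma norm_hker_le {μ : ℝ} (hμ : 0 < μ) (F : ℝ → E → ℂ) (s t : ℝ) (ξ : E) :
    ‖hker μ F s t ξ‖ ≤ ‖𝓕 (F t) ξ‖ := by
  unfold hker
  rw [norm_mul, norm_mul, RCLike.norm_conj, Complex.norm_real, Real.norm_of_nonneg (kd_nonneg _ _)]
  have : ‖Complex.exp (Complex.I * om ξ * (t - s))‖ = 1 := by
    rw [show Complex.I * om ξ * (t - s) = ((om ξ * (t - s) : ℝ) : ℂ) * Complex.I by push_cast; ring]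
    exact Complex.norm_exp_ofReal_mul_I _
  rw [this, mul_one]
  exact mul_le_of_le_one_left (norm_nonneg _) (kd_le_one hμ _)

lemma measurable_hker (μ : ℝ) {F : ℝ → E → ℂ} (hF : Nice F) :
    Measurable fun z : ℝ × ℝ × E => hker μ F z.1 z.2.1 z.2.2 := by
  unfold hker om
  have h1 : Measurable fun z : ℝ × ℝ × E => (kd μ (z.2.1 - z.1) : ℂ) :=
    Complex.measurable_ofReal.comp ((measurable_kd μ).comp (by fun_prop))
  have h2 : Measurable fun z : ℝ × ℝ × E => 𝓕 (F z.2.1) z.2.2 :=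
    hF.fourier_cont.measurable.comp measurable_snd
  have h3 : Measurable fun z : ℝ × ℝ × E => starRingEnd ℂ (𝓕 (F z.2.1) z.2.2) :=
    Complex.continuous_conj.measurable.comp h2
  refine (h1.mul ?_).mul h3
  apply Continuous.measurable
  fun_prop

lemma hker_integrable {μ : ℝ} (hμ : 0 < μ) {F : ℝ → E → ℂ} (hF : Nice F) (s : ℝ) :
    Integrable (fun z : E × (ℝ × ℝ) => hker μ F s z.2.1 z.1 * starRingEnd ℂ (hker μ F s z.2.2 z.1))
      ((volume : Measure E).prod volume) := by
  have hm := measurable_hker μ hF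
  have m1 : Measurable (fun z : E × (ℝ × ℝ) => hker μ F s z.2.1 z.1) := by
    have := hm.comp (by fun_prop : Measurable fun z : E × (ℝ × ℝ) => (s, z.2.1, z.1))
    simpa only [Function.comp_def] using this
  have m2 : Measurable (fun z : E × (ℝ × ℝ) => hker μ F s z.2.2 z.1) := by
    have := hm.comp (by fun_prop : Measurable fun z : E × (ℝ × ℝ) => (s, z.2.2, z.1))
    simpa only [Function.comp_def] using this
  have m2c : Measurable (fun z : E × (ℝ × ℝ) => starRingEnd ℂ (hker μ F s z.2.2 z.1)) := by
    have := Complex.continuous_conj.measurable.comp m2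
    simpa only [Function.comp_def] using this
  have m3 : Measurable (fun z : E × (ℝ × ℝ) => hker μ F s z.2.1 z.1 * starRingEnd ℂ (hker μ F s z.2.2 z.1)) :=
    m1.mul m2c
  refine ⟨m3.aestronglyMeasurable, ?_⟩
  rw [hasFiniteIntegral_iff_enorm, lintegral_prod_symm' _ m3.enorm]
  obtain ⟨K, hK, hb⟩ := hF.fourier_pair_le
  calc _ ≤ ∫⁻ y : ℝ × ℝ, ∫⁻ ξ, ‖𝓕 (F y.1) ξ‖ₑ * ‖𝓕 (F y.2) ξ‖ₑ := by
        gcongr with y ξ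
        rw [enorm_mul]
        refine mul_le_mul' ?_ ?_
        · rw [enorm_le_iff_norm_le]; exact norm_hker_le hμ F s _ ξ
        · rw [enorm_le_iff_norm_le, RCLike.norm_conj]; exact norm_hker_le hμ F s _ ξ
    _ ≤ ∫⁻ y : ℝ × ℝ, ENNReal.ofReal (K * (tw y.1 * tw y.2)) := by
        gcongr with y; exact hb y.1 y.2
    _ < ∞ := by
        have : Integrable (fun y : ℝ × ℝ => K * (tw y.1 * tw y.2)) :=
          (integrable_tw.mul_prod integrable_tw).const_mul K
        rw [← ofReal_integral_eq_lintegral_ofReal this]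
        · exact ENNReal.ofReal_lt_top
        · filter_upwards with y
          have := tw_pos y.1; have := tw_pos y.2
          positivity

/-- dual solution (on the Fourier side) -/
noncomputable def dsol (μ : ℝ) (F : ℝ → E → ℂ) (s : ℝ) (ξ : E) : ℂ := ∫ t, hker μ F s t ξ

set_option maxHeartbeats 1600000 in
lemma strich {p q : ℝ} (hpq : p.HolderConjugate q) (hp2 : p < 2)
    (hγ : (Module.finrank ℝ E : ℝ) / 2 * (2 / p - 1) = 2 - 2 / p) :
    ∃ C : ℝ, 0 < C ∧ ∀ (F : ℝ → E → ℂ), Nice F → ∀ μ : ℝ, 0 < μ →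
      ∫⁻ s, ∫⁻ ξ, ‖dsol μ F s ξ‖ₑ ^ (2:ℝ) ≤
        ENNReal.ofReal (C / μ) * (∫⁻ t, ∫⁻ x, ‖F t x‖ₑ ^ p) ^ (2 / p) := by
  obtain ⟨C1, hC1, hd⟩ := dispersive (E := E) hpq hp2
  obtain ⟨C2, hC2, hh⟩ := hls p hpq.lt hp2
  have hp0 : 0 < p := hpq.pos
  set D : ℝ := C1 * (4 * π ^ 2) ^ (-(2 - 2 / p)) with hD
  have hD0 : 0 < D := by positivity
  refine ⟨D * C2, by positivity, fun F hF μ hμ => ?_⟩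
  set a : ℝ → ℝ≥0∞ := fun t => (∫⁻ x, ‖F t x‖ₑ ^ p) ^ (1 / p) with ha
  have ham : Measurable a := (hF.meas_lint p).pow_const _
  have hat : ∀ t, a t ≠ ∞ := fun t =>
    ENNReal.rpow_ne_top_of_nonneg (by positivity) (hF.lint_ne_top hpq.lt.le t)
  have hap : ∀ t, a t ^ p = ∫⁻ x, ‖F t x‖ₑ ^ p := fun t => by
    rw [ha]; simp only
    rw [← ENNReal.rpow_mul, one_div_mul_cancel hp0.ne', ENNReal.rpow_one]
  have hlsB := hh a ham hat (by simp only [hap]; exact hF.lint2_ne_top hpq.lt.le)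
  simp only [hap] at hlsB
  -- kernel
  set G : ℝ → ℝ → ℝ≥0∞ := fun t t' => a t' * a t * ENNReal.ofReal (|t - t'| ^ (-(2 - 2 / p))) with hG
  have hGm : Measurable (Function.uncurry G) := by
    simp only [hG, Function.uncurry_def]
    refine ((ham.comp measurable_snd).mul (ham.comp measurable_fst)).mul ?_
    apply ENNReal.measurable_ofReal.comp
    exact (by fun_prop : Measurable fun z : ℝ × ℝ => |z.1 - z.2|).pow_const _
  have pair : ∀ s t t', t' ≠ t → ‖∫ ξ, hker μ F s t ξ * starRingEnd ℂ (hker μ F s t' ξ)‖ₑ ≤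
      ENNReal.ofReal (kd μ (t - s)) * (ENNReal.ofReal D * G t t') := by
    intro s t t' htt
    have hne : t - t' ≠ 0 := sub_ne_zero.2 htt.symm
    have e : ∀ ξ : E, hker μ F s t ξ * starRingEnd ℂ (hker μ F s t' ξ) =
        ((kd μ (t - s) * kd μ (t' - s) : ℝ) : ℂ) *
        (Complex.exp (Complex.I * ((4 * π ^ 2 * (t - t') : ℝ) : ℂ) * (‖ξ‖:ℂ) ^ 2) * 𝓕 (F t') ξ *
          starRingEnd ℂ (𝓕 (F t) ξ)) := by
      intro ξ
      unfold hker om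
      simp only [map_mul, Complex.conj_conj, Complex.conj_ofReal, ← Complex.exp_conj, Complex.conj_I,
        map_sub]
      have : Complex.exp (Complex.I * ((4 * π ^ 2 * (t - t') : ℝ) : ℂ) * (‖ξ‖:ℂ) ^ 2) =
        Complex.exp (Complex.I * ((4 * π ^ 2 * ‖ξ‖ ^ 2 : ℝ) : ℂ) * (t - s)) *
          Complex.exp (-Complex.I * ((4 * π ^ 2 * ‖ξ‖ ^ 2 : ℝ) : ℂ) * (t' - s)) := by
        rw [← Complex.exp_add]; congr 1; push_cast; ring
      rw [this]; push_cast; ring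
    simp only [e]
    rw [integral_const_mul, enorm_mul]
    have hdd := hd (4 * π ^ 2 * (t - t')) (by positivity) (F t') (F t) (hF.slice_cont t').measurable
      (hF.slice_int t') (hF.slice_memLp t') (hF.slice_cont t).measurable
      (hF.slice_int t) (hF.slice_memLp t)
    refine mul_le_mul' ?_ ?_
    · rw [← ofReal_norm, Complex.norm_real]
      apply ENNReal.ofReal_le_ofReal
      rw [Real.norm_of_nonneg (mul_nonneg (kd_nonneg _ _) (kd_nonneg _ _))]
      exact mul_le_of_le_one_right (kd_nonneg _ _) (kd_le_one hμ _)
    · refine hdd.trans (le_of_eq ?_)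
      rw [hγ, abs_mul, abs_of_pos (by positivity : 0 < 4 * π ^ 2), Real.mul_rpow (by positivity) (abs_nonneg _),
        ← mul_assoc, ← hD, ENNReal.ofReal_mul hD0.le]
      simp only [hG, ha]
      ring
  calc ∫⁻ s, ∫⁻ ξ, ‖dsol μ F s ξ‖ₑ ^ (2:ℝ)
      ≤ ∫⁻ s, ∫⁻ t, ∫⁻ t', ‖∫ ξ, hker μ F s t ξ * starRingEnd ℂ (hker μ F s t' ξ)‖ₑ := by
        gcongr with s
        exact tt_star (hker μ F s) (hker_integrable hμ hF s)
    _ ≤ ∫⁻ s, ∫⁻ t, ENNReal.ofReal (kd μ (t - s)) * ∫⁻ t', ENNReal.ofReal D * G t t' := by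
        gcongr with s t
        rw [← lintegral_const_mul _ (by
          exact (hGm.of_uncurry_left (x := t)).const_mul _)]
        apply lintegral_mono_ae
        filter_upwards [compl_mem_ae_iff.2 (measure_singleton t)] with t' ht'
        exact pair s t t' ht'
    _ = ∫⁻ t, ∫⁻ s, ENNReal.ofReal (kd μ (t - s)) * ∫⁻ t', ENNReal.ofReal D * G t t' := by
        apply lintegral_lintegral_swap
        apply Measurable.aemeasurable
        apply Measurable.mul
        · have := ENNReal.measurable_ofReal.comp ((measurable_kd μ).comp
            (by fun_prop : Measurable fun z : ℝ × ℝ => z.2 - z.1))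
          simpa only [Function.comp_def, Function.uncurry_def] using this
        · have : Measurable fun t => ∫⁻ t', ENNReal.ofReal D * G t t' :=
            Measurable.lintegral_prod_right' (hGm.const_mul _)
          exact this.comp measurable_snd
    _ = ∫⁻ t, ENNReal.ofReal (1 / μ) * (ENNReal.ofReal D * ∫⁻ t', G t t') := by
        congr 1; ext t
        have hk : Measurable fun s => ENNReal.ofReal (kd μ (t - s)) := by
          have := ENNReal.measurable_ofReal.comp ((measurable_kd μ).comp
            (by fun_prop : Measurable fun s : ℝ => t - s))
          simpa only [Function.comp_def] using this
        rw [lintegral_mul_const _ hk, lintegral_kd hμ,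
          lintegral_const_mul _ hGm.of_uncurry_left]
    _ = ENNReal.ofReal (1 / μ) * (ENNReal.ofReal D * ∫⁻ t, ∫⁻ t', G t t') := by
        have : Measurable fun t => ∫⁻ t', G t t' :=
            Measurable.lintegral_prod_right' hGm
        rw [lintegral_const_mul _ (this.const_mul _), lintegral_const_mul _ this]
    _ ≤ ENNReal.ofReal (1 / μ) * (ENNReal.ofReal D * (ENNReal.ofReal C2 * (∫⁻ t, ∫⁻ x, ‖F t x‖ₑ ^ p) ^ (2 / p))) := by
        gcongr
    _ = _ := by
        rw [← mul_assoc, ← mul_assoc, ← ENNReal.ofReal_mul (by positivity), ← ENNReal.ofReal_mul (by positivity)]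
        congr 2
        field_simp

end Str
end GNS

namespace GNS

section Dual
variable {E : Type*} [NormedAddCommGroup E] [InnerProductSpace ℝ E] [FiniteDimensional ℝ E]
  [MeasurableSpace E] [BorelSpace E]

lemma Nice.int_prod {F : ℝ → E → ℂ} (h : Nice F) :
    Integrable (fun z : ℝ × E => F z.1 z.2) ((volume : Measure ℝ).prod (volume : Measure E)) := by
  obtain ⟨C, hC, hb⟩ := h.bd
  refine ((integrable_tw.mul_prod (integrable_wt (E := E))).const_mul C).mono'
    h.cont.aestronglyMeasurable ?_
  filter_upwards with z using hb z.1 z.2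

lemma Nice.fourier_memLp {F : ℝ → E → ℂ} (h : Nice F) :
    MemLp (fun z : ℝ × E => 𝓕 (F z.1) z.2) 2 ((volume : Measure ℝ).prod (volume : Measure E)) := by
  refine ⟨h.fourier_cont.aestronglyMeasurable, ?_⟩
  rw [eLpNorm_lt_top_iff_lintegral_rpow_enorm_lt_top (by norm_num) (by norm_num)]
  rw [lintegral_prod _ (h.fourier_cont.measurable.enorm.pow_const _).aemeasurable]
  have := h.lint2_ne_top (r := 2) (by norm_num)
  have e := fun t => h.fourier_sq t
  simp only [← e] at this
  simpa using this.lt_top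

lemma Nice.fourier_lint_sq {F : ℝ → E → ℂ} (h : Nice F) :
    ∫⁻ z, ‖𝓕 (F z.1) z.2‖ₑ ^ (2:ℝ) ∂((volume : Measure ℝ).prod (volume : Measure E))
      = ∫⁻ t, ∫⁻ x, ‖F t x‖ₑ ^ (2:ℝ) := by
  rw [lintegral_prod _ (h.fourier_cont.measurable.enorm.pow_const _).aemeasurable]
  have e := fun t => h.fourier_sq t
  simp only [← e]

lemma fourier_hasDerivAt {V Vt : ℝ → E → ℂ} (hV : Nice V) (hVt : Nice Vt)
    (hd : ∀ t x, HasDerivAt (fun t => V t x) (Vt t x) t) (ξ : E) (t : ℝ) :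
    HasDerivAt (fun t => 𝓕 (V t) ξ) (𝓕 (Vt t) ξ) t := by
  obtain ⟨C, hC, hb⟩ := hVt.bd
  simp only [Real.fourier_eq']
  have hc : Continuous fun x : E => Complex.exp (((-2 * π * inner ℝ x ξ : ℝ):ℂ) * Complex.I) := by fun_prop
  refine (hasDerivAt_integral_of_dominated_loc_of_deriv_le (μ := (volume : Measure E)) (s := Set.univ)
    (F := fun t x => Complex.exp (((-2 * π * inner ℝ x ξ : ℝ):ℂ) * Complex.I) • V t x)
    (F' := fun t x => Complex.exp (((-2 * π * inner ℝ x ξ : ℝ):ℂ) * Complex.I) • Vt t x)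
    (bound := fun x => C * wt x) Filter.univ_mem ?_ ?_ ?_ ?_ ?_ ?_).2
  · filter_upwards with s using (hc.smul (hV.slice_cont s)).aestronglyMeasurable
  · refine (hV.slice_int t).mono (hc.smul (hV.slice_cont t)).aestronglyMeasurable ?_
    filter_upwards with x
    rw [norm_smul, Complex.norm_exp_ofReal_mul_I, one_mul]
  · exact (hc.smul (hVt.slice_cont t)).aestronglyMeasurable
  · filter_upwards with x s _
    rw [norm_smul, Complex.norm_exp_ofReal_mul_I, one_mul]
    refine (hb _ _).trans ?_
    have := (wt_pos x).le
    gcongr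
    exact mul_le_of_le_one_left this (tw_le_one s)
  · exact integrable_wt.const_mul _
  · filter_upwards with x s _
    exact (hd s x).const_smul (Complex.exp (((-2 * π * inner ℝ x ξ : ℝ):ℂ) * Complex.I))

lemma tendsto_tw : Filter.Tendsto tw Filter.atBot (nhds 0) := by
  unfold tw
  apply Filter.Tendsto.inv_tendsto_atTop
  apply Filter.tendsto_atTop_add_const_left
  have := (Filter.tendsto_pow_atTop (α := ℝ) two_ne_zero).comp Filter.tendsto_abs_atBot_atTop
  simpa [Function.comp_def] using this

lemma ode_solve {μ : ℝ} (hμ : 0 < μ) (w : ℝ) {a a' : ℝ → ℂ} (hd : ∀ t, HasDerivAt a (a' t) t)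
    {K : ℝ} (hK : 0 ≤ K) (ha : ∀ t, ‖a t‖ ≤ K * tw t) (ha' : ∀ t, ‖a' t‖ ≤ K * tw t) (hc : Continuous a') (t : ℝ) :
    ∫ s, (Complex.I * a' s + (w + Complex.I * μ) * a s) *
      (kd μ (t - s) * Complex.exp (Complex.I * w * (t - s))) = Complex.I * a t := by
  have hca : Continuous a := continuous_iff_continuousAt.2 fun t => (hd t).continuousAt
  set c : ℂ := μ - Complex.I * w with hcdef
  have hexp : ∀ s, s ≤ t → ‖Complex.exp (-c * (t - s))‖ ≤ 1 := by
    intro s hs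
    rw [Complex.norm_exp, Real.exp_le_one_iff, ← Complex.ofReal_sub, Complex.re_mul_ofReal]
    simp [hcdef]
    exact mul_nonneg hμ.le (by linarith)
  have h1 : ∀ s, (Complex.I * a' s + (w + Complex.I * μ) * a s) *
      (kd μ (t - s) * Complex.exp (Complex.I * w * (t - s))) =
      Set.indicator (Set.Iio t) (fun s => Complex.I * (Complex.exp (-c * (t - s)) * (c * a s + a' s))) s := by
    intro s
    unfold kd
    by_cases hs : s < t
    · rw [Set.indicator_of_mem (show t - s ∈ Set.Ioi (0:ℝ) from sub_pos.2 hs),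
        Set.indicator_of_mem (show s ∈ Set.Iio t from hs)]
      have : Complex.exp (-c * (t - s)) = ((Real.exp (-μ * (t - s)) : ℝ) : ℂ) * Complex.exp (Complex.I * w * (t - s)) := by
        rw [Complex.ofReal_exp, ← Complex.exp_add]
        congr 1; rw [hcdef]; push_cast; ring
      rw [this, hcdef]
      ring_nf
      rw [Complex.I_sq]; ring
    · rw [Set.indicator_of_notMem (show t - s ∉ Set.Ioi (0:ℝ) from fun h => hs (sub_pos.1 h)),
        Set.indicator_of_notMem (show s ∉ Set.Iio t from hs)]
      simp
  simp only [h1]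
  rw [integral_indicator measurableSet_Iio, integral_const_mul, ← integral_Iic_eq_integral_Iio]
  congr 1
  have hder : ∀ s : ℝ, HasDerivAt (fun s : ℝ => Complex.exp (-c * (t - s)) * a s)
      (Complex.exp (-c * (t - s)) * (c * a s + a' s)) s := by
    intro s
    have e1 : HasDerivAt (fun s : ℝ => -c * ((t:ℂ) - s)) c s := by
      have := ((hasDerivAt_id s).ofReal_comp.const_sub (t:ℂ)).const_mul (-c)
      simpa using this
    have := e1.cexp.mul (hd s)
    exact this.congr_deriv (by ring)
  have hI := integral_Iic_of_hasDerivAt_of_tendsto' (a := t) (m := (0:ℂ))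
    (f := fun s : ℝ => Complex.exp (-c * (t - s)) * a s) (fun s _ => hder s) ?_ ?_
  · rw [hI]; simp
  · have : Integrable (fun s => (‖c‖ * K + K) * tw s) := integrable_tw.const_mul _
    refine this.integrableOn.mono' (by
      apply Continuous.aestronglyMeasurable; fun_prop) ?_
    filter_upwards [ae_restrict_mem measurableSet_Iic] with s hs
    rw [norm_mul]
    calc _ ≤ 1 * (‖c‖ * (K * tw s) + K * tw s) := by
          gcongr
          · exact hexp s hs
          · refine (norm_add_le _ _).trans ?_
            rw [norm_mul]
            gcongr
            exacts [ha s, ha' s]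
      _ = _ := by ring
  · apply squeeze_zero_norm' (a := fun s => K * tw s)
    · filter_upwards [Filter.eventually_le_atBot t] with s hs
      rw [norm_mul]
      exact (mul_le_of_le_one_left (norm_nonneg _) (hexp s hs)).trans (ha s)
    · simpa using tendsto_tw.const_mul K

lemma measurable_dsol (μ : ℝ) {F : ℝ → E → ℂ} (hF : Nice F) :
    Measurable fun z : ℝ × E => dsol μ F z.1 z.2 := by
  unfold dsol
  have hm : Measurable fun z : (ℝ × E) × ℝ => hker μ F z.1.1 z.2 z.1.2 := by
    have := (measurable_hker μ hF).comp (by fun_prop : Measurable fun z : (ℝ × E) × ℝ => (z.1.1, z.2, z.1.2))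
    simpa only [Function.comp_def] using this
  exact (hm.stronglyMeasurable.integral_prod_right').measurable

lemma pair_time {μ : ℝ} (hμ : 0 < μ) {V Vt F : ℝ → E → ℂ} (hV : Nice V) (hVt : Nice Vt) (hF : Nice F)
    (hd : ∀ t x, HasDerivAt (fun t => V t x) (Vt t x) t) (ξ : E) :
    ∫ s, (Complex.I * 𝓕 (Vt s) ξ + (om ξ + Complex.I * μ) * 𝓕 (V s) ξ) * dsol μ F s ξ =
      Complex.I * ∫ t, 𝓕 (V t) ξ * starRingEnd ℂ (𝓕 (F t) ξ) := by
  obtain ⟨K1, hK1, hb1⟩ := hV.fourier_bd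
  obtain ⟨K2, hK2, hb2⟩ := hVt.fourier_bd
  obtain ⟨K3, hK3, hb3⟩ := hF.fourier_bd
  obtain ⟨b, hbdef⟩ : ∃ b : ℝ → ℂ, b = fun s => Complex.I * 𝓕 (Vt s) ξ + (om ξ + Complex.I * μ) * 𝓕 (V s) ξ :=
    ⟨_, rfl⟩
  suffices hmain : ∫ s, b s * dsol μ F s ξ = Complex.I * ∫ t, 𝓕 (V t) ξ * starRingEnd ℂ (𝓕 (F t) ξ) by
    rw [hbdef] at hmain
    exact hmain
  have hcV : Continuous fun s => 𝓕 (V s) ξ := by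
    have := hV.fourier_cont.comp (by fun_prop : Continuous fun s : ℝ => (s, ξ))
    simpa only [Function.comp_def] using this
  have hcVt : Continuous fun s => 𝓕 (Vt s) ξ := by
    have := hVt.fourier_cont.comp (by fun_prop : Continuous fun s : ℝ => (s, ξ))
    simpa only [Function.comp_def] using this
  have hcb : Continuous b := by
    rw [hbdef]
    exact (continuous_const.mul hcVt).add (continuous_const.mul hcV)
  have hbb : ∀ s, ‖b s‖ ≤ (K2 + ‖(om ξ + Complex.I * μ : ℂ)‖ * K1) * tw s := by
    intro s
    rw [hbdef]
    refine (norm_add_le _ _).trans ?_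
    rw [norm_mul, norm_mul, Complex.norm_I, one_mul, add_mul, mul_assoc]
    gcongr
    exacts [hb2 s ξ, hb1 s ξ]
  have hm : Measurable fun z : ℝ × ℝ => hker μ F z.1 z.2 ξ := by
    have := (measurable_hker μ hF).comp (by fun_prop : Measurable fun z : ℝ × ℝ => (z.1, z.2, ξ))
    simpa only [Function.comp_def] using this
  have hintg : Integrable (fun z : ℝ × ℝ => b z.1 * hker μ F z.1 z.2 ξ) (volume.prod volume) := by
    refine ((integrable_tw.mul_prod integrable_tw).const_mul
      ((K2 + ‖(om ξ + Complex.I * μ : ℂ)‖ * K1) * K3)).mono' ?_ ?_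
    · have hb1 : Measurable fun z : ℝ × ℝ => b z.1 := by
        exact hcb.measurable.comp measurable_fst
      exact (hb1.mul hm).aestronglyMeasurable
    · filter_upwards with z
      rw [norm_mul]
      have := (norm_hker_le hμ F z.1 z.2 ξ).trans (hb3 z.2 ξ)
      have h1 := tw_pos z.1
      calc _ ≤ _ := mul_le_mul (hbb z.1) this (norm_nonneg _) (by positivity)
        _ = _ := by ring
  calc ∫ s, b s * dsol μ F s ξ = ∫ s, ∫ t, b s * hker μ F s t ξ := by
        congr 1; ext s; rw [dsol, integral_const_mul]
    _ = ∫ t, ∫ s, b s * hker μ F s t ξ := integral_integral_swap hintg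
    _ = ∫ t, Complex.I * (𝓕 (V t) ξ * starRingEnd ℂ (𝓕 (F t) ξ)) := by
        congr 1; ext t
        have := ode_solve hμ (om ξ) (K := max K1 K2) (fun t => fourier_hasDerivAt hV hVt hd ξ t)
          (le_max_of_le_left hK1)
          (fun t => (hb1 t ξ).trans (mul_le_mul_of_nonneg_right (le_max_left _ _) (tw_pos t).le))
          (fun t => (hb2 t ξ).trans (mul_le_mul_of_nonneg_right (le_max_right _ _) (tw_pos t).le))
          hcVt t
        rw [← mul_assoc, ← this, ← integral_mul_const]
        congr 1; ext s
        simp only [hbdef, hker]; ring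
    _ = _ := integral_const_mul _ _

lemma pair_bound {μ : ℝ} (hμ : 0 < μ) {V Vt S F : ℝ → E → ℂ} (hV : Nice V) (hVt : Nice Vt)
    (hS : Nice S) (hF : Nice F)
    (hd : ∀ t x, HasDerivAt (fun t => V t x) (Vt t x) t)
    (hSf : ∀ t ξ, 𝓕 (S t) ξ = Complex.I * 𝓕 (Vt t) ξ + om ξ * 𝓕 (V t) ξ) :
    ‖∫ t, ∫ x, V t x * starRingEnd ℂ (F t x)‖ₑ ≤
      (2 * ((∫⁻ t, ∫⁻ x, ‖S t x‖ₑ ^ (2:ℝ)) + ENNReal.ofReal (μ ^ 2) * ∫⁻ t, ∫⁻ x, ‖V t x‖ₑ ^ (2:ℝ))) ^ (1/(2:ℝ))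
       * (∫⁻ s, ∫⁻ ξ, ‖dsol μ F s ξ‖ₑ ^ (2:ℝ)) ^ (1/(2:ℝ)) := by
  set ν := (volume : Measure ℝ).prod (volume : Measure E) with hν
  set b : ℝ × E → ℂ := fun z => 𝓕 (S z.1) z.2 + Complex.I * μ * 𝓕 (V z.1) z.2 with hb
  have hbm : Measurable b := by
    have := hS.fourier_cont; have := hV.fourier_cont
    simp only [hb]
    apply Continuous.measurable; fun_prop
  have hdm := measurable_dsol μ hF
  have hb' : ∀ s ξ, b (s, ξ) = Complex.I * 𝓕 (Vt s) ξ + (om ξ + Complex.I * μ) * 𝓕 (V s) ξ := by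
    intro s ξ; simp only [hb]; rw [hSf]; ring
  have hpl : ∀ t, ∫ x, V t x * starRingEnd ℂ (F t x) = ∫ ξ, 𝓕 (V t) ξ * starRingEnd ℂ (𝓕 (F t) ξ) := fun t =>
    (integral_fourier_star (hV.slice_int t) (hV.slice_memLp t) (hF.slice_int t) (hF.slice_memLp t)).symm
  have hintg : Integrable (fun z : ℝ × E => 𝓕 (V z.1) z.2 * starRingEnd ℂ (𝓕 (F z.1) z.2)) ν := by
    have h2 : MemLp (fun z : ℝ × E => starRingEnd ℂ (𝓕 (F z.1) z.2)) 2 ν := hF.fourier_memLp.star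
    exact hV.fourier_memLp.integrable_mul h2
  simp only [hpl]
  rw [integral_integral_swap hintg]
  have e1 : ‖∫ ξ, ∫ t, 𝓕 (V t) ξ * starRingEnd ℂ (𝓕 (F t) ξ)‖ₑ ≤ ∫⁻ z, ‖b z‖ₑ * ‖dsol μ F z.1 z.2‖ₑ ∂ν := by
    have hm : Measurable fun z : ℝ × E => ‖b z‖ₑ * ‖dsol μ F z.1 z.2‖ₑ := hbm.enorm.mul hdm.enorm
    rw [hν, lintegral_prod_symm' _ hm]
    refine (enorm_integral_le_lintegral_enorm _).trans ?_
    gcongr with ξ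
    have h1 := pair_time hμ hV hVt hF hd ξ
    simp only [← hb'] at h1
    have h2 : ‖∫ t, 𝓕 (V t) ξ * starRingEnd ℂ (𝓕 (F t) ξ)‖ₑ = ‖∫ s, b (s, ξ) * dsol μ F s ξ‖ₑ := by
      rw [h1, enorm_mul, show ‖Complex.I‖ₑ = 1 by rw [← ofReal_norm]; simp, one_mul]
    rw [h2]
    refine (enorm_integral_le_lintegral_enorm _).trans (le_of_eq ?_)
    exact lintegral_congr fun s => enorm_mul _ _
  refine e1.trans ?_
  refine (ENNReal.lintegral_mul_le_Lp_mul_Lq _ Real.HolderConjugate.two_two hbm.enorm.aemeasurable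
    hdm.enorm.aemeasurable).trans ?_
  have e2 : ∫⁻ z, ‖dsol μ F z.1 z.2‖ₑ ^ (2:ℝ) ∂ν = ∫⁻ s, ∫⁻ ξ, ‖dsol μ F s ξ‖ₑ ^ (2:ℝ) := by
    rw [hν, lintegral_prod _ (hdm.enorm.pow_const _).aemeasurable]
  rw [e2]
  gcongr
  rw [← hS.fourier_lint_sq, ← hV.fourier_lint_sq]
  have mS := hS.fourier_cont.measurable.enorm.pow_const (2:ℝ)
  have mV := hV.fourier_cont.measurable.enorm.pow_const (2:ℝ)
  have mSV : Measurable fun z : ℝ × E => ‖𝓕 (S z.1) z.2‖ₑ ^ (2:ℝ) +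
      ENNReal.ofReal (μ ^ 2) * ‖𝓕 (V z.1) z.2‖ₑ ^ (2:ℝ) := mS.add (mV.const_mul _)
  rw [← lintegral_const_mul _ mV, ← lintegral_add_left mS, ← lintegral_const_mul _ mSV]
  gcongr with z
  simp only [hb]
  simp only [← ofReal_norm]
  rw [ENNReal.ofReal_rpow_of_nonneg (norm_nonneg _) (by norm_num),
    ENNReal.ofReal_rpow_of_nonneg (norm_nonneg _) (by norm_num),
    ENNReal.ofReal_rpow_of_nonneg (norm_nonneg _) (by norm_num), ← ENNReal.ofReal_mul (by positivity),
    ← ENNReal.ofReal_add (by positivity) (by positivity), ← ENNReal.ofReal_ofNat 2,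
    ← ENNReal.ofReal_mul (by positivity)]
  apply ENNReal.ofReal_le_ofReal
  simp only [Real.rpow_two]
  have h3 := norm_add_le (𝓕 (S z.1) z.2) (Complex.I * μ * 𝓕 (V z.1) z.2)
  rw [norm_mul, norm_mul, Complex.norm_I, one_mul, Complex.norm_real, Real.norm_of_nonneg hμ.le] at h3
  calc _ ≤ (‖𝓕 (S z.1) z.2‖ + μ * ‖𝓕 (V z.1) z.2‖) ^ 2 := by gcongr
    _ ≤ _ := by nlinarith [sq_nonneg (‖𝓕 (S z.1) z.2‖ - μ * ‖𝓕 (V z.1) z.2‖)]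

lemma Nice.mul_bdd {V : ℝ → E → ℂ} (hV : Nice V) {f : ℂ → ℂ} (hf : Continuous f)
    (hb : ∀ M : ℝ, 0 ≤ M → ∃ K : ℝ, 0 ≤ K ∧ ∀ z, ‖z‖ ≤ M → ‖f z‖ ≤ K * ‖z‖) : Nice (fun t x => f (V t x)) := by
  obtain ⟨C, hC, hC'⟩ := hV.bd
  obtain ⟨K, hK, hK'⟩ := hb C hC
  refine ⟨hf.comp hV.cont, K * C, by positivity, fun t x => ?_⟩
  have h1 : tw t * wt x ≤ 1 := mul_le_one₀ (tw_le_one t) (wt_pos x).le (wt_le_one x)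
  calc _ ≤ K * ‖V t x‖ := hK' _ ((hC' t x).trans (mul_le_of_le_one_right hC h1))
    _ ≤ K * (C * (tw t * wt x)) := by gcongr; exact hC' t x
    _ = _ := by ring

/-- key inequality for every damping parameter -/
lemma key_mu {p q : ℝ} (hpq : p.HolderConjugate q) (hp2 : p < 2)
    (hγ : (Module.finrank ℝ E : ℝ) / 2 * (2 / p - 1) = 2 - 2 / p) :
    ∃ C : ℝ, 0 < C ∧ ∀ (V Vt S : ℝ → E → ℂ), Nice V → Nice Vt → Nice S →
      (∀ t x, HasDerivAt (fun t => V t x) (Vt t x) t) →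
      (∀ t ξ, 𝓕 (S t) ξ = Complex.I * 𝓕 (Vt t) ξ + om ξ * 𝓕 (V t) ξ) → ∀ μ : ℝ, 0 < μ →
      (∫⁻ t, ∫⁻ x, ‖V t x‖ₑ ^ q) ^ (1 / q) ≤
        (ENNReal.ofReal (C / μ) * ((∫⁻ t, ∫⁻ x, ‖S t x‖ₑ ^ (2:ℝ)) +
          ENNReal.ofReal (μ ^ 2) * ∫⁻ t, ∫⁻ x, ‖V t x‖ₑ ^ (2:ℝ))) ^ (1 / (2:ℝ)) := by
  obtain ⟨C, hC, hst⟩ := strich (E := E) hpq hp2 hγ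
  refine ⟨2 * C, by positivity, fun V Vt S hV hVt hS hd hSf μ hμ => ?_⟩
  have hp0 := hpq.pos
  have hq0 := hpq.symm.pos
  have hq1 := hpq.symm.lt
  have hq2 : 2 < q := by
    have := hpq.mul_eq_add; have := hpq.lt
    by_contra h
    push Not at h
    nlinarith
  set F : ℝ → E → ℂ := fun t x => V t x * ((‖V t x‖ ^ (q - 2) : ℝ) : ℂ) with hFdef
  have hF : Nice F := by
    apply hV.mul_bdd (f := fun z => z * ((‖z‖ ^ (q - 2) : ℝ) : ℂ))
    · apply continuous_id.mul
      exact Complex.continuous_ofReal.comp (continuous_norm.rpow_const fun _ => Or.inr (by linarith))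
    · intro M hM
      refine ⟨M ^ (q - 2), by positivity, fun z hz => ?_⟩
      rw [norm_mul, Complex.norm_real, Real.norm_of_nonneg (by positivity), mul_comm]
      gcongr
  have hP : Nice (fun t x => ((‖V t x‖ ^ q : ℝ) : ℂ)) := by
    apply hV.mul_bdd (f := fun z => ((‖z‖ ^ q : ℝ) : ℂ))
    · exact Complex.continuous_ofReal.comp (continuous_norm.rpow_const fun _ => Or.inr (by linarith))
    · intro M hM
      refine ⟨M ^ (q - 1), by positivity, fun z hz => ?_⟩
      rw [Complex.norm_real, Real.norm_of_nonneg (by positivity)]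
      calc ‖z‖ ^ q = ‖z‖ ^ ((q - 1) + 1) := by ring_nf
        _ = ‖z‖ ^ (q - 1) * ‖z‖ := by
          rw [Real.rpow_add_of_nonneg (norm_nonneg _) (by linarith) (by norm_num), Real.rpow_one]
        _ ≤ _ := by
          gcongr
  set X := ∫⁻ t, ∫⁻ x, ‖V t x‖ₑ ^ q with hX
  have hXt : X ≠ ∞ := hV.lint2_ne_top hq1.le
  have hFp : ∫⁻ t, ∫⁻ x, ‖F t x‖ₑ ^ p = X := by
    rw [hX]; congr 1; ext t; congr 1; ext x
    rw [← ofReal_norm, ← ofReal_norm, ENNReal.ofReal_rpow_of_nonneg (norm_nonneg _) hp0.le,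
      ENNReal.ofReal_rpow_of_nonneg (norm_nonneg _) hq0.le]
    congr 1
    simp only [hFdef]
    rw [norm_mul, Complex.norm_real, Real.norm_of_nonneg (by positivity)]
    rw [← Real.rpow_one_add' (norm_nonneg _) (by linarith), ← Real.rpow_mul (norm_nonneg _)]
    congr 1
    have := hpq.mul_eq_add
    linarith
  have hpair : ∫ t, ∫ x, V t x * starRingEnd ℂ (F t x) = ∫ t, ∫ x, ((‖V t x‖ ^ q : ℝ) : ℂ) := by
    congr 1; ext t; congr 1; ext x
    simp only [hFdef, map_mul, Complex.conj_ofReal]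
    rw [← mul_assoc, Complex.mul_conj, Complex.normSq_eq_norm_sq, ← Complex.ofReal_mul]
    congr 1
    rw [← Real.rpow_two, ← Real.rpow_add_of_nonneg (norm_nonneg _) (by norm_num) (by linarith)]
    congr 1; ring
  have hXe : ‖∫ t, ∫ x, V t x * starRingEnd ℂ (F t x)‖ₑ = X := by
    have hi := hP.int_prod
    rw [hpair, ← integral_prod (fun z : ℝ × E => ((‖V z.1 z.2‖ ^ q : ℝ) : ℂ)) hi, integral_complex_ofReal,
      ← ofReal_norm, Complex.norm_real, Real.norm_of_nonneg (integral_nonneg fun _ => by positivity),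
      ofReal_integral_eq_lintegral_ofReal (by simpa using hi.re) (by filter_upwards with z; positivity)]
    have hm : Measurable fun z : ℝ × E => ‖V z.1 z.2‖ₑ ^ q := hV.cont.measurable.enorm.pow_const q
    rw [hX, ← lintegral_prod (fun z : ℝ × E => ‖V z.1 z.2‖ₑ ^ q) hm.aemeasurable]
    congr 1; ext z
    rw [← ofReal_norm, ENNReal.ofReal_rpow_of_nonneg (norm_nonneg _) hq0.le]
  have h1 := pair_bound hμ hV hVt hS hF hd hSf
  have h2 := hst F hF μ hμ
  rw [hXe] at h1
  rw [hFp] at h2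
  set Y := (∫⁻ t, ∫⁻ x, ‖S t x‖ₑ ^ (2:ℝ)) + ENNReal.ofReal (μ ^ 2) * ∫⁻ t, ∫⁻ x, ‖V t x‖ₑ ^ (2:ℝ) with hY
  have h3 : X ≤ (ENNReal.ofReal (2 * C / μ) * Y) ^ (1 / (2:ℝ)) * X ^ (1 / p) := by
    calc X ≤ _ := h1
      _ ≤ (2 * Y) ^ (1 / (2:ℝ)) * (ENNReal.ofReal (C / μ) * X ^ (2 / p)) ^ (1 / (2:ℝ)) := by gcongr
      _ = _ := by
        rw [ENNReal.mul_rpow_of_nonneg (ENNReal.ofReal (C / μ)) _ (by norm_num), ← ENNReal.rpow_mul, ← mul_assoc,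
          ← ENNReal.mul_rpow_of_nonneg _ _ (by norm_num)]
        congr 2
        · rw [mul_div_assoc, ENNReal.ofReal_mul (by norm_num)]
          simp only [ENNReal.ofReal_ofNat]; ring
        · field_simp
  by_cases hX0 : X = 0
  · rw [hX0, ENNReal.zero_rpow_of_pos (by positivity)]; exact zero_le
  have hXp0 : X ^ (1 / p) ≠ 0 := by simp [hX0, hXt]
  have hXpt : X ^ (1 / p) ≠ ∞ := ENNReal.rpow_ne_top_of_nonneg (by positivity) hXt
  have e : X = X ^ (1 / q) * X ^ (1 / p) := by
    rw [← ENNReal.rpow_add _ _ hX0 hXt]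
    have := hpq.inv_add_inv_eq_one
    rw [show 1 / q + 1 / p = 1 by simp only [one_div]; linarith, ENNReal.rpow_one]
  rw [← ENNReal.mul_le_mul_iff_left hXp0 hXpt, ← e]
  exact h3

end Dual
end GNS

namespace GNS

section Slice
open scoped LineDeriv

/-- the spatial embedding -/
noncomputable def iot (n : ℕ) : EuclideanSpace ℝ (Fin n) →ₗᵢ[ℝ] EuclideanSpace ℝ (Fin (n + 1)) where
  toFun x := WithLp.toLp 2 (Fin.snoc (α := fun _ => ℝ) (fun i => x i) 0)
  map_add' x y := by
    ext i
    refine Fin.lastCases ?_ (fun j => ?_) i <;> simp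
  map_smul' c x := by
    ext i
    refine Fin.lastCases ?_ (fun j => ?_) i <;> simp
  norm_map' x := by
    rw [EuclideanSpace.norm_eq, EuclideanSpace.norm_eq]
    simp [Fin.sum_univ_castSucc]

/-- unit time vector -/
noncomputable def et (n : ℕ) : EuclideanSpace ℝ (Fin (n + 1)) := EuclideanSpace.single (Fin.last n) 1

/-- the space-time point -/
noncomputable def pt (n : ℕ) (t : ℝ) (x : EuclideanSpace ℝ (Fin n)) : EuclideanSpace ℝ (Fin (n + 1)) :=
  iot n x + t • et n

lemma iot_castSucc (n : ℕ) (x : EuclideanSpace ℝ (Fin n)) (i : Fin n) : iot n x i.castSucc = x i := by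
  simp [iot]

lemma iot_last (n : ℕ) (x : EuclideanSpace ℝ (Fin n)) : iot n x (Fin.last n) = 0 := by
  simp [iot]

lemma pt_castSucc (n : ℕ) (t : ℝ) (x : EuclideanSpace ℝ (Fin n)) (i : Fin n) : pt n t x i.castSucc = x i := by
  simp [pt, iot_castSucc, et, Fin.castSucc_ne_last]

lemma pt_last (n : ℕ) (t : ℝ) (x : EuclideanSpace ℝ (Fin n)) : pt n t x (Fin.last n) = t := by
  simp [pt, iot_last, et]

lemma iot_single (n : ℕ) (i : Fin n) :
    iot n (EuclideanSpace.single i 1) = EuclideanSpace.single i.castSucc 1 := by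
  ext j
  refine Fin.lastCases ?_ (fun k => ?_) j
  · rw [iot_last]; simp [Fin.castSucc_ne_last]
  · rw [iot_castSucc]; simp [Pi.single_apply]

lemma norm_pt_sq (n : ℕ) (t : ℝ) (x : EuclideanSpace ℝ (Fin n)) : ‖pt n t x‖ ^ 2 = ‖x‖ ^ 2 + t ^ 2 := by
  rw [EuclideanSpace.norm_sq_eq, EuclideanSpace.norm_sq_eq, Fin.sum_univ_castSucc]
  simp [pt_castSucc, pt_last]

lemma continuous_pt (n : ℕ) : Continuous fun z : ℝ × EuclideanSpace ℝ (Fin n) => pt n z.1 z.2 := by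
  unfold pt
  have := (iot n).continuous
  fun_prop

lemma pt_mp (n : ℕ) : MeasurePreserving (fun z : ℝ × EuclideanSpace ℝ (Fin n) => pt n z.1 z.2)
    (volume.prod volume) volume := by
  have h1 : MeasurePreserving (Prod.map id (WithLp.ofLp (p := 2)) : ℝ × EuclideanSpace ℝ (Fin n) → ℝ × (Fin n → ℝ))
      (volume.prod volume) (volume.prod volume) :=
    (MeasurePreserving.id volume).prod (PiLp.volume_preserving_ofLp (Fin n))
  have h2 := (volume_preserving_piFinSuccAbove (fun _ : Fin (n + 1) => ℝ) (Fin.last n)).symm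
  have h3 := PiLp.volume_preserving_toLp (Fin (n + 1))
  have h4 := h3.comp (h2.comp h1)
  have e : (fun z : ℝ × EuclideanSpace ℝ (Fin n) => pt n z.1 z.2) = WithLp.toLp 2 ∘
      ⇑(MeasurableEquiv.piFinSuccAbove (fun _ : Fin (n + 1) => ℝ) (Fin.last n)).symm ∘ Prod.map id WithLp.ofLp := by
    ext z i
    refine Fin.lastCases ?_ (fun j => ?_) i
    · simp [pt_last]
    · simp [pt_castSucc]
  rw [e]; exact h4

lemma lintegral_pt (n : ℕ) {f : EuclideanSpace ℝ (Fin (n + 1)) → ℝ≥0∞} (hf : Measurable f) :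
    ∫⁻ z, f z = ∫⁻ t, ∫⁻ x, f (pt n t x) := by
  have hm : Measurable fun z : ℝ × EuclideanSpace ℝ (Fin n) => f (pt n z.1 z.2) :=
    hf.comp (continuous_pt n).measurable
  rw [← (pt_mp n).lintegral_comp hf, lintegral_prod _ hm.aemeasurable]

lemma nice_slice (n : ℕ) (u : SchwartzMap (EuclideanSpace ℝ (Fin (n + 1))) ℂ) : Nice (fun t x => u (pt n t x)) := by
  refine ⟨u.continuous.comp (continuous_pt n), ?_⟩
  set C := 2 ^ (n + 3) * ((Finset.Iic (n + 3, 0)).sup fun m => SchwartzMap.seminorm ℝ m.1 m.2) u with hC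
  have hC0 : 0 ≤ C := by positivity
  refine ⟨C, hC0, fun t x => ?_⟩
  have h := SchwartzMap.one_add_le_sup_seminorm_apply (𝕜 := ℝ) (m := (n + 3, 0)) (k := n + 3) (n := 0) le_rfl le_rfl u (pt n t x)
  rw [norm_iteratedFDeriv_zero, ← hC] at h
  set N := ‖pt n t x‖ with hN
  have hN0 : 0 ≤ N := norm_nonneg _
  have hsq : N ^ 2 = ‖x‖ ^ 2 + t ^ 2 := norm_pt_sq n t x
  have hx : ‖x‖ ≤ N := by
    apply le_of_sq_le_sq _ hN0
    nlinarith [sq_nonneg t]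
  have hw : tw t * wt x = ((1 + t ^ 2) * (1 + ‖x‖) ^ (n + 1))⁻¹ := by
    unfold tw wt
    rw [mul_inv, Real.rpow_neg (by positivity), finrank_euclideanSpace_fin]
    norm_cast
  rw [hw, ← div_eq_mul_inv, le_div_iff₀ (by positivity)]
  calc ‖u (pt n t x)‖ * ((1 + t ^ 2) * (1 + ‖x‖) ^ (n + 1))
      ≤ ‖u (pt n t x)‖ * ((1 + N) ^ 2 * (1 + N) ^ (n + 1)) := by
        gcongr
        nlinarith [sq_nonneg ‖x‖]
    _ = (1 + N) ^ (n + 3) * ‖u (pt n t x)‖ := by ring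
    _ ≤ C := h

lemma hasTG (n : ℕ) (t : ℝ) : Function.HasTemperateGrowth (pt n t) := by
  have h1 : Function.HasTemperateGrowth (fun x => iot n x) :=
    (iot n).toContinuousLinearMap.hasTemperateGrowth
  exact h1.add (Function.HasTemperateGrowth.const (t • et n))

lemma antil (n : ℕ) (t : ℝ) : AntilipschitzWith 1 (pt n t) := by
  apply AntilipschitzWith.of_le_mul_dist
  intro x y
  unfold pt
  rw [dist_add_right, (iot n).dist_map]; simp

/-- slice at time t -/
noncomputable def sl (n : ℕ) (t : ℝ) : SchwartzMap (EuclideanSpace ℝ (Fin (n + 1))) ℂ →L[ℂ]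
    SchwartzMap (EuclideanSpace ℝ (Fin n)) ℂ :=
  SchwartzMap.compCLMOfAntilipschitz ℂ (hasTG n t) (antil n t)

lemma sl_apply (n : ℕ) (t : ℝ) (u : SchwartzMap (EuclideanSpace ℝ (Fin (n + 1))) ℂ) (x : EuclideanSpace ℝ (Fin n)) :
    sl n t u x = u (pt n t x) := rfl

lemma pt_hasFDerivAt (n : ℕ) (t : ℝ) (x : EuclideanSpace ℝ (Fin n)) :
    HasFDerivAt (pt n t) (iot n).toContinuousLinearMap x :=
  ((iot n).toContinuousLinearMap.hasFDerivAt).add_const _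

lemma lineDeriv_sl (n : ℕ) (t : ℝ) (u : SchwartzMap (EuclideanSpace ℝ (Fin (n + 1))) ℂ) (m : EuclideanSpace ℝ (Fin n)) :
    ∂_{m} (sl n t u) = sl n t (∂_{iot n m} u) := by
  ext x
  rw [sl_apply, SchwartzMap.lineDerivOp_apply_eq_fderiv, SchwartzMap.lineDerivOp_apply_eq_fderiv]
  have h := (u.differentiableAt (x := pt n t x)).hasFDerivAt.comp x (pt_hasFDerivAt n t x)
  have h2 : HasFDerivAt (sl n t u) ((fderiv ℝ u (pt n t x)).comp (iot n).toContinuousLinearMap) x := h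
  rw [h2.fderiv]; rfl

lemma slice_hasDerivAt (n : ℕ) (t : ℝ) (u : SchwartzMap (EuclideanSpace ℝ (Fin (n + 1))) ℂ) (x : EuclideanSpace ℝ (Fin n)) :
    HasDerivAt (fun t => u (pt n t x)) ((∂_{et n} u) (pt n t x)) t := by
  rw [SchwartzMap.lineDerivOp_apply_eq_fderiv]
  have h1 : HasDerivAt (fun t => pt n t x) (et n) t := by
    unfold pt
    simpa using ((hasDerivAt_id t).smul_const (et n)).const_add (iot n x)
  exact (u.differentiableAt (x := pt n t x)).hasFDerivAt.comp_hasDerivAt t h1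

lemma fourier_second (n : ℕ) (f : SchwartzMap (EuclideanSpace ℝ (Fin n)) ℂ) (m ξ : EuclideanSpace ℝ (Fin n)) :
    𝓕 (∂_{m} (∂_{m} f)) ξ = -(4 * π ^ 2 * (inner ℝ ξ m) ^ 2 : ℝ) * 𝓕 f ξ := by
  rw [SchwartzMap.fourier_lineDerivOp_eq, SchwartzMap.smul_apply, SchwartzMap.smulLeftCLM_apply_apply (by fun_prop),
    SchwartzMap.fourier_lineDerivOp_eq, SchwartzMap.smul_apply, SchwartzMap.smulLeftCLM_apply_apply (by fun_prop)]
  simp only [smul_eq_mul, Complex.real_smul]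
  push_cast
  ring_nf
  rw [Complex.I_sq]; ring

/-- Schrödinger operator as a Schwartz map -/
noncomputable def schr (n : ℕ) (v : SchwartzMap (EuclideanSpace ℝ (Fin (n + 1))) ℂ) :
    SchwartzMap (EuclideanSpace ℝ (Fin (n + 1))) ℂ :=
  Complex.I • ∂_{et n} v - ∑ i : Fin n, ∂_{(EuclideanSpace.single i.castSucc (1:ℝ) : EuclideanSpace ℝ (Fin (n + 1)))}
    (∂_{(EuclideanSpace.single i.castSucc (1:ℝ) : EuclideanSpace ℝ (Fin (n + 1)))} v)

lemma schr_apply (n : ℕ) (v : SchwartzMap (EuclideanSpace ℝ (Fin (n + 1))) ℂ) (z : EuclideanSpace ℝ (Fin (n + 1))) :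
    schr n v z = Complex.I * fderiv ℝ (⇑v) z (EuclideanSpace.single (Fin.last n) (1 : ℝ)) -
            ∑ i : Fin n, iteratedFDeriv ℝ 2 (⇑v) z (fun _ => EuclideanSpace.single i.castSucc (1 : ℝ)) := by
  unfold schr
  rw [SchwartzMap.sub_apply, SchwartzMap.smul_apply, SchwartzMap.sum_apply, smul_eq_mul,
    SchwartzMap.lineDerivOp_apply_eq_fderiv]
  congr 1
  apply Finset.sum_congr rfl
  intro i _
  rw [← SchwartzMap.iteratedLineDerivOp_eq_iteratedFDeriv]
  simp [LineDeriv.iteratedLineDerivOp_succ_left]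
  rfl

lemma fourier_schr (n : ℕ) (v : SchwartzMap (EuclideanSpace ℝ (Fin (n + 1))) ℂ) (t : ℝ) (ξ : EuclideanSpace ℝ (Fin n)) :
    𝓕 (fun x : EuclideanSpace ℝ (Fin n) => schr n v (pt n t x)) ξ = Complex.I * 𝓕 (fun x : EuclideanSpace ℝ (Fin n) => (∂_{et n} v : SchwartzMap (EuclideanSpace ℝ (Fin (n + 1))) ℂ) (pt n t x)) ξ +
      om ξ * 𝓕 (fun x : EuclideanSpace ℝ (Fin n) => v (pt n t x)) ξ := by
  have e : ∀ u : SchwartzMap (EuclideanSpace ℝ (Fin (n + 1))) ℂ, 𝓕 (fun x : EuclideanSpace ℝ (Fin n) => u (pt n t x)) ξ = 𝓕 (sl n t u) ξ :=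
    fun u => rfl
  rw [e, e, e]
  have h1 : sl n t (schr n v) = Complex.I • sl n t (∂_{et n} v) -
      ∑ i : Fin n, ∂_{(EuclideanSpace.single i (1:ℝ) : EuclideanSpace ℝ (Fin n))}
        (∂_{(EuclideanSpace.single i (1:ℝ) : EuclideanSpace ℝ (Fin n))} (sl n t v)) := by
    unfold schr
    rw [map_sub, map_smul, map_sum]
    congr 1
    apply Finset.sum_congr rfl
    intro i _
    rw [lineDeriv_sl, lineDeriv_sl, iot_single]
  have h2 : 𝓕 (sl n t (schr n v)) = Complex.I • 𝓕 (sl n t (∂_{et n} v)) -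
      ∑ i : Fin n, 𝓕 (∂_{(EuclideanSpace.single i (1:ℝ) : EuclideanSpace ℝ (Fin n))}
        (∂_{(EuclideanSpace.single i (1:ℝ) : EuclideanSpace ℝ (Fin n))} (sl n t v))) := by
    rw [h1]
    have := fun f => FourierTransform.fourierCLM_apply (R := ℂ) (E := SchwartzMap (EuclideanSpace ℝ (Fin n)) ℂ) f
    simp only [← this, map_sub, map_smul, map_sum]
  rw [h2, SchwartzMap.sub_apply, SchwartzMap.smul_apply, SchwartzMap.sum_apply, smul_eq_mul]
  simp only [fourier_second]
  rw [← Finset.sum_mul, sub_eq_add_neg, ← neg_mul]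
  congr 2
  unfold om
  rw [EuclideanSpace.norm_sq_eq]
  simp only [Real.norm_eq_abs, sq_abs]
  push_cast
  simp [Finset.mul_sum, EuclideanSpace.inner_single_right]

end Slice
end GNS

namespace GNS

section Fin1
open scoped LineDeriv

lemma opt_real {m C α β : ℝ} (hC : 0 < C) (hα : 0 ≤ α) (hβ : 0 ≤ β)
    (h : ∀ μ : ℝ, 0 < μ → m ≤ C / μ * (α ^ 2 + μ ^ 2 * β ^ 2)) : m ≤ 2 * C * (α * β) := by
  have key : ∀ ε : ℝ, 0 < ε → m ≤ C * (2 * (α * β) + ε * (α + β)) := by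
    intro ε hε
    have h1 : 0 < α + ε := by positivity
    have h2 : 0 < β + ε := by positivity
    refine (h ((α + ε) / (β + ε)) (by positivity)).trans ?_
    have e : C / ((α + ε) / (β + ε)) * (α ^ 2 + ((α + ε) / (β + ε)) ^ 2 * β ^ 2) =
        C * (α ^ 2 / (α + ε) * (β + ε) + (α + ε) * (β ^ 2 / (β + ε))) := by
      field_simp
    rw [e]
    have i1 : α ^ 2 / (α + ε) ≤ α := by rw [div_le_iff₀ h1]; nlinarith
    have i2 : β ^ 2 / (β + ε) ≤ β := by rw [div_le_iff₀ h2]; nlinarith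
    have i3 := mul_le_mul_of_nonneg_right i1 h2.le
    have i4 := mul_le_mul_of_nonneg_left i2 h1.le
    have : α ^ 2 / (α + ε) * (β + ε) + (α + ε) * (β ^ 2 / (β + ε)) ≤ 2 * (α * β) + ε * (α + β) := by linarith
    exact mul_le_mul_of_nonneg_left this hC.le
  have ht : Filter.Tendsto (fun ε : ℝ => C * (2 * (α * β) + ε * (α + β))) (nhdsWithin 0 (Set.Ioi 0))
      (nhds (C * (2 * (α * β) + 0 * (α + β)))) := by
    apply Filter.Tendsto.mono_left _ nhdsWithin_le_nhds
    apply Continuous.tendsto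
    fun_prop
  have := ge_of_tendsto ht (Filter.mem_of_superset self_mem_nhdsWithin (fun ε hε => key ε hε))
  linarith

lemma opt_enn {N a b : ℝ≥0∞} {C : ℝ} (hC : 0 < C) (ha : a ≠ ∞) (hb : b ≠ ∞)
    (h : ∀ μ : ℝ, 0 < μ → N ≤ (ENNReal.ofReal (C / μ) * (a ^ (2:ℝ) + ENNReal.ofReal (μ ^ 2) * b ^ (2:ℝ))) ^ (1 / (2:ℝ))) :
    N ≤ ENNReal.ofReal (√(2 * C)) * a ^ (1 / (2:ℝ)) * b ^ (1 / (2:ℝ)) := by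
  lift a to ℝ≥0 using ha
  lift b to ℝ≥0 using hb
  have e : ∀ μ : ℝ, 0 < μ → ENNReal.ofReal (C / μ) * ((a : ℝ≥0∞) ^ (2:ℝ) + ENNReal.ofReal (μ ^ 2) * (b : ℝ≥0∞) ^ (2:ℝ)) =
      ENNReal.ofReal (C / μ * ((a:ℝ) ^ 2 + μ ^ 2 * (b:ℝ) ^ 2)) := by
    intro μ hμ
    rw [ENNReal.ofReal_mul (by positivity), ENNReal.ofReal_add (by positivity) (by positivity),
      ENNReal.ofReal_mul (by positivity)]
    simp [ENNReal.ofReal_pow]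
  have h' : ∀ μ : ℝ, 0 < μ → N ^ (2:ℝ) ≤ ENNReal.ofReal (C / μ * ((a:ℝ) ^ 2 + μ ^ 2 * (b:ℝ) ^ 2)) := by
    intro μ hμ
    have := ENNReal.rpow_le_rpow (h μ hμ) (by norm_num : (0:ℝ) ≤ 2)
    rw [← ENNReal.rpow_mul, e μ hμ] at this
    simpa using this
  have hN : N ^ (2:ℝ) ≠ ∞ := ne_top_of_le_ne_top ENNReal.ofReal_ne_top (h' 1 one_pos)
  have h2 : N ^ (2:ℝ) ≤ ENNReal.ofReal (2 * C * ((a:ℝ) * b)) := by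
    rw [← ENNReal.ofReal_toReal hN]
    apply ENNReal.ofReal_le_ofReal
    apply opt_real hC a.2 b.2
    intro μ hμ
    exact ENNReal.toReal_le_of_le_ofReal (by positivity) (h' μ hμ)
  have h3 := ENNReal.rpow_le_rpow h2 (by norm_num : (0:ℝ) ≤ 1 / 2)
  rw [← ENNReal.rpow_mul] at h3
  norm_num at h3
  refine h3.trans (le_of_eq ?_)
  rw [ENNReal.ofReal_mul (by positivity), ENNReal.ofReal_mul (p := (a:ℝ)) a.2, ENNReal.mul_rpow_of_nonneg _ _ (by norm_num),
    ENNReal.mul_rpow_of_nonneg _ _ (by norm_num), ENNReal.ofReal_rpow_of_nonneg (by positivity) (by norm_num), Real.sqrt_eq_rpow]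
  simp [mul_assoc]

lemma half_est (n : ℕ) (hn : 1 ≤ n) : ∃ C : ℝ, 0 < C ∧ ∀ v : SchwartzMap (EuclideanSpace ℝ (Fin (n + 1))) ℂ,
    eLpNorm (⇑v) (ENNReal.ofReal (2 * (n + 2) / n)) volume ≤ ENNReal.ofReal C *
      eLpNorm (⇑(schr n v)) 2 volume ^ (1 / (2:ℝ)) * eLpNorm (⇑v) 2 volume ^ (1 / (2:ℝ)) := by
  have hn0 : (0:ℝ) < n := by exact_mod_cast hn
  set p : ℝ := 2 * (n + 2) / (n + 4) with hp
  set q : ℝ := 2 * (n + 2) / n with hq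
  have hq0 : 0 < q := by positivity
  have hpq : p.HolderConjugate q := by
    rw [Real.holderConjugate_iff]
    constructor
    · rw [hp, lt_div_iff₀ (by positivity)]; linarith
    · rw [hp, hq]; field_simp; ring
  have hp2 : p < 2 := by rw [hp, div_lt_iff₀ (by positivity)]; linarith
  have hγ : (Module.finrank ℝ (EuclideanSpace ℝ (Fin n)) : ℝ) / 2 * (2 / p - 1) = 2 - 2 / p := by
    rw [finrank_euclideanSpace_fin, hp]; field_simp; ring
  obtain ⟨C, hC, h⟩ := key_mu (E := EuclideanSpace ℝ (Fin n)) hpq hp2 hγ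
  refine ⟨√(2 * C), by positivity, fun v => ?_⟩
  have cv : ∀ (u : SchwartzMap (EuclideanSpace ℝ (Fin (n + 1))) ℂ) (r : ℝ), 0 < r →
      (∫⁻ t, ∫⁻ x, ‖u (pt n t x)‖ₑ ^ r) = eLpNorm (⇑u) (ENNReal.ofReal r) volume ^ r := by
    intro u r hr
    have hm : Measurable fun z => ‖u z‖ₑ ^ r := (u.continuous.measurable.enorm).pow_const r
    rw [← lintegral_pt n hm, eLpNorm_eq_lintegral_rpow_enorm_toReal (by simpa using hr) ENNReal.ofReal_ne_top,
      ENNReal.toReal_ofReal hr.le, ← ENNReal.rpow_mul, one_div, inv_mul_cancel₀ hr.ne', ENNReal.rpow_one]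
  have h2 : ENNReal.ofReal (2:ℝ) = 2 := by simp
  apply opt_enn hC
  · exact ((schr n v).memLp 2 volume).eLpNorm_ne_top
  · exact (v.memLp 2 volume).eLpNorm_ne_top
  intro μ hμ
  have := h (fun t x => v (pt n t x)) (fun t x => (∂_{et n} v : SchwartzMap (EuclideanSpace ℝ (Fin (n + 1))) ℂ) (pt n t x))
    (fun t x => schr n v (pt n t x)) (nice_slice n _) (nice_slice n _) (nice_slice n _)
    (fun t x => slice_hasDerivAt n t v x) (fun t ξ => fourier_schr n v t ξ) μ hμ
  rw [cv v q hq0, cv v 2 two_pos, cv _ 2 two_pos, h2, ← ENNReal.rpow_mul, mul_one_div_cancel hq0.ne', ENNReal.rpow_one] at this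
  exact this

lemma interp {α : Type*} [MeasurableSpace α] {ν : Measure α} {f : α → ℂ} (hf : AEStronglyMeasurable f ν)
    {q0 q θ : ℝ} (hq0 : 0 < q0) (hq : 0 < q) (h0 : 0 ≤ θ) (h1 : θ ≤ 1) (he : 1 / q = θ / q0 + (1 - θ) / 2) :
    eLpNorm f (ENNReal.ofReal q) ν ≤ eLpNorm f (ENNReal.ofReal q0) ν ^ θ * eLpNorm f 2 ν ^ (1 - θ) := by
  have h2 : ENNReal.ofReal (2:ℝ) = 2 := by simp
  rcases h0.eq_or_lt with rfl | h0
  · have : q = 2 := by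
      have he : 1 / q = 1 / 2 := by rw [he]; simp
      field_simp at he; linarith
    simp [this, h2]
  rcases h1.eq_or_lt with rfl | h1
  · have : q = q0 := by field_simp at he; linarith
    simp [this]
  have h1' : 0 < 1 - θ := by linarith
  have en : ∀ r : ℝ, 0 < r → eLpNorm f (ENNReal.ofReal r) ν = (∫⁻ x, ‖f x‖ₑ ^ r ∂ν) ^ (1 / r) := by
    intro r hr
    rw [eLpNorm_eq_lintegral_rpow_enorm_toReal (by simpa using hr) ENNReal.ofReal_ne_top,
      ENNReal.toReal_ofReal hr.le]
  rw [← h2, en q hq, en q0 hq0, en 2 two_pos]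
  -- Hoelder with exponents q0/(θ q) and 2/((1-θ) q)
  have hpq : (q0 / (θ * q)).HolderConjugate (2 / ((1 - θ) * q)) := by
    have e : θ * q / q0 + (1 - θ) * q / 2 = 1 := by
      have : θ * q / q0 + (1 - θ) * q / 2 = q * (θ / q0 + (1 - θ) / 2) := by ring
      rw [this, ← he, mul_one_div_cancel hq.ne']
    rw [Real.holderConjugate_iff]
    constructor
    · rw [lt_div_iff₀ (by positivity), one_mul]
      have : 0 < (1 - θ) * q / 2 := by positivity
      have : θ * q / q0 < 1 := by linarith
      rwa [div_lt_one hq0] at this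
    · rw [inv_div, inv_div]; exact e
  have hm := hf.enorm
  have := ENNReal.lintegral_mul_le_Lp_mul_Lq ν hpq (hm.pow_const (θ * q)) (hm.pow_const ((1 - θ) * q))
  have e1 : ∀ x, ‖f x‖ₑ ^ q = ‖f x‖ₑ ^ (θ * q) * ‖f x‖ₑ ^ ((1 - θ) * q) := by
    intro x
    rw [← ENNReal.rpow_add_of_nonneg _ _ (by positivity) (by positivity)]
    congr 1; ring
  simp only [Pi.mul_apply, ← e1, ← ENNReal.rpow_mul] at this
  have c1 : θ * q * (q0 / (θ * q)) = q0 := by field_simp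
  have c2 : (1 - θ) * q * (2 / ((1 - θ) * q)) = 2 := by field_simp
  rw [c1, c2] at this
  have := ENNReal.rpow_le_rpow this (by positivity : 0 ≤ 1 / q)
  refine this.trans (le_of_eq ?_)
  rw [ENNReal.mul_rpow_of_nonneg _ _ (by positivity)]
  simp only [← ENNReal.rpow_mul]
  congr 2 <;> field_simp

end Fin1
end GNS

/-- Gagliardo-Nirenberg inequality for the Schrödinger operator (Theorem `thm:GN_Schroe`). -/
theorem gagliardo_nirenberg_schroedinger
    (d : ℕ) (hd : 2 ≤ d) (κ : ℝ) (hκ1 : 1 / 2 ≤ κ) (hκ2 : κ ≤ 1) :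
    ∃ C : ℝ, 0 < C ∧ ∀ v : SchwartzMap (EuclideanSpace ℝ (Fin d)) ℂ,
      eLpNorm (⇑v) (ENNReal.ofReal (2 * (d + 1) / (d - 3 + 4 * κ))) volume ≤
        ENNReal.ofReal C *
        eLpNorm (fun z =>
            Complex.I * fderiv ℝ (⇑v) z
              (EuclideanSpace.single (⟨d - 1, by omega⟩ : Fin d) (1 : ℝ)) -
            ∑ i : Fin (d - 1),
              iteratedFDeriv ℝ 2 (⇑v) z
                (fun _ => EuclideanSpace.single (Fin.castLE (by omega) i) (1 : ℝ)))
          2 volume ^ (1 - κ) *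
        eLpNorm (⇑v) 2 volume ^ κ := by
  obtain ⟨n, rfl⟩ : ∃ n, d = n + 1 := ⟨d - 1, by omega⟩
  have hn : 1 ≤ n := by omega
  have hn0 : (1:ℝ) ≤ n := by exact_mod_cast hn
  obtain ⟨C, hC, h⟩ := GNS.half_est n hn
  refine ⟨C ^ (2 * (1 - κ)), by positivity, fun v => ?_⟩
  have hS : (fun z => Complex.I * fderiv ℝ (⇑v) z (EuclideanSpace.single (⟨n + 1 - 1, by omega⟩ : Fin (n + 1)) (1 : ℝ)) -
            ∑ i : Fin (n + 1 - 1), iteratedFDeriv ℝ 2 (⇑v) z (fun _ => EuclideanSpace.single (Fin.castLE (by omega) i) (1 : ℝ)))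
      = ⇑(GNS.schr n v) := by
    funext z
    rw [GNS.schr_apply]
    rfl
  rw [hS]
  have hden : (0:ℝ) < n - 2 + 4 * κ := by linarith
  have hq : (2 * (((n + 1 : ℕ) : ℝ) + 1) / (((n + 1 : ℕ) : ℝ) - 3 + 4 * κ)) = 2 * (n + 2) / (n - 2 + 4 * κ) := by
    push_cast; congr 1 <;> ring
  rw [hq]
  have hi := GNS.interp (ν := volume) (f := v) v.continuous.aestronglyMeasurable
    (q0 := 2 * (n + 2) / n) (q := 2 * (n + 2) / (n - 2 + 4 * κ)) (θ := 2 * (1 - κ)) (by positivity) (by positivity)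
    (by linarith) (by linarith) (by field_simp; ring)
  refine hi.trans ?_
  have h2 := ENNReal.rpow_le_rpow (h v) (by linarith : 0 ≤ 2 * (1 - κ))
  refine (mul_le_mul_left h2 _).trans (le_of_eq ?_)
  have k0 : 0 ≤ 2 * (1 - κ) := by linarith
  rw [ENNReal.mul_rpow_of_nonneg _ _ k0, ENNReal.mul_rpow_of_nonneg _ _ k0, ENNReal.ofReal_rpow_of_nonneg hC.le k0,
    ← ENNReal.rpow_mul, ← ENNReal.rpow_mul, mul_assoc, ← ENNReal.rpow_add_of_nonneg _ _ (by linarith) (by linarith)]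
  congr 2
  · congr 1; ring
  · ring
end

section
/- Let d ∈ ℕ, s ∈ ℝ, ε > 0, M ∈ ℝ and C₀ > 0. Let τ : ℝ^d → ℝ be smooth with compact support, let ξ₀ ∈ ℝ^d be such that τ ≡ 1 on a neighborhood of ξ₀, and let U ⊆ ℝ^d be an open set containing the support of 1 − τ. Let P : ℝ^d → ℝ be measurable with |P(ξ)| ≤ C₀·⟨ξ⟩^{M} for all ξ ∈ ℝ^d, such that P is smooth and nonvanishing on U and the function Q(ξ) := ⟨ξ⟩^{s}/P(ξ) satisfies, for all ξ ∈ U: ‖D^n Q(ξ)‖ ≤ C₀·⟨ξ⟩^{−n} for 0 ≤ n ≤ ⌊d/2⌋, and ‖D^n Q(ξ)‖ ≤ C₀·⟨ξ⟩^{−ε−n} for n = ⌊d/2⌋ + 1. Let η : ℝ → ℂ be smooth with compact support not containing 0. Then for all p, q with 1 ≤ p ≤ q ≤ ∞ there exists a constant C > 0 such that for all j ∈ ℤ and all Schwartz functions u : ℝ^d → ℂ one has ‖𝓕⁻¹(ξ ↦ η(2^{j}‖ξ − ξ₀‖)·(1 − τ(ξ))·𝓕u(ξ))‖_q ≤ C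 · 2^{j(s − d(1/p − 1/q))} · ‖𝓕⁻¹(P·𝓕u)‖_p. -/
open MeasureTheory Real SchwartzMap
open scoped FourierTransform ENNReal NNReal

section DyAux


section partA
variable {d : ℕ}

/-- pointwise Hoelder bound for a convolution -/
lemma dy_holder {p : ℝ} (hp : 1 ≤ p) (K f : EuclideanSpace ℝ (Fin d) → ℝ≥0∞)
    (hK : Measurable K) (hf : Measurable f) (x : EuclideanSpace ℝ (Fin d)) :
    ∫⁻ y, K y * f (x - y) ≤
      (∫⁻ y, K y) ^ (1 - 1 / p) * (∫⁻ y, K y * f (x - y) ^ p) ^ (1 / p) := by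
  have hp0 : 0 < p := by linarith
  have h1 : 1 / p ≤ 1 := by rw [div_le_one hp0]; exact hp
  have h0 : 0 ≤ 1 / p := by positivity
  have hm : Measurable fun y => f (x - y) := hf.comp (measurable_const.sub measurable_id)
  refine le_trans (le_of_eq ?_) (ENNReal.lintegral_mul_norm_pow_le (μ := volume)
    (f := K) (g := fun y => K y * f (x - y) ^ p) hK.aemeasurable
    (hK.mul (hm.pow_const p)).aemeasurable (p := 1 - 1 / p) (q := 1 / p) (by linarith) h0
    (by ring))
  refine lintegral_congr fun y => ?_
  rw [ENNReal.mul_rpow_of_nonneg _ _ h0, ← ENNReal.rpow_mul, mul_one_div_cancel hp0.ne',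
    ENNReal.rpow_one, ← mul_assoc, ← ENNReal.rpow_add_of_nonneg _ _ (by linarith) h0]
  simp

/-- Young-type inequality -/
lemma dy_young (p q : ℝ≥0∞) (hp : 1 ≤ p) (hpq : p ≤ q)
    (K f g : EuclideanSpace ℝ (Fin d) → ℂ) (hK : Continuous K) (hf : Continuous f)
    (A B : ℝ≥0∞) (hA : ∫⁻ y, ‖K y‖ₑ ≤ A) (hB : ∀ y, ‖K y‖ₑ ≤ B)
    (hA0 : A ≠ 0) (hAt : A ≠ ∞) (hB0 : B ≠ 0) (hBt : B ≠ ∞)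
    (hg : ∀ x, ‖g x‖ₑ ≤ ∫⁻ y, ‖K y‖ₑ * ‖f (x - y)‖ₑ) :
    eLpNorm g q volume ≤ A ^ (1 - (p⁻¹.toReal - q⁻¹.toReal)) * B ^ (p⁻¹.toReal - q⁻¹.toReal) *
      eLpNorm f p volume := by
  have hKm : Measurable fun y => ‖K y‖ₑ := hK.enorm.measurable
  have hfm : Measurable fun y => ‖f y‖ₑ := hf.enorm.measurable
  rcases eq_or_ne p ∞ with rfl | hpt
  · obtain rfl : q = ∞ := top_le_iff.1 hpq
    simp only [sub_self, sub_zero, ENNReal.rpow_one, ENNReal.rpow_zero, mul_one]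
    rw [eLpNorm_exponent_top, eLpNorm_exponent_top]
    refine eLpNormEssSup_le_of_ae_enorm_bound (Filter.Eventually.of_forall fun x => ?_)
    refine (hg x).trans ?_
    have hae : ∀ᵐ y, ‖f (x - y)‖ₑ ≤ eLpNormEssSup f volume :=
      (Measure.measurePreserving_sub_left volume x).quasiMeasurePreserving.ae
        (enorm_ae_le_eLpNormEssSup f volume)
    calc ∫⁻ y, ‖K y‖ₑ * ‖f (x - y)‖ₑ ≤ ∫⁻ y, ‖K y‖ₑ * eLpNormEssSup f volume :=
          lintegral_mono_ae (hae.mono fun y hy => by gcongr)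
      _ = (∫⁻ y, ‖K y‖ₑ) * eLpNormEssSup f volume := lintegral_mul_const _ hKm
      _ ≤ A * eLpNormEssSup f volume := by gcongr
  have hp0 : p ≠ 0 := (zero_lt_one.trans_le hp).ne'
  set r := p.toReal with hr
  have hr1 : 1 ≤ r := by
    rw [hr, ← ENNReal.toReal_one]; exact ENNReal.toReal_mono hpt hp
  have hr0 : 0 < r := by linarith
  have hri : p⁻¹.toReal = 1 / r := by rw [ENNReal.toReal_inv, one_div]
  have h0 : 0 ≤ 1 / r := by positivity
  have h1 : 0 ≤ 1 - 1 / r := by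
    have : 1 / r ≤ 1 := by rw [div_le_one hr0]; exact hr1
    linarith
  set F := eLpNorm f p volume with hF
  have hFr : ∫⁻ y, ‖f y‖ₑ ^ r = F ^ r := by
    rw [hF, eLpNorm_eq_lintegral_rpow_enorm_toReal hp0 hpt, ← ENNReal.rpow_mul,
      one_div_mul_cancel hr0.ne', ENNReal.rpow_one]
  set S := A ^ (1 - 1 / r) * B ^ (1 / r) * F with hS
  have hsup : ∀ x, ‖g x‖ₑ ≤ S := fun x => by
    refine (hg x).trans ((dy_holder hr1 _ _ hKm hfm x).trans ?_)
    have : ∫⁻ y, ‖K y‖ₑ * ‖f (x - y)‖ₑ ^ r ≤ B * F ^ r := by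
      calc ∫⁻ y, ‖K y‖ₑ * ‖f (x - y)‖ₑ ^ r ≤ ∫⁻ y, B * ‖f (x - y)‖ₑ ^ r :=
            lintegral_mono fun y => by gcongr; exact hB y
        _ = B * ∫⁻ y, ‖f (x - y)‖ₑ ^ r :=
            lintegral_const_mul _ ((hfm.comp (measurable_const.sub measurable_id)).pow_const r)
        _ = B * F ^ r := by
            rw [lintegral_sub_left_eq_self (fun y => ‖f y‖ₑ ^ r) x, hFr]
    calc _ ≤ A ^ (1 - 1 / r) * (B * F ^ r) ^ (1 / r) := by gcongr
      _ = S := by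
        rw [ENNReal.mul_rpow_of_nonneg _ _ h0, ← ENNReal.rpow_mul, mul_one_div_cancel hr0.ne',
          ENNReal.rpow_one, hS, mul_assoc]
  have hLp : ∫⁻ x, ‖g x‖ₑ ^ r ≤ (A * F) ^ r := by
    calc ∫⁻ x, ‖g x‖ₑ ^ r ≤ ∫⁻ x, A ^ (r - 1) * ∫⁻ y, ‖K y‖ₑ * ‖f (x - y)‖ₑ ^ r := by
          refine lintegral_mono fun x => ?_
          have := (hg x).trans (dy_holder hr1 _ _ hKm hfm x)
          calc ‖g x‖ₑ ^ r ≤ _ := ENNReal.rpow_le_rpow this hr0.le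
            _ = (∫⁻ y, ‖K y‖ₑ) ^ (r - 1) * ∫⁻ y, ‖K y‖ₑ * ‖f (x - y)‖ₑ ^ r := by
              rw [ENNReal.mul_rpow_of_nonneg _ _ hr0.le, ← ENNReal.rpow_mul, ← ENNReal.rpow_mul,
                one_div_mul_cancel hr0.ne', ENNReal.rpow_one]
              congr 2
              field_simp
            _ ≤ _ := by
              gcongr
      _ = A ^ (r - 1) * ∫⁻ x, ∫⁻ y, ‖K y‖ₑ * ‖f (x - y)‖ₑ ^ r := by
          refine lintegral_const_mul _ ?_
          refine Measurable.lintegral_prod_right' (f := fun z : EuclideanSpace ℝ (Fin d) × EuclideanSpace ℝ (Fin d) => ‖K z.2‖ₑ * ‖f (z.1 - z.2)‖ₑ ^ r) ?_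
          exact (hKm.comp measurable_snd).mul
            ((hfm.comp (measurable_fst.sub measurable_snd)).pow_const r)
      _ = A ^ (r - 1) * ∫⁻ y, ∫⁻ x, ‖K y‖ₑ * ‖f (x - y)‖ₑ ^ r := by
          rw [lintegral_lintegral_swap]
          exact ((hKm.comp measurable_snd).mul
            ((hfm.comp (measurable_fst.sub measurable_snd)).pow_const r)).aemeasurable
      _ = A ^ (r - 1) * ∫⁻ y, ‖K y‖ₑ * F ^ r := by
          congr 1
          refine lintegral_congr fun y => ?_
          have hfx : Measurable fun x => ‖f (x - y)‖ₑ :=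
            hfm.comp (measurable_id.sub measurable_const)
          rw [lintegral_const_mul _ (hfx.pow_const r),
            lintegral_sub_right_eq_self (fun x => ‖f x‖ₑ ^ r) y, hFr]
      _ = A ^ (r - 1) * ((∫⁻ y, ‖K y‖ₑ) * F ^ r) := by rw [lintegral_mul_const _ hKm]
      _ ≤ A ^ (r - 1) * (A * F ^ r) := by gcongr
      _ = (A * F) ^ r := by
          rw [ENNReal.mul_rpow_of_nonneg _ _ hr0.le, ← mul_assoc]
          congr 1
          conv_rhs => rw [show r = (r - 1) + 1 by ring,
            ENNReal.rpow_add_of_nonneg _ _ (by linarith) zero_le_one, ENNReal.rpow_one]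
  rcases eq_or_ne q ∞ with rfl | hqt
  · rw [eLpNorm_exponent_top, hri]
    simp only [ENNReal.inv_top, ENNReal.toReal_zero, sub_zero]
    exact eLpNormEssSup_le_of_ae_enorm_bound (Filter.Eventually.of_forall hsup)
  have hq0 : q ≠ 0 := (zero_lt_one.trans_le (hp.trans hpq)).ne'
  set t := q.toReal with ht
  have hrt : r ≤ t := ENNReal.toReal_mono hqt hpq
  have ht0 : 0 < t := by linarith
  have hti : q⁻¹.toReal = 1 / t := by rw [ENNReal.toReal_inv, one_div]
  rw [hri, hti, eLpNorm_eq_lintegral_rpow_enorm_toReal hq0 hqt, ← ht]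
  have hθ : 0 ≤ 1 / r - 1 / t := by
    have := one_div_le_one_div_of_le hr0 hrt; linarith
  have ht0' : 0 ≤ 1 / t := by positivity
  have hrt1 : r / t ≤ 1 := by rw [div_le_one ht0]; exact hrt
  have hrt0 : 0 ≤ r / t := by positivity
  rcases eq_or_ne F ∞ with hFt | hFt
  · rw [hFt, ENNReal.mul_top]
    · exact le_top
    · exact mul_ne_zero (ENNReal.rpow_pos (pos_iff_ne_zero.2 hA0) hAt).ne'
        (ENNReal.rpow_pos (pos_iff_ne_zero.2 hB0) hBt).ne'
  have hSt : S ^ (t - r) ≠ ∞ := by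
    refine ENNReal.rpow_ne_top_of_nonneg (by linarith) ?_
    exact ENNReal.mul_ne_top (ENNReal.mul_ne_top (ENNReal.rpow_ne_top_of_nonneg h1 hAt)
      (ENNReal.rpow_ne_top_of_nonneg h0 hBt)) hFt
  calc (∫⁻ x, ‖g x‖ₑ ^ t) ^ (1 / t) ≤ (∫⁻ x, S ^ (t - r) * ‖g x‖ₑ ^ r) ^ (1 / t) := by
        gcongr with x
        calc ‖g x‖ₑ ^ t = ‖g x‖ₑ ^ (t - r) * ‖g x‖ₑ ^ r := by
              rw [← ENNReal.rpow_add_of_nonneg _ _ (by linarith) hr0.le]; simp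
          _ ≤ _ := by
            gcongr
            exact hsup x
    _ ≤ (S ^ (t - r) * (A * F) ^ r) ^ (1 / t) := by
        have : ∫⁻ x, S ^ (t - r) * ‖g x‖ₑ ^ r ≤ S ^ (t - r) * (A * F) ^ r := by
          rw [lintegral_const_mul' _ _ hSt]; gcongr
        gcongr
    _ = A ^ (1 - (1 / r - 1 / t)) * B ^ (1 / r - 1 / t) * F := by
        have e1 : (t - r) * (1 / t) = 1 - r / t := by field_simp
        have e2 : r * (1 / t) = r / t := by ring
        have e0 : 0 ≤ 1 - r / t := by linarith
        rw [ENNReal.mul_rpow_of_nonneg _ _ ht0', ← ENNReal.rpow_mul, ← ENNReal.rpow_mul, e1, e2,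
          hS, ENNReal.mul_rpow_of_nonneg _ _ hrt0, ENNReal.mul_rpow_of_nonneg _ _ e0,
          ENNReal.mul_rpow_of_nonneg _ _ e0, ← ENNReal.rpow_mul, ← ENNReal.rpow_mul]
        have e3 : A ^ (1 - (1 / r - 1 / t)) = A ^ ((1 - 1 / r) * (1 - r / t)) * A ^ (r / t) := by
          rw [← ENNReal.rpow_add_of_nonneg _ _ (mul_nonneg h1 e0) hrt0]
          congr 1; field_simp; ring
        have e4 : (1 / r) * (1 - r / t) = 1 / r - 1 / t := by field_simp
        have e5 : F = F ^ (1 - r / t) * F ^ (r / t) := by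
          rw [← ENNReal.rpow_add_of_nonneg _ _ e0 hrt0]; simp
        rw [e3, e4]
        conv_rhs => rw [e5]
        ring

end partA

section partB
variable {d : ℕ}

lemma dy_continuous_fourierInv {v : EuclideanSpace ℝ (Fin d) → ℂ} (hv : Integrable v) :
    Continuous (𝓕⁻ v) := by
  have h : Continuous (𝓕 v) := by
    exact VectorFourier.fourierIntegral_continuous Real.continuous_fourierChar
      (by exact continuous_inner) hv
  have h2 : 𝓕⁻ v = fun x => 𝓕 v (-x) := by
    ext x; rw [Real.fourierInv_eq_fourier_neg]
  rw [h2]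
  exact h.comp continuous_neg

lemma dy_conv {K v : EuclideanSpace ℝ (Fin d) → ℂ} (hK : Integrable K) (hv : Integrable v)
    (x : EuclideanSpace ℝ (Fin d)) :
    𝓕⁻ (fun ξ => 𝓕 K ξ * v ξ) x = ∫ y, K y * 𝓕⁻ v (x - y) := by
  have hI : Integrable (Function.uncurry fun ξ y : EuclideanSpace ℝ (Fin d) =>
      ((𝐞 (inner ℝ ξ (x - y)) : Circle) : ℂ) * (v ξ * K y)) (volume.prod volume) := by
    refine Integrable.bdd_mul (c := 1) (hv.mul_prod hK) ?_ ?_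
    · refine Continuous.aestronglyMeasurable ?_
      have := Real.continuous_fourierChar
      fun_prop
    · exact Filter.Eventually.of_forall fun z => (Circle.norm_coe _).le
  calc 𝓕⁻ (fun ξ => 𝓕 K ξ * v ξ) x
      = ∫ ξ, ∫ y, ((𝐞 (inner ℝ ξ (x - y)) : Circle) : ℂ) * (v ξ * K y) := by
        rw [Real.fourierInv_eq]
        refine integral_congr_ae (Filter.Eventually.of_forall fun ξ => ?_)
        simp only [Real.fourier_eq, Circle.smul_def, smul_eq_mul]
        rw [mul_comm _ (v ξ), ← mul_assoc, ← integral_const_mul]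
        refine integral_congr_ae (Filter.Eventually.of_forall fun y => ?_)
        have hin : inner ℝ ξ (x - y) = inner ℝ ξ x + -inner ℝ y ξ := by
          rw [inner_sub_right, real_inner_comm y ξ]; ring
        simp only [hin, AddChar.map_add_eq_mul, Circle.coe_mul]
        ring
    _ = ∫ y, ∫ ξ, ((𝐞 (inner ℝ ξ (x - y)) : Circle) : ℂ) * (v ξ * K y) :=
        integral_integral_swap hI
    _ = ∫ y, K y * 𝓕⁻ v (x - y) := by
        refine integral_congr_ae (Filter.Eventually.of_forall fun y => ?_)
        simp only [Real.fourierInv_eq, Circle.smul_def, smul_eq_mul]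
        rw [← integral_const_mul]
        refine integral_congr_ae (Filter.Eventually.of_forall fun ξ => ?_)
        ring

open LineDeriv in
lemma dy_fourierInv_iter (n : ℕ) (e : EuclideanSpace ℝ (Fin d))
    (m : 𝓢(EuclideanSpace ℝ (Fin d), ℂ)) (x : EuclideanSpace ℝ (Fin d)) :
    ‖𝓕⁻ (∂^{fun _ : Fin n => e} m) x‖ = (2 * π * |inner ℝ x e|) ^ n * ‖𝓕⁻ m x‖ := by
  induction n with
  | zero => simp
  | succ n ih =>
    have : (inner ℝ · e : EuclideanSpace ℝ (Fin d) → ℝ).HasTemperateGrowth := by fun_prop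
    rw [iteratedLineDerivOp_succ_left, fourierInv_lineDerivOp_eq]
    have h : Fin.tail (fun _ : Fin (n + 1) => e) = fun _ : Fin n => e := rfl
    rw [h, smul_apply, SchwartzMap.smulLeftCLM_apply_apply this, norm_smul, norm_smul,
      ih]
    simp [abs_of_pos Real.pi_pos]
    ring

lemma dy_plancherel (m : 𝓢(EuclideanSpace ℝ (Fin d), ℂ)) :
    ∫ x, ‖𝓕⁻ m x‖ ^ 2 = ∫ x, ‖m x‖ ^ 2 := by
  rw [← integral_norm_sq_fourier (𝓕⁻ m)]
  simp

lemma dy_int_sq (m : 𝓢(EuclideanSpace ℝ (Fin d), ℂ)) :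
    Integrable (fun x => ‖m x‖ ^ 2) := by
  have := (m.memLp 2 volume).integrable_norm_pow (by norm_num)
  simpa using this

lemma dy_sq_bound (m : 𝓢(EuclideanSpace ℝ (Fin d), ℂ)) (ξ₀ : EuclideanSpace ℝ (Fin d))
    {R A : ℝ} (hR : 0 ≤ R) (h0 : ∀ ξ, R < ‖ξ - ξ₀‖ → m ξ = 0) (hb : ∀ ξ, ‖m ξ‖ ≤ A) (k : ℕ) :
    ∫ x, ‖m x‖ ^ k.succ ≤ A ^ k.succ * (R ^ d *
      (volume (Metric.ball (0 : EuclideanSpace ℝ (Fin d)) 1)).toReal) := by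
  have hs : Function.support (fun x => ‖m x‖ ^ k.succ) ⊆ Metric.closedBall ξ₀ R := by
    intro x hx
    by_contra hc
    rw [Metric.mem_closedBall, dist_eq_norm, not_le] at hc
    simp [h0 x hc] at hx
  rw [← setIntegral_eq_integral_of_forall_compl_eq_zero (s := Metric.closedBall ξ₀ R)
    (fun x hx => by_contra fun h => hx (hs h))]
  have hfin : volume (Metric.closedBall ξ₀ R) < ∞ := measure_closedBall_lt_top
  have := norm_setIntegral_le_of_norm_le_const (C := A ^ k.succ) (f := fun x => ‖m x‖ ^ k.succ) hfin
    (fun x _ => by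
      rw [Real.norm_of_nonneg (by positivity)]; gcongr; exact hb x)
  refine (le_abs_self _).trans (this.trans (le_of_eq ?_))
  rw [Measure.real, Measure.addHaar_closedBall _ _ hR]
  simp [ENNReal.toReal_mul, pow_nonneg hR]


lemma dy_norm_pow_le (n : ℕ) (x : EuclideanSpace ℝ (Fin d)) :
    ‖x‖ ^ (2 * (n + 1)) ≤ (d : ℝ) ^ n * ∑ i, |x i| ^ (2 * (n + 1)) := by
  rw [pow_mul, EuclideanSpace.norm_sq_eq]
  rcases Nat.eq_zero_or_pos d with rfl | hd
  · simp
  have h := pow_sum_div_card_le_sum_pow (s := (Finset.univ : Finset (Fin d)))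
    (f := fun i => ‖x i‖ ^ 2) (fun i _ => by positivity) n
  have hd' : (0 : ℝ) < (d : ℝ) ^ n := by positivity
  rw [Finset.card_univ, Fintype.card_fin, div_le_iff₀ hd', mul_comm] at h
  simpa [pow_mul] using h

lemma dy_core (hd : 1 ≤ d) (b : ℝ) (hb : 0 ≤ b) : ∃ C : ℝ, 0 < C ∧
    ∀ (l A : ℝ), 0 < l → 0 < A → ∀ (m : 𝓢(EuclideanSpace ℝ (Fin d), ℂ))
      (ξ₀ : EuclideanSpace ℝ (Fin d)),
      (∀ ξ, b * l < ‖ξ - ξ₀‖ → m ξ = 0) → (∀ ξ, ‖m ξ‖ ≤ A) →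
      (∀ ξ, ‖iteratedFDeriv ℝ (d / 2 + 1) m ξ‖ ≤ A * (l ^ (d / 2 + 1))⁻¹) →
      ∫⁻ x, ‖𝓕⁻ m x‖ₑ ≤ ENNReal.ofReal (C * A) ∧ ∀ x, ‖𝓕⁻ m x‖ ≤ C * A * l ^ d := by
  obtain ⟨n, hn⟩ : ∃ n, n = d / 2 := ⟨_, rfl⟩
  rw [← hn]
  have hnd : d < 2 * (n + 1) := by omega
  set V := b ^ d * (volume (Metric.ball (0 : EuclideanSpace ℝ (Fin d)) 1)).toReal with hV
  have hV0 : 0 ≤ V := by positivity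
  have hJi : Integrable (fun x : EuclideanSpace ℝ (Fin d) => (1 + ‖x‖) ^ (-((2 * (n + 1) : ℕ) : ℝ))) :=
    integrable_one_add_norm (by simpa using (by exact_mod_cast hnd))
  set J := ∫ x : EuclideanSpace ℝ (Fin d), (1 + ‖x‖) ^ (-((2 * (n + 1) : ℕ) : ℝ)) with hJ
  have hJ0 : 0 ≤ J := integral_nonneg fun x => by positivity
  set c1 : ℝ := 2 ^ (2 * (n + 1) - 1) with hc1
  set c2 : ℝ := c1 * (V + d ^ n * (d * V)) with hc2
  have hc10 : 0 < c1 := by positivity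
  have hc20 : 0 ≤ c2 := by positivity
  refine ⟨J + c2 + V + 1, by positivity, ?_⟩
  intro l A hl hA m ξ₀ hsupp hm0 hmN
  have hbl : 0 ≤ b * l := by positivity
  constructor
  · set H : Fin d → 𝓢(EuclideanSpace ℝ (Fin d), ℂ) := fun i =>
      LineDeriv.iteratedLineDerivOp (fun _ : Fin (n + 1) => EuclideanSpace.single i (1 : ℝ)) m with hH
    have hI0 : ∫ x, ‖𝓕⁻ m x‖ ^ 2 ≤ A ^ 2 * (l ^ d * V) := by
      rw [dy_plancherel]
      refine (dy_sq_bound m ξ₀ hbl hsupp hm0 1).trans (le_of_eq ?_)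
      rw [hV, mul_pow]; simp only [Nat.succ_eq_add_one]; ring
    have hIi : ∀ i, ∫ x, ‖𝓕⁻ (H i) x‖ ^ 2 ≤ (A * (l ^ (n + 1))⁻¹) ^ 2 * (l ^ d * V) := fun i => by
      rw [dy_plancherel]
      refine (dy_sq_bound (H i) ξ₀ (A := A * (l ^ (n + 1))⁻¹) hbl ?_ ?_ 1).trans (le_of_eq ?_)
      · intro ξ hξ
        have h1 : tsupport m ⊆ Metric.closedBall ξ₀ (b * l) := by
          refine closure_minimal (fun x hx => ?_) Metric.isClosed_closedBall
          by_contra hc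
          rw [Metric.mem_closedBall, dist_eq_norm, not_le] at hc
          exact hx (hsupp x hc)
        by_contra hc
        have h2 := h1 (tsupport_iteratedLineDerivOp_subset _ m (subset_tsupport _ hc))
        rw [Metric.mem_closedBall, dist_eq_norm] at h2
        linarith
      · intro ξ
        rw [hH]
        simp only [iteratedLineDerivOp_eq_iteratedFDeriv]
        refine (ContinuousMultilinearMap.le_opNorm _ _).trans ?_
        simpa using hmN ξ
      · rw [hV, mul_pow]; simp only [Nat.succ_eq_add_one]; ring
    set G : EuclideanSpace ℝ (Fin d) → ℝ := fun x =>
      A * l ^ d * (1 + ‖l • x‖) ^ (-((2 * (n + 1) : ℕ) : ℝ)) + (A * l ^ d)⁻¹ *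
        (c1 * (‖𝓕⁻ m x‖ ^ 2 + l ^ (2 * (n + 1)) * (d ^ n * ∑ i, ‖𝓕⁻ (H i) x‖ ^ 2))) with hG
    have hKG : ∀ x, ‖𝓕⁻ m x‖ ≤ G x := fun x => by
      have hw : 0 < (1 + ‖l • x‖) ^ (2 * (n + 1)) := by positivity
      have hwb : (1 + ‖l • x‖) ^ (2 * (n + 1)) * ‖𝓕⁻ m x‖ ^ 2 ≤
          c1 * (‖𝓕⁻ m x‖ ^ 2 + l ^ (2 * (n + 1)) * (d ^ n * ∑ i, ‖𝓕⁻ (H i) x‖ ^ 2)) := by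
        have h1 := add_pow_le zero_le_one (norm_nonneg (l • x)) (2 * (n + 1))
        have h2 : ∀ i, |x i| ^ (2 * (n + 1)) * ‖𝓕⁻ m x‖ ^ 2 ≤ ‖𝓕⁻ (H i) x‖ ^ 2 := fun i => by
          rw [hH, dy_fourierInv_iter, mul_pow, ← pow_mul, mul_comm (n + 1) 2]
          gcongr
          have : inner ℝ x (EuclideanSpace.single i (1 : ℝ)) = x i := by
            simp [EuclideanSpace.inner_single_right]
          rw [this]
          have := Real.pi_gt_three
          nlinarith [abs_nonneg (x i)]
        calc (1 + ‖l • x‖) ^ (2 * (n + 1)) * ‖𝓕⁻ m x‖ ^ 2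
            ≤ c1 * (1 ^ (2 * (n + 1)) + ‖l • x‖ ^ (2 * (n + 1))) * ‖𝓕⁻ m x‖ ^ 2 := by gcongr
          _ = c1 * (‖𝓕⁻ m x‖ ^ 2 + l ^ (2 * (n + 1)) * (‖x‖ ^ (2 * (n + 1)) * ‖𝓕⁻ m x‖ ^ 2)) := by
            rw [norm_smul, Real.norm_of_nonneg hl.le, mul_pow, one_pow]; ring
          _ ≤ c1 * (‖𝓕⁻ m x‖ ^ 2 + l ^ (2 * (n + 1)) *
              ((d ^ n * ∑ i, |x i| ^ (2 * (n + 1))) * ‖𝓕⁻ m x‖ ^ 2)) := by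
            gcongr; exact dy_norm_pow_le n x
          _ ≤ _ := by
            rw [mul_assoc, Finset.sum_mul]
            gcongr with i
            exact h2 i
      have hB : 0 < A * l ^ d := by positivity
      rw [hG]
      simp only [Real.rpow_neg (by positivity : (0:ℝ) ≤ 1 + ‖l • x‖), Real.rpow_natCast]
      refine le_trans ?_ (add_le_add le_rfl (mul_le_mul_of_nonneg_left hwb (by positivity)))
      generalize (1 + ‖l • x‖) ^ (2 * (n + 1)) = w at *
      generalize ‖𝓕⁻ m x‖ = k at *
      generalize A * l ^ d = B at *
      have : B * w⁻¹ + B⁻¹ * (w * k ^ 2) - k = ((B - w * k / 2) ^ 2 + 3 / 4 * (w * k) ^ 2) / (B * w) := by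
        field_simp; ring
      have h3 : 0 ≤ ((B - w * k / 2) ^ 2 + 3 / 4 * (w * k) ^ 2) / (B * w) := by positivity
      linarith
    have hscale : ∫ x : EuclideanSpace ℝ (Fin d), (1 + ‖l • x‖) ^ (-((2 * (n + 1) : ℕ) : ℝ)) =
        (l ^ d)⁻¹ * J := by
      rw [Measure.integral_comp_smul volume (fun x : EuclideanSpace ℝ (Fin d) => (1 + ‖x‖) ^ (-((2 * (n + 1) : ℕ) : ℝ))) l]
      simp [abs_of_pos hl, hJ]
    have hi1 : Integrable fun x : EuclideanSpace ℝ (Fin d) =>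
        (1 + ‖l • x‖) ^ (-((2 * (n + 1) : ℕ) : ℝ)) := by
      exact (integrable_comp_smul_iff volume (fun x : EuclideanSpace ℝ (Fin d) => (1 + ‖x‖) ^ (-((2 * (n + 1) : ℕ) : ℝ))) hl.ne').2 hJi
    have hi2 : Integrable fun x => ‖𝓕⁻ m x‖ ^ 2 := dy_int_sq _
    have hi3 : Integrable fun x => ∑ i, ‖𝓕⁻ (H i) x‖ ^ 2 :=
      integrable_finsetSum _ fun i _ => dy_int_sq _
    have hi4 := hi2.add ((hi3.const_mul ((d:ℝ) ^ n)).const_mul (l ^ (2 * (n + 1))))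
    have hi5 := (hi4.const_mul c1).const_mul (A * l ^ d)⁻¹
    have hi6 := hi1.const_mul (A * l ^ d)
    have hGi : Integrable G := hi6.add hi5
    have hGint : ∫ x, G x ≤ (J + c2) * A := by
      have e1 : ∫ x, G x = A * l ^ d * ((l ^ d)⁻¹ * J) + (A * l ^ d)⁻¹ * (c1 * ((∫ x, ‖𝓕⁻ m x‖ ^ 2) +
          l ^ (2 * (n + 1)) * (d ^ n * ∑ i, ∫ x, ‖𝓕⁻ (H i) x‖ ^ 2))) := by
        have f1 := integral_add hi6 hi5
        have f2 := integral_add hi2 ((hi3.const_mul ((d:ℝ) ^ n)).const_mul (l ^ (2 * (n + 1))))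
        rw [integral_const_mul, integral_const_mul, integral_const_mul, hscale] at f1
        rw [integral_const_mul, integral_const_mul,
          integral_finsetSum _ fun i _ => dy_int_sq (𝓕⁻ (H i))] at f2
        rw [← f2]
        exact f1
      rw [e1]
      calc _ ≤ A * l ^ d * ((l ^ d)⁻¹ * J) + (A * l ^ d)⁻¹ * (c1 * (A ^ 2 * (l ^ d * V) +
          l ^ (2 * (n + 1)) * (d ^ n * ∑ i : Fin d, (A * (l ^ (n + 1))⁻¹) ^ 2 * (l ^ d * V)))) := by
            gcongr with i
            exact hIi i
        _ = (J + c2) * A := by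
            rw [Finset.sum_const, Finset.card_univ, Fintype.card_fin, nsmul_eq_mul, hc2]
            field_simp
            ring
    rw [← ofReal_integral_norm_eq_lintegral_enorm (𝓕⁻ m).integrable]
    refine ENNReal.ofReal_le_ofReal ?_
    calc ∫ x, ‖𝓕⁻ m x‖ ≤ ∫ x, G x := integral_mono (𝓕⁻ m).integrable.norm hGi hKG
      _ ≤ (J + c2) * A := hGint
      _ ≤ _ := mul_le_mul_of_nonneg_right (by linarith) hA.le
  · intro x
    have h1 : ‖𝓕⁻ m x‖ ≤ ∫ ξ, ‖m ξ‖ := by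
      rw [fourierInv_coe, Real.fourierInv_eq]
      refine (norm_integral_le_integral_norm _).trans (le_of_eq ?_)
      simp
    have h2 := dy_sq_bound m ξ₀ hbl hsupp hm0 0
    simp only [Nat.succ_eq_add_one, zero_add, pow_one] at h2
    calc ‖𝓕⁻ m x‖ ≤ _ := h1.trans h2
      _ = V * A * l ^ d := by rw [hV, mul_pow]; ring
      _ ≤ _ := by gcongr; linarith

end partB

section partC
variable {d : ℕ}

lemma dy_leibniz {F : Type*} [NormedAddCommGroup F] [NormedSpace ℝ F]
    {U : Set (EuclideanSpace ℝ (Fin d))} (hU : IsOpen U) {N : ℕ}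
    {f : EuclideanSpace ℝ (Fin d) → ℝ} {g : EuclideanSpace ℝ (Fin d) → F}
    (hf : ContDiffOn ℝ N f U) (hg : ContDiffOn ℝ N g U) {ξ : EuclideanSpace ℝ (Fin d)}
    (hξ : ξ ∈ U) {A B L : ℝ} (hA : 0 ≤ A) (hB : 0 ≤ B) (hL : 0 < L)
    (h1 : ∀ n ≤ N, ‖iteratedFDeriv ℝ n f ξ‖ ≤ A * (L ^ n)⁻¹)
    (h2 : ∀ n ≤ N, ‖iteratedFDeriv ℝ n g ξ‖ ≤ B * (L ^ n)⁻¹) :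
    ∀ n ≤ N, ‖iteratedFDeriv ℝ n (fun x => f x • g x) ξ‖ ≤ 2 ^ N * A * B * (L ^ n)⁻¹ := by
  intro n hn
  have h := norm_iteratedFDerivWithin_smul_le hf hg hU.uniqueDiffOn hξ (n := n)
    (by exact_mod_cast hn)
  rw [iteratedFDerivWithin_of_isOpen n hU hξ] at h
  refine h.trans ?_
  calc _ ≤ ∑ i ∈ Finset.range (n + 1), (n.choose i : ℝ) * (A * B * (L ^ n)⁻¹) := by
        refine Finset.sum_le_sum fun i hi => ?_
        have hi' : i ≤ n := Nat.lt_succ_iff.1 (Finset.mem_range.1 hi)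
        rw [iteratedFDerivWithin_of_isOpen i hU hξ, iteratedFDerivWithin_of_isOpen (n - i) hU hξ,
          mul_assoc]
        have e : (L ^ n)⁻¹ = (L ^ i)⁻¹ * (L ^ (n - i))⁻¹ := by
          rw [← mul_inv, ← pow_add, Nat.add_sub_cancel' hi']
        calc _ ≤ (n.choose i : ℝ) * ((A * (L ^ i)⁻¹) * (B * (L ^ (n - i))⁻¹)) := by
              gcongr
              · exact h1 i (hi'.trans hn)
              · exact h2 (n - i) (by omega)
          _ = _ := by rw [e]; ring
    _ = 2 ^ n * A * B * (L ^ n)⁻¹ := by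
        rw [← Finset.sum_mul, ← Nat.cast_sum, Nat.sum_range_choose]; push_cast; ring
    _ ≤ _ := by
        gcongr
        norm_num

lemma dy_normsq_deriv (k : ℝ) (hk : 0 < k) (ξ : EuclideanSpace ℝ (Fin d)) (L : ℝ) (hL : 0 < L)
    (hkL : k = (L ^ 2)⁻¹) (hξ : ‖ξ‖ ≤ L) :
    ∀ i, 1 ≤ i → ‖iteratedFDeriv ℝ i (fun ζ : EuclideanSpace ℝ (Fin d) => k * (1 + ‖ζ‖ ^ 2)) ξ‖ ≤
      (2 / L) ^ i := by
  intro i hi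
  obtain ⟨i, rfl⟩ : ∃ j, i = j + 1 := ⟨i - 1, by omega⟩
  set T : EuclideanSpace ℝ (Fin d) →L[ℝ] (EuclideanSpace ℝ (Fin d) →L[ℝ] ℝ) :=
    (k * 2) • innerSL ℝ with hT
  have hTa : ∀ x y, T x y = k * 2 * inner ℝ x y := fun x y => rfl
  have hTn : ‖T‖ ≤ k * 2 := by
    refine T.opNorm_le_bound₂ (by positivity) fun x y => ?_
    rw [hTa, norm_mul, Real.norm_of_nonneg (by positivity), mul_assoc (k * 2)]
    gcongr
    exact norm_inner_le_norm x y
  have hfd : fderiv ℝ (fun ζ : EuclideanSpace ℝ (Fin d) => k * (1 + ‖ζ‖ ^ 2)) = T := by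
    ext1 x
    have h1 : HasFDerivAt (fun ζ : EuclideanSpace ℝ (Fin d) => k * (1 + ‖ζ‖ ^ 2))
        (k • (2 • innerSL ℝ x)) x :=
      ((hasStrictFDerivAt_norm_sq x).hasFDerivAt.const_add 1).const_mul k
    rw [h1.fderiv]
    ext y
    rw [hTa]
    simp
    ring
  rw [← norm_iteratedFDeriv_fderiv, hfd]
  rcases i with _ | i
  · simp only [norm_iteratedFDeriv_zero, zero_add, pow_one]
    calc ‖T ξ‖ ≤ ‖T‖ * ‖ξ‖ := T.le_opNorm ξ
      _ ≤ k * 2 * L := by gcongr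
      _ = 2 / L := by rw [hkL]; field_simp
  · rw [← norm_iteratedFDeriv_fderiv]
    have : fderiv ℝ T = fun _ => T := by ext1 x; exact T.fderiv
    rw [this]
    rcases i with _ | i
    · simp only [norm_iteratedFDeriv_zero]
      refine hTn.trans ?_
      rw [hkL, div_pow, div_eq_inv_mul]
      gcongr
      norm_num
    · rw [iteratedFDeriv_const_of_ne (by omega)]
      simp only [Pi.zero_apply, norm_zero]
      positivity

lemma dy_bracket (a : ℝ) (N : ℕ) : ∃ C : ℝ, 0 ≤ C ∧ ∀ n ≤ N, ∀ ξ : EuclideanSpace ℝ (Fin d),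
    ‖iteratedFDeriv ℝ n (fun ζ : EuclideanSpace ℝ (Fin d) => Real.sqrt (1 + ‖ζ‖ ^ 2) ^ a) ξ‖ ≤
      C * Real.sqrt (1 + ‖ξ‖ ^ 2) ^ a * (Real.sqrt (1 + ‖ξ‖ ^ 2) ^ n)⁻¹ := by
  set g : ℝ → ℝ := fun t => t ^ (a / 2) with hg
  set C := ∑ i ∈ Finset.range (N + 1), ‖iteratedFDerivWithin ℝ i g (Set.Ioi 0) 1‖ with hC
  have hC0 : 0 ≤ C := Finset.sum_nonneg fun i _ => norm_nonneg _
  refine ⟨N.factorial * C * 2 ^ N, by positivity, fun n hn ξ => ?_⟩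
  have hpos : ∀ ζ : EuclideanSpace ℝ (Fin d), 0 < 1 + ‖ζ‖ ^ 2 := fun ζ => by positivity
  set L := Real.sqrt (1 + ‖ξ‖ ^ 2) with hL
  have hL0 : 0 < L := Real.sqrt_pos.2 (hpos ξ)
  have hL2 : L ^ 2 = 1 + ‖ξ‖ ^ 2 := Real.sq_sqrt (hpos ξ).le
  have hξL : ‖ξ‖ ≤ L := Real.le_sqrt_of_sq_le (by linarith)
  set f : EuclideanSpace ℝ (Fin d) → ℝ := fun ζ => (L ^ 2)⁻¹ * (1 + ‖ζ‖ ^ 2) with hf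
  have hfξ : f ξ = 1 := by rw [hf]; simp only; rw [← hL2]; field_simp
  have hgc : ContDiffOn ℝ n g (Set.Ioi 0) := fun t ht =>
    (Real.contDiffAt_rpow_const_of_ne (ne_of_gt ht)).contDiffWithinAt
  have hfc : ContDiff ℝ n f := contDiff_const.mul (contDiff_const.add (contDiff_norm_sq ℝ))
  have hmaps : Set.MapsTo f Set.univ (Set.Ioi 0) := fun ζ _ => by
    have := hpos ζ
    simp only [hf, Set.mem_Ioi]; positivity
  have hcomp := norm_iteratedFDerivWithin_comp_le (n := n) hgc hfc.contDiffOn le_rfl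
    isOpen_Ioi.uniqueDiffOn uniqueDiffOn_univ hmaps (Set.mem_univ ξ) (C := C) (D := 2 / L) ?_ ?_
  · rw [iteratedFDerivWithin_univ] at hcomp
    have heq : (fun ζ : EuclideanSpace ℝ (Fin d) => Real.sqrt (1 + ‖ζ‖ ^ 2) ^ a) =
        fun ζ => L ^ a • (g ∘ f) ζ := by
      ext ζ
      simp only [hg, hf, Function.comp, smul_eq_mul]
      rw [Real.mul_rpow (by positivity) (hpos ζ).le, Real.sqrt_eq_rpow, ← Real.rpow_mul (hpos ζ).le,
        Real.inv_rpow (by positivity), ← Real.rpow_natCast L 2, ← Real.rpow_mul hL0.le]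
      have e1 : ((2:ℕ):ℝ) * (a / 2) = a := by push_cast; ring
      have e2 : 1 / 2 * a = a / 2 := by ring
      have : L ^ a ≠ 0 := (Real.rpow_pos_of_pos hL0 a).ne'
      rw [e1, e2]
      field_simp
    have hgf : ContDiff ℝ n (g ∘ f) := by
      rw [← contDiffOn_univ]; exact hgc.comp hfc.contDiffOn hmaps
    rw [heq, iteratedFDeriv_const_smul_apply' hgf.contDiffAt, norm_smul,
      Real.norm_of_nonneg (Real.rpow_nonneg hL0.le a)]
    have hLa := Real.rpow_nonneg hL0.le a
    calc L ^ a * ‖iteratedFDeriv ℝ n (g ∘ f) ξ‖ ≤ L ^ a * (n.factorial * C * (2 / L) ^ n) := by gcongr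
      _ = (n.factorial * C * 2 ^ n) * L ^ a * (L ^ n)⁻¹ := by rw [div_pow]; ring
      _ ≤ (N.factorial * C * 2 ^ N) * L ^ a * (L ^ n)⁻¹ := by
        gcongr
        norm_num
  · intro i hi
    rw [hfξ]
    exact Finset.single_le_sum (f := fun i => ‖iteratedFDerivWithin ℝ i g (Set.Ioi 0) 1‖)
      (fun i _ => norm_nonneg _) (Finset.mem_range.2 (by omega))
  · intro i hi _
    rw [iteratedFDerivWithin_univ]
    exact dy_normsq_deriv _ (by positivity) ξ L hL0 rfl hξL i hi

lemma dy_cpt_bound {F : Type*} [NormedAddCommGroup F] [NormedSpace ℝ F]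
    {f : EuclideanSpace ℝ (Fin d) → F} (hf : ContDiff ℝ (⊤ : ℕ∞) f) (hc : HasCompactSupport f)
    (w : EuclideanSpace ℝ (Fin d) → ℝ) (hw : Continuous w) (N : ℕ) :
    ∃ C : ℝ, 0 ≤ C ∧ ∀ n ≤ N, ∀ ξ, ‖iteratedFDeriv ℝ n f ξ‖ * w ξ ^ n ≤ C := by
  have h : ∀ n : ℕ, ∃ C : ℝ, ∀ ξ, ‖iteratedFDeriv ℝ n f ξ‖ * w ξ ^ n ≤ C := fun n => by
    have h1 : Continuous fun ξ => ‖iteratedFDeriv ℝ n f ξ‖ * w ξ ^ n :=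
      (hf.continuous_iteratedFDeriv (by exact_mod_cast le_top)).norm.mul (hw.pow n)
    have h2 : HasCompactSupport fun ξ => ‖iteratedFDeriv ℝ n f ξ‖ * w ξ ^ n :=
      (hc.iteratedFDeriv n).norm.mul_right
    obtain ⟨x, hx⟩ := h1.exists_forall_ge_of_hasCompactSupport h2
    exact ⟨_, hx⟩
  choose C hC using h
  refine ⟨∑ i ∈ Finset.range (N + 1), |C i|, Finset.sum_nonneg fun _ _ => abs_nonneg _, ?_⟩
  intro n hn ξ
  refine (hC n ξ).trans ((le_abs_self _).trans ?_)
  exact Finset.single_le_sum (f := fun i => |C i|) (fun _ _ => abs_nonneg _)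
    (Finset.mem_range.2 (by omega))

end partC

section partD
variable {d : ℕ}

lemma dy_sqrt_one_le (ξ : EuclideanSpace ℝ (Fin d)) : 1 ≤ Real.sqrt (1 + ‖ξ‖ ^ 2) :=
  Real.le_sqrt_of_sq_le (by nlinarith [sq_nonneg ‖ξ‖])

lemma dy_sqrt_le (ξ : EuclideanSpace ℝ (Fin d)) : Real.sqrt (1 + ‖ξ‖ ^ 2) ≤ 1 + ‖ξ‖ :=
  Real.sqrt_le_iff.2 ⟨by positivity, by nlinarith [norm_nonneg ξ]⟩

lemma dy_le_sqrt (ξ : EuclideanSpace ℝ (Fin d)) : ‖ξ‖ ≤ Real.sqrt (1 + ‖ξ‖ ^ 2) :=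
  Real.le_sqrt_of_sq_le (by linarith)

/-- the symbol `(1 - τ) / P` -/
lemma dy_symbol (s ε C₀ : ℝ) (hε : 0 < ε) (hC₀ : 0 < C₀)
    (τ : EuclideanSpace ℝ (Fin d) → ℝ) (hτ : ContDiff ℝ (⊤ : ℕ∞) τ)
    (hτc : HasCompactSupport τ)
    (U : Set (EuclideanSpace ℝ (Fin d))) (hU : IsOpen U)
    (hUsupp : tsupport (fun ξ => 1 - τ ξ) ⊆ U)
    (P : EuclideanSpace ℝ (Fin d) → ℝ)
    (hPsmooth : ContDiffOn ℝ (⊤ : ℕ∞) P U) (hPne : ∀ ξ ∈ U, P ξ ≠ 0)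
    (hQ1 : ∀ ξ ∈ U, ∀ n : ℕ, n ≤ d / 2 →
      ‖iteratedFDeriv ℝ n (fun ζ => Real.sqrt (1 + ‖ζ‖ ^ 2) ^ s / P ζ) ξ‖ ≤
        C₀ * Real.sqrt (1 + ‖ξ‖ ^ 2) ^ (-(n : ℝ)))
    (hQ2 : ∀ ξ ∈ U,
      ‖iteratedFDeriv ℝ (d / 2 + 1) (fun ζ => Real.sqrt (1 + ‖ζ‖ ^ 2) ^ s / P ζ) ξ‖ ≤
        C₀ * Real.sqrt (1 + ‖ξ‖ ^ 2) ^ (-ε - ((d / 2 + 1 : ℕ) : ℝ))) :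
    ContDiff ℝ (⊤ : ℕ∞) (fun ξ => (1 - τ ξ) * (P ξ)⁻¹) ∧
    ∃ C : ℝ, 0 ≤ C ∧ ∀ n ≤ d / 2 + 1, ∀ ξ,
      ‖iteratedFDeriv ℝ n (fun ξ => (1 - τ ξ) * (P ξ)⁻¹) ξ‖ ≤
        C * Real.sqrt (1 + ‖ξ‖ ^ 2) ^ (-s) * (Real.sqrt (1 + ‖ξ‖ ^ 2) ^ n)⁻¹ := by
  have hzero : ∀ ξ, ξ ∉ U → (fun ξ => (1 - τ ξ) * (P ξ)⁻¹) =ᶠ[nhds ξ] fun _ => 0 := by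
    intro ξ hξ
    have h1 := notMem_tsupport_iff_eventuallyEq.1 fun h => hξ (hUsupp h)
    filter_upwards [h1] with x hx
    have hx' : 1 - τ x = 0 := hx
    rw [hx', zero_mul]
  have h1τ : ContDiff ℝ (⊤ : ℕ∞) fun ξ => 1 - τ ξ := contDiff_const.sub hτ
  constructor
  · rw [contDiff_iff_contDiffAt]
    intro ξ
    by_cases hξ : ξ ∈ U
    · exact h1τ.contDiffAt.mul
        ((hPsmooth.contDiffAt (hU.mem_nhds hξ)).inv (hPne ξ hξ))
    · exact contDiffAt_const.congr_of_eventuallyEq (hzero ξ hξ)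
  have hJc : Continuous fun ξ : EuclideanSpace ℝ (Fin d) => Real.sqrt (1 + ‖ξ‖ ^ 2) := by fun_prop
  obtain ⟨C1, hC1, hb1⟩ := dy_bracket (d := d) (-s) (d / 2 + 1)
  obtain ⟨C2, hC2, hb2⟩ := dy_cpt_bound hτ hτc _ hJc (d / 2 + 1)
  have hsm : ∀ a : ℝ, ContDiff ℝ (⊤ : ℕ∞)
      fun ζ : EuclideanSpace ℝ (Fin d) => Real.sqrt (1 + ‖ζ‖ ^ 2) ^ a := fun a => by
    have hp : ∀ ζ : EuclideanSpace ℝ (Fin d), 1 + ‖ζ‖ ^ 2 ≠ 0 := fun ζ => by positivity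
    refine ContDiff.rpow_const_of_ne ?_ fun ζ => (zero_lt_one.trans_le (dy_sqrt_one_le ζ)).ne'
    exact (contDiff_const.add (contDiff_norm_sq ℝ)).sqrt hp
  refine ⟨2 ^ (d / 2 + 1) * (1 + C2) * (2 ^ (d / 2 + 1) * C1 * C₀), by positivity, ?_⟩
  intro n hn ξ
  set L := Real.sqrt (1 + ‖ξ‖ ^ 2) with hL
  have hL1 : 1 ≤ L := dy_sqrt_one_le ξ
  have hL0 : 0 < L := by linarith
  have hLs : 0 ≤ L ^ (-s) := Real.rpow_nonneg hL0.le _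
  by_cases hξ : ξ ∈ U
  · have hQsm : ContDiffOn ℝ (d / 2 + 1 : ℕ) (fun ζ => Real.sqrt (1 + ‖ζ‖ ^ 2) ^ s / P ζ) U :=
      (((hsm s).contDiffOn.div hPsmooth hPne)).of_le (by exact_mod_cast le_top)
    have hQ : ∀ n ≤ d / 2 + 1, ‖iteratedFDeriv ℝ n (fun ζ => Real.sqrt (1 + ‖ζ‖ ^ 2) ^ s / P ζ) ξ‖ ≤
        C₀ * (L ^ n)⁻¹ := by
      intro n hn
      rcases Nat.lt_or_ge (d / 2) n with h | h
      · obtain rfl : n = d / 2 + 1 := by omega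
        refine (hQ2 ξ hξ).trans ?_
        gcongr
        have e : (L ^ (d / 2 + 1))⁻¹ = L ^ (-((d / 2 + 1 : ℕ) : ℝ)) := by
          rw [Real.rpow_neg hL0.le, Real.rpow_natCast]
        rw [e]
        exact Real.rpow_le_rpow_of_exponent_le hL1 (by linarith)
      · refine (hQ1 ξ hξ n h).trans (le_of_eq ?_)
        rw [Real.rpow_neg hL0.le, Real.rpow_natCast]
    have step1 := dy_leibniz hU (f := fun ζ => Real.sqrt (1 + ‖ζ‖ ^ 2) ^ (-s))
      ((hsm (-s)).contDiffOn.of_le (by exact_mod_cast le_top)) hQsm hξ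
      (mul_nonneg hC1 hLs) hC₀.le hL0 (fun n hn => hb1 n hn ξ) hQ
    have hτb : ∀ n ≤ d / 2 + 1, ‖iteratedFDeriv ℝ n (fun ξ => 1 - τ ξ) ξ‖ ≤ (1 + C2) * (L ^ n)⁻¹ := by
      intro n hn
      have hb := hb2 n hn ξ
      rw [← div_eq_mul_inv, le_div_iff₀ (by positivity)]
      rcases Nat.eq_zero_or_pos n with rfl | hn0
      · simp only [norm_iteratedFDeriv_zero, pow_zero, mul_one] at hb ⊢
        calc ‖1 - τ ξ‖ ≤ ‖(1:ℝ)‖ + ‖τ ξ‖ := norm_sub_le _ _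
          _ ≤ _ := by simpa using hb
      · have : iteratedFDeriv ℝ n (fun ξ => 1 - τ ξ) ξ = - iteratedFDeriv ℝ n τ ξ := by
          have e : (fun ξ => 1 - τ ξ) = (fun _ => (1:ℝ)) - τ := rfl
          rw [e, iteratedFDeriv_sub_apply contDiff_const.contDiffAt
            (hτ.contDiffAt.of_le (by exact_mod_cast le_top)), iteratedFDeriv_const_of_ne (by omega)]
          simp
        rw [this, norm_neg]
        linarith
    have step2 := dy_leibniz hU (f := fun ξ => 1 - τ ξ)
      (h1τ.contDiffOn.of_le (by exact_mod_cast le_top))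
      (((hsm (-s)).contDiffOn.of_le (by exact_mod_cast le_top)).smul hQsm) hξ (by positivity)
      (by positivity) hL0 hτb step1 n hn
    have heq : (fun ξ => (1 - τ ξ) * (P ξ)⁻¹) = fun ξ => (1 - τ ξ) •
        (Real.sqrt (1 + ‖ξ‖ ^ 2) ^ (-s) • (Real.sqrt (1 + ‖ξ‖ ^ 2) ^ s / P ξ)) := by
      ext x
      have hx : 0 < Real.sqrt (1 + ‖x‖ ^ 2) := zero_lt_one.trans_le (dy_sqrt_one_le x)
      have := (Real.rpow_pos_of_pos hx s).ne'
      rw [Real.rpow_neg hx.le, smul_eq_mul, smul_eq_mul, ← mul_div_assoc, inv_mul_cancel₀ this,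
        one_div]
    rw [heq]
    refine step2.trans (le_of_eq ?_)
    ring
  · rw [((hzero ξ hξ).iteratedFDeriv ℝ n).eq_of_nhds]
    have : iteratedFDeriv ℝ n (fun _ : EuclideanSpace ℝ (Fin d) => (0:ℝ)) ξ = 0 := by
      simp
    rw [this, norm_zero]
    positivity

lemma dy_eta (η : ℝ → ℂ) (hη : ContDiff ℝ (⊤ : ℕ∞) η) (hηc : HasCompactSupport η)
    (hη0 : (0 : ℝ) ∉ tsupport η) :
    ∃ a b : ℝ, 0 < a ∧ a ≤ 1 ∧ 0 < b ∧ (∀ t, 0 ≤ t → η t ≠ 0 → a ≤ t ∧ t ≤ b) := by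
  have h1 := notMem_tsupport_iff_eventuallyEq.1 hη0
  obtain ⟨r, hr, hr'⟩ := Metric.eventually_nhds_iff.1 h1
  obtain ⟨b, hb⟩ := hηc.isCompact.isBounded.exists_norm_le
  refine ⟨min r 1, max b 1, by positivity, min_le_right _ _, by positivity, fun t ht hne => ⟨?_, ?_⟩⟩
  · by_contra hc
    refine hne (hr' ?_)
    rw [dist_zero_right, Real.norm_of_nonneg ht]
    exact (not_le.1 hc).trans_le (min_le_left _ _)
  · have := hb t (subset_tsupport _ hne)
    rw [Real.norm_of_nonneg ht] at this
    exact this.trans (le_max_left _ _)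

lemma dy_phi (η : ℝ → ℂ) (hη : ContDiff ℝ (⊤ : ℕ∞) η) (hηc : HasCompactSupport η)
    (hη0 : (0 : ℝ) ∉ tsupport η) :
    ContDiff ℝ (⊤ : ℕ∞) (fun ζ : EuclideanSpace ℝ (Fin d) => η ‖ζ‖) ∧
    HasCompactSupport (fun ζ : EuclideanSpace ℝ (Fin d) => η ‖ζ‖) := by
  obtain ⟨a, b, ha, -, hb, hab⟩ := dy_eta η hη hηc hη0
  constructor
  · rw [contDiff_iff_contDiffAt]
    intro ξ
    by_cases hξ : ξ = 0
    · have : (fun ζ : EuclideanSpace ℝ (Fin d) => η ‖ζ‖) =ᶠ[nhds ξ] fun _ => 0 := by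
        filter_upwards [Metric.ball_mem_nhds ξ ha] with x hx
        by_contra hc
        have := (hab _ (norm_nonneg x) hc).1
        rw [hξ, mem_ball_zero_iff] at hx
        linarith
      exact contDiffAt_const.congr_of_eventuallyEq this
    · exact hη.contDiffAt.comp ξ (contDiffAt_norm ℝ hξ)
  · refine HasCompactSupport.intro (isCompact_closedBall 0 b) fun x hx => ?_
    by_contra hc
    exact hx (mem_closedBall_zero_iff.2 (hab _ (norm_nonneg x) hc).2)

lemma dy_rpow_comp {c c' l J t : ℝ} (hc : 0 < c) (hc' : 0 < c') (hl : 0 < l)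
    (h1 : c * l ≤ J) (h2 : J ≤ c' * l) : J ^ t ≤ (c ^ t + c' ^ t) * l ^ t := by
  have hJ : 0 < J := (mul_pos hc hl).trans_le h1
  have p1 := Real.rpow_pos_of_pos hc t
  have p2 := Real.rpow_pos_of_pos hc' t
  have p3 := Real.rpow_pos_of_pos hl t
  rcases le_total 0 t with ht | ht
  · have := Real.rpow_le_rpow hJ.le h2 ht
    rw [Real.mul_rpow hc'.le hl.le] at this
    nlinarith
  · have := Real.rpow_le_rpow_of_nonpos (mul_pos hc hl) h1 ht
    rw [Real.mul_rpow hc.le hl.le] at this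
    nlinarith

lemma dy_mult (s : ℝ) (N : ℕ) (R : EuclideanSpace ℝ (Fin d) → ℝ) (hR : ContDiff ℝ (⊤ : ℕ∞) R)
    (C : ℝ) (hC : 0 ≤ C) (hRb : ∀ n ≤ N, ∀ ξ, ‖iteratedFDeriv ℝ n R ξ‖ ≤
        C * Real.sqrt (1 + ‖ξ‖ ^ 2) ^ (-s) * (Real.sqrt (1 + ‖ξ‖ ^ 2) ^ n)⁻¹)
    (ξ₀ : EuclideanSpace ℝ (Fin d)) (hR0 : ∀ᶠ ξ in nhds ξ₀, R ξ = 0)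
    (η : ℝ → ℂ) (hη : ContDiff ℝ (⊤ : ℕ∞) η) (hηc : HasCompactSupport η)
    (hη0 : (0 : ℝ) ∉ tsupport η) :
    ∃ b C' : ℝ, 0 < b ∧ 0 < C' ∧ ∀ l : ℝ, 0 < l →
      ContDiff ℝ (⊤ : ℕ∞) (fun ξ => R ξ • η (l⁻¹ * ‖ξ - ξ₀‖)) ∧
      (∀ ξ, b * l < ‖ξ - ξ₀‖ → R ξ • η (l⁻¹ * ‖ξ - ξ₀‖) = 0) ∧
      ∀ n ≤ N, ∀ ξ, ‖iteratedFDeriv ℝ n (fun ξ => R ξ • η (l⁻¹ * ‖ξ - ξ₀‖)) ξ‖ ≤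
        C' * l ^ (-s) * (l ^ n)⁻¹ := by
  obtain ⟨a, b, ha, ha1, hb, hab⟩ := dy_eta η hη hηc hη0
  obtain ⟨hΦ, hΦc⟩ := dy_phi (d := d) η hη hηc hη0
  obtain ⟨C2, hC2, hb2⟩ := dy_cpt_bound hΦ hΦc (fun _ => 1) continuous_const N
  obtain ⟨r, hr, hr'⟩ := Metric.eventually_nhds_iff.1 hR0
  set c := a / (1 + ‖ξ₀‖) with hc
  set c' := ((1 + ‖ξ₀‖) / r + 1) * b with hc'
  have hc0 : 0 < c := by positivity
  have hc1 : c ≤ 1 := by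
    rw [hc, div_le_one (by positivity)]; linarith [norm_nonneg ξ₀]
  have hc'0 : 0 < c' := by positivity
  have hcs : 0 < c ^ (-s) + c' ^ (-s) := by positivity
  refine ⟨b, 2 ^ N * (C * (c ^ (-s) + c' ^ (-s)) * (c ^ N)⁻¹) * C2 + 1, hb, by positivity, ?_⟩
  intro l hl
  have hηeq : (fun ξ => η (l⁻¹ * ‖ξ - ξ₀‖)) = fun ξ => (fun z => η ‖l⁻¹ • z‖) (ξ - ξ₀) := by
    ext ξ
    simp only
    rw [norm_smul, Real.norm_of_nonneg (by positivity)]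
  have hηsm : ContDiff ℝ (⊤ : ℕ∞) (fun ξ => η (l⁻¹ * ‖ξ - ξ₀‖)) := by
    rw [hηeq]
    have h : ContDiff ℝ (⊤ : ℕ∞) fun ξ : EuclideanSpace ℝ (Fin d) => l⁻¹ • (ξ - ξ₀) :=
      (contDiff_id.sub contDiff_const).const_smul l⁻¹
    exact hΦ.comp h
  have hηb : ∀ n ≤ N, ∀ ξ, ‖iteratedFDeriv ℝ n (fun ξ => η (l⁻¹ * ‖ξ - ξ₀‖)) ξ‖ ≤ C2 * (l ^ n)⁻¹ := by
    intro n hn ξ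
    rw [hηeq, iteratedFDeriv_comp_sub (f := fun z => η ‖l⁻¹ • z‖) n ξ₀ ξ,
      iteratedFDeriv_comp_const_smul (f := fun z : EuclideanSpace ℝ (Fin d) => η ‖z‖) l⁻¹
        (hΦ.of_le (by exact_mod_cast le_top)), norm_smul, norm_pow,
      Real.norm_of_nonneg (by positivity), inv_pow, mul_comm]
    gcongr
    simpa using hb2 n hn (l⁻¹ • (ξ - ξ₀))
  have hanu : ∀ ξ, η (l⁻¹ * ‖ξ - ξ₀‖) ≠ 0 → a * l ≤ ‖ξ - ξ₀‖ ∧ ‖ξ - ξ₀‖ ≤ b * l := by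
    intro ξ hξ
    obtain ⟨h1, h2⟩ := hab _ (by positivity) hξ
    rw [← div_eq_inv_mul] at h1 h2
    exact ⟨(le_div_iff₀ hl).1 h1, (div_le_iff₀ hl).1 h2⟩
  refine ⟨hR.smul hηsm, ?_, ?_⟩
  · intro ξ hξ
    have : η (l⁻¹ * ‖ξ - ξ₀‖) = 0 := by
      by_contra h
      linarith [(hanu ξ h).2]
    rw [this, smul_zero]
  · intro n hn ξ
    have hls := Real.rpow_pos_of_pos hl (-s)
    by_cases hξ : ξ ∈ tsupport (fun ξ => R ξ • η (l⁻¹ * ‖ξ - ξ₀‖))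
    · have hsub : tsupport (fun ξ => R ξ • η (l⁻¹ * ‖ξ - ξ₀‖)) ⊆
          {x | a * l ≤ ‖x - ξ₀‖ ∧ ‖x - ξ₀‖ ≤ b * l ∧ r ≤ ‖x - ξ₀‖} := by
        refine closure_minimal (fun x hx => ?_) ?_
        · have h1 : R x ≠ 0 := fun h => hx (by simp [h])
          have h2 : η (l⁻¹ * ‖x - ξ₀‖) ≠ 0 := fun h => hx (by simp [h])
          refine ⟨(hanu x h2).1, (hanu x h2).2, ?_⟩
          by_contra h
          exact h1 (hr' (by rw [dist_eq_norm]; exact not_le.1 h))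
        · have hcont : Continuous fun x => ‖x - ξ₀‖ := by fun_prop
          exact (isClosed_le continuous_const hcont).inter
            ((isClosed_le hcont continuous_const).inter (isClosed_le continuous_const hcont))
      obtain ⟨h1, h2, h3⟩ := hsub hξ
      set J := Real.sqrt (1 + ‖ξ‖ ^ 2) with hJ
      have hJ1 : 1 ≤ J := dy_sqrt_one_le ξ
      have hJl : c * l ≤ J := by
        rw [hc, div_mul_eq_mul_div, div_le_iff₀ (by positivity)]
        have := norm_sub_le ξ ξ₀
        have := dy_le_sqrt ξ
        nlinarith [norm_nonneg ξ₀]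
      have hJu : J ≤ c' * l := by
        have e1 : J ≤ 1 + ‖ξ‖ := dy_sqrt_le ξ
        have e2 : ‖ξ‖ ≤ ‖ξ - ξ₀‖ + ‖ξ₀‖ := by simpa using norm_add_le (ξ - ξ₀) ξ₀
        have e3 : 1 + ‖ξ₀‖ ≤ (1 + ‖ξ₀‖) / r * ‖ξ - ξ₀‖ := by
          rw [div_mul_eq_mul_div, le_div_iff₀ hr]
          gcongr
        calc J ≤ ((1 + ‖ξ₀‖) / r + 1) * ‖ξ - ξ₀‖ := by linarith
          _ ≤ ((1 + ‖ξ₀‖) / r + 1) * (b * l) := by gcongr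
          _ = c' * l := by rw [hc']; ring
      have hJs := dy_rpow_comp (t := -s) hc0 hc'0 hl hJl hJu
      have hRξ : ∀ n ≤ N, ‖iteratedFDeriv ℝ n R ξ‖ ≤
          (C * ((c ^ (-s) + c' ^ (-s)) * l ^ (-s)) * (c ^ N)⁻¹) * (l ^ n)⁻¹ := by
        intro n hn
        refine (hRb n hn ξ).trans ?_
        have hcl : 0 < c * l := by positivity
        calc C * J ^ (-s) * (J ^ n)⁻¹
            ≤ C * ((c ^ (-s) + c' ^ (-s)) * l ^ (-s)) * ((c * l) ^ n)⁻¹ := by gcongr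
          _ = C * ((c ^ (-s) + c' ^ (-s)) * l ^ (-s)) * (c ^ n)⁻¹ * (l ^ n)⁻¹ := by
            rw [mul_pow, mul_inv]; ring
          _ ≤ _ := by
            have : c ^ N ≤ c ^ n := pow_le_pow_of_le_one hc0.le hc1 hn
            gcongr
      have := dy_leibniz isOpen_univ (hR.contDiffOn.of_le (by exact_mod_cast le_top))
        (hηsm.contDiffOn.of_le (by exact_mod_cast le_top)) (Set.mem_univ ξ) (by positivity) hC2 hl
        hRξ (fun n hn => hηb n hn ξ) n hn
      refine this.trans ?_
      have hle : 0 ≤ l ^ (-s) * (l ^ n)⁻¹ := by positivity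
      nlinarith
    · have : iteratedFDeriv ℝ n (fun ξ => R ξ • η (l⁻¹ * ‖ξ - ξ₀‖)) ξ = 0 := by
        by_contra h
        exact hξ (support_iteratedFDeriv_subset n h)
      rw [this, norm_zero]
      positivity

lemma dy_Pu_integrable (M C₀ : ℝ) (P : EuclideanSpace ℝ (Fin d) → ℝ) (hPmeas : Measurable P)
    (hPbd : ∀ ξ, |P ξ| ≤ C₀ * Real.sqrt (1 + ‖ξ‖ ^ 2) ^ M) (hC₀ : 0 < C₀)
    (v : SchwartzMap (EuclideanSpace ℝ (Fin d)) ℂ) :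
    Integrable fun ξ => ((P ξ : ℝ) : ℂ) * v ξ := by
  obtain ⟨k, hk⟩ := exists_nat_ge M
  have h1 : Integrable fun ξ => C₀ * (2 ^ (k - 1) * (‖ξ‖ ^ 0 * ‖v ξ‖ + ‖ξ‖ ^ k * ‖v ξ‖)) :=
    (((v.integrable_pow_mul volume 0).add (v.integrable_pow_mul volume k)).const_mul _).const_mul _
  refine h1.mono' ?_ (Filter.Eventually.of_forall fun ξ => ?_)
  · exact ((Complex.measurable_ofReal.comp hPmeas).mul v.continuous.measurable).aestronglyMeasurable
  · rw [norm_mul, Complex.norm_real, Real.norm_eq_abs]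
    have h2 : Real.sqrt (1 + ‖ξ‖ ^ 2) ^ M ≤ 2 ^ (k - 1) * (1 ^ k + ‖ξ‖ ^ k) := by
      calc Real.sqrt (1 + ‖ξ‖ ^ 2) ^ M ≤ Real.sqrt (1 + ‖ξ‖ ^ 2) ^ (k : ℝ) :=
            Real.rpow_le_rpow_of_exponent_le (dy_sqrt_one_le ξ) hk
        _ = Real.sqrt (1 + ‖ξ‖ ^ 2) ^ k := Real.rpow_natCast _ _
        _ ≤ (1 + ‖ξ‖) ^ k := by gcongr; exact dy_sqrt_le ξ
        _ ≤ _ := add_pow_le zero_le_one (norm_nonneg ξ) k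
    calc |P ξ| * ‖v ξ‖ ≤ C₀ * (2 ^ (k - 1) * (1 ^ k + ‖ξ‖ ^ k)) * ‖v ξ‖ := by
          gcongr
          exact (hPbd ξ).trans (by gcongr)
      _ = _ := by rw [one_pow]; ring

end partD

lemma dy_final {c l s θ t : ℝ} (d : ℕ) (j : ℤ) (hc : 0 < c) (ht : t = 1 - θ)
    (hl : l = ((2:ℝ) ^ j)⁻¹) :
    ENNReal.ofReal (c * l ^ (-s)) ^ t * ENNReal.ofReal (c * l ^ (-s) * l ^ d) ^ θ =
      ENNReal.ofReal (c * (2:ℝ) ^ ((j:ℝ) * (s - d * θ))) := by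
  have hl0 : 0 < l := by rw [hl]; positivity
  have e : l = (2:ℝ) ^ (-(j:ℝ)) := by
    rw [hl, Real.rpow_neg (by norm_num), Real.rpow_intCast]
  have hA : 0 < c * l ^ (-s) := by positivity
  have hB : 0 < l ^ d := by positivity
  rw [ENNReal.ofReal_rpow_of_pos hA, ENNReal.ofReal_rpow_of_pos (by positivity),
    ← ENNReal.ofReal_mul (by positivity), Real.mul_rpow hA.le hB.le, ← mul_assoc,
    ← Real.rpow_add hA, ht, sub_add_cancel, Real.rpow_one, mul_assoc]
  congr 2
  rw [← Real.rpow_natCast, ← Real.rpow_mul hl0.le, ← Real.rpow_add hl0, e,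
    ← Real.rpow_mul (by norm_num)]
  congr 1; ring


end DyAux

/-- Dyadic estimates in the large frequency regime (Proposition `prop:dyadicEstimatesI`). -/
theorem dyadic_estimates_large_frequencies
    (d : ℕ) (hd : 1 ≤ d) (s ε M C₀ : ℝ) (hε : 0 < ε) (hC₀ : 0 < C₀)
    (τ : EuclideanSpace ℝ (Fin d) → ℝ) (hτ : ContDiff ℝ (⊤ : ℕ∞) τ)
    (hτc : HasCompactSupport τ)
    (ξ₀ : EuclideanSpace ℝ (Fin d)) (hτ1 : ∀ᶠ ξ in nhds ξ₀, τ ξ = 1)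
    (U : Set (EuclideanSpace ℝ (Fin d))) (hU : IsOpen U)
    (hUsupp : tsupport (fun ξ => 1 - τ ξ) ⊆ U)
    (P : EuclideanSpace ℝ (Fin d) → ℝ) (hPmeas : Measurable P)
    (hPbd : ∀ ξ, |P ξ| ≤ C₀ * Real.sqrt (1 + ‖ξ‖ ^ 2) ^ M)
    (hPsmooth : ContDiffOn ℝ (⊤ : ℕ∞) P U) (hPne : ∀ ξ ∈ U, P ξ ≠ 0)
    (hQ1 : ∀ ξ ∈ U, ∀ n : ℕ, n ≤ d / 2 →
      ‖iteratedFDeriv ℝ n (fun ζ => Real.sqrt (1 + ‖ζ‖ ^ 2) ^ s / P ζ) ξ‖ ≤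
        C₀ * Real.sqrt (1 + ‖ξ‖ ^ 2) ^ (-(n : ℝ)))
    (hQ2 : ∀ ξ ∈ U,
      ‖iteratedFDeriv ℝ (d / 2 + 1) (fun ζ => Real.sqrt (1 + ‖ζ‖ ^ 2) ^ s / P ζ) ξ‖ ≤
        C₀ * Real.sqrt (1 + ‖ξ‖ ^ 2) ^ (-ε - ((d / 2 + 1 : ℕ) : ℝ)))
    (η : ℝ → ℂ) (hη : ContDiff ℝ (⊤ : ℕ∞) η) (hηc : HasCompactSupport η)
    (hη0 : (0 : ℝ) ∉ tsupport η)
    (p q : ℝ≥0∞) (hp : 1 ≤ p) (hpq : p ≤ q) :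
    ∃ C : ℝ, 0 < C ∧ ∀ (j : ℤ) (u : SchwartzMap (EuclideanSpace ℝ (Fin d)) ℂ),
      eLpNorm (fun x =>
          𝓕⁻ (fun ξ => η ((2 : ℝ) ^ j * ‖ξ - ξ₀‖) * ((1 - τ ξ : ℝ) : ℂ) * 𝓕 (⇑u) ξ) x) q volume ≤
        ENNReal.ofReal (C * (2 : ℝ) ^ ((j : ℝ) * (s - d * (p⁻¹.toReal - q⁻¹.toReal)))) *
        eLpNorm (fun x => 𝓕⁻ (fun ξ => ((P ξ : ℝ) : ℂ) * 𝓕 (⇑u) ξ) x) p volume := by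
  obtain ⟨hR, CR, hCR, hRb⟩ := dy_symbol s ε C₀ hε hC₀ τ hτ hτc U hU hUsupp P hPsmooth hPne hQ1 hQ2
  obtain ⟨b, C', hb, hC', hm⟩ := dy_mult s (d / 2 + 1) _ hR CR hCR hRb ξ₀
    (by filter_upwards [hτ1] with ξ hξ; simp [hξ]) η hη hηc hη0
  obtain ⟨Cc, hCc, hcore⟩ := dy_core hd b hb.le
  refine ⟨Cc * C', by positivity, fun j u => ?_⟩
  set l : ℝ := ((2:ℝ) ^ j)⁻¹ with hl
  have hl0 : 0 < l := by positivity
  have hlinv : l⁻¹ = (2:ℝ) ^ j := by rw [hl, inv_inv]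
  obtain ⟨hsm, hsupp, hder⟩ := hm l hl0
  have hcs : HasCompactSupport
      (fun ξ => ((1 - τ ξ) * (P ξ)⁻¹) • η (l⁻¹ * ‖ξ - ξ₀‖)) := by
    refine HasCompactSupport.intro (isCompact_closedBall ξ₀ (b * l)) fun ξ hξ => ?_
    apply hsupp
    rw [← dist_eq_norm]
    simpa [Metric.mem_closedBall] using hξ
  let m : SchwartzMap (EuclideanSpace ℝ (Fin d)) ℂ := hcs.toSchwartzMap hsm
  have hmc : ∀ ξ, m ξ = ((1 - τ ξ) * (P ξ)⁻¹) • η (l⁻¹ * ‖ξ - ξ₀‖) := fun ξ => rfl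
  have hls := Real.rpow_pos_of_pos hl0 (-s)
  obtain ⟨hK1, hKinf⟩ := hcore l (C' * l ^ (-s)) hl0 (by positivity) m ξ₀
    (fun ξ hξ => hsupp ξ hξ)
    (fun ξ => by
      have h := hder 0 (Nat.zero_le _) ξ
      rw [norm_iteratedFDeriv_zero, pow_zero, inv_one, mul_one] at h
      exact h)
    (fun ξ => hder (d / 2 + 1) le_rfl ξ)
  let K : SchwartzMap (EuclideanSpace ℝ (Fin d)) ℂ := 𝓕⁻ m
  have hKm : 𝓕 (K : EuclideanSpace ℝ (Fin d) → ℂ) = m := by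
    rw [← SchwartzMap.fourier_coe]
    simp [K]
  have hv : Integrable (fun ξ => ((P ξ : ℝ) : ℂ) * 𝓕 (⇑u) ξ) := by
    rw [← SchwartzMap.fourier_coe]
    exact dy_Pu_integrable M C₀ P hPmeas hPbd hC₀ (𝓕 u)
  have hfun : (fun ξ => η ((2 : ℝ) ^ j * ‖ξ - ξ₀‖) * ((1 - τ ξ : ℝ) : ℂ) * 𝓕 (⇑u) ξ) =
      fun ξ => 𝓕 (K : EuclideanSpace ℝ (Fin d) → ℂ) ξ * (((P ξ : ℝ) : ℂ) * 𝓕 (⇑u) ξ) := by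
    ext ξ
    rw [hKm, hmc, hlinv, Complex.real_smul]
    by_cases h : 1 - τ ξ = 0
    · simp [h]
    · have hP : P ξ ≠ 0 := hPne ξ (hUsupp (subset_tsupport _ h))
      have hPc : ((P ξ : ℝ) : ℂ) ≠ 0 := by exact_mod_cast hP
      push_cast
      field_simp
  rw [hfun]
  have key := dy_young p q hp hpq K (𝓕⁻ (fun ξ => ((P ξ : ℝ) : ℂ) * 𝓕 (⇑u) ξ))
    (fun x => 𝓕⁻ (fun ξ => 𝓕 (K : EuclideanSpace ℝ (Fin d) → ℂ) ξ *
      (((P ξ : ℝ) : ℂ) * 𝓕 (⇑u) ξ)) x) K.continuous (dy_continuous_fourierInv hv)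
    (ENNReal.ofReal (Cc * C' * l ^ (-s))) (ENNReal.ofReal (Cc * C' * l ^ (-s) * l ^ d))
    (by rw [mul_assoc]; exact hK1)
    (fun y => by
      rw [← ofReal_norm, mul_assoc Cc]
      exact ENNReal.ofReal_le_ofReal (hKinf y))
    (by simpa using by positivity) ENNReal.ofReal_ne_top
    (by simpa using by positivity) ENNReal.ofReal_ne_top
    (fun x => by
      rw [dy_conv K.integrable hv x]
      refine (enorm_integral_le_lintegral_enorm _).trans (le_of_eq ?_)
      simp_rw [enorm_mul])
  rw [dy_final d j (by positivity) rfl hl] at key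
  exact key
end
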